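/- arXiv:2405.15543 — 2 statements merged into one kernel-verified Lean document; each statement's English description precedes it below -/
import Mathlib

section
/- For every finite simple graph H, the following four statements are equivalent, where 𝒢 denotes the class of all finite simple graphs that do not contain any induced subdivision of H: (1) 𝒢 is tame; (2) 𝒢 is not feral; (3) H is isomorphic to an induced subgraph of 2P_2, the diamond, or the house; (4) H is an induced topological minor of 2P_2 or of the house. -/
open SimpleGraph

/-! ### Minimal separators, tame and feral classes -/

/-- `S` separates `a` from `b` in `G`: `a, b` lie in distinct connected components of `G − S`,
i.e. every walk from `a` to `b` meets `S`. -/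
def Separates {V : Type} (G : SimpleGraph V) (S : Set V) (a b : V) : Prop :=
  ∀ p : G.Walk a b, ∃ x ∈ p.support, x ∈ S

/-- `S` is a minimal separator of `G`: some nonadjacent pair `a, b` outside `S` lies in distinct
components of `G − S`, while for every proper subset `S' ⊊ S` they lie in the same component
of `G − S'`. -/
def IsMinimalSeparator {V : Type} (G : SimpleGraph V) (S : Set V) : Prop :=
  ∃ a b : V, a ∉ S ∧ b ∉ S ∧ a ≠ b ∧ ¬ G.Adj a b ∧ Separates G S a b ∧
    ∀ S' : Set V, S' ⊂ S → ¬ Separates G S' a b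

/-- The number of minimal separators of a graph on `Fin n`. -/
noncomputable def numMinSep {n : ℕ} (G : SimpleGraph (Fin n)) : ℕ :=
  {S : Set (Fin n) | IsMinimalSeparator G S}.ncard

/-- A class of finite simple graphs (one collection for each number of vertices) is tame if
some polynomial bounds the number of minimal separators of all its members. -/
def Tame (𝒢 : ∀ n : ℕ, SimpleGraph (Fin n) → Prop) : Prop :=
  ∃ p : Polynomial ℕ, ∀ (n : ℕ) (G : SimpleGraph (Fin n)), 𝒢 n G → numMinSep G ≤ p.eval n

/-- A class of finite simple graphs is feral if for some real `c > 1` there are infinitely many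
graphs `G` in the class with at least `c ^ |V(G)|` minimal separators. -/
def Feral (𝒢 : ∀ n : ℕ, SimpleGraph (Fin n) → Prop) : Prop :=
  ∃ c : ℝ, 1 < c ∧ ∀ N : ℕ, ∃ n : ℕ, N ≤ n ∧
    ∃ G : SimpleGraph (Fin n), 𝒢 n G ∧ (c ^ n : ℝ) ≤ (numMinSep G : ℝ)

/-! ### Minors and induced minors via models -/

/-- An induced minor model of `H` in `G`. -/
def IsInducedMinorModel {V W : Type} (G : SimpleGraph V) (H : SimpleGraph W)
    (X : W → Set V) : Prop :=
  (∀ w, (X w).Nonempty) ∧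
  (∀ w, (G.induce (X w)).Connected) ∧
  (Pairwise fun u w => Disjoint (X u) (X w)) ∧
  (∀ u w, H.Adj u w → ∃ a ∈ X u, ∃ b ∈ X w, G.Adj a b) ∧
  (∀ u w, u ≠ w → ¬ H.Adj u w → ∀ a ∈ X u, ∀ b ∈ X w, ¬ G.Adj a b)

/-- `H` is an induced minor of `G`. -/
def InducedMinor {V W : Type} (H : SimpleGraph W) (G : SimpleGraph V) : Prop :=
  ∃ X : W → Set V, IsInducedMinorModel G H X

/-- A minor model of `H` in `G` (edges between branch sets of nonadjacent vertices allowed). -/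
def IsMinorModel {V W : Type} (G : SimpleGraph V) (H : SimpleGraph W)
    (X : W → Set V) : Prop :=
  (∀ w, (X w).Nonempty) ∧
  (∀ w, (G.induce (X w)).Connected) ∧
  (Pairwise fun u w => Disjoint (X u) (X w)) ∧
  (∀ u w, H.Adj u w → ∃ a ∈ X u, ∃ b ∈ X w, G.Adj a b)

/-- `H` is a minor of `G`. -/
def IsMinorOf {V W : Type} (H : SimpleGraph W) (G : SimpleGraph V) : Prop :=
  ∃ X : W → Set V, IsMinorModel G H X

/-! ### Subdivisions -/

/-- The graph obtained from `H` by subdividing the edge `uv`: the new vertex is `none`, it is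
joined to `u` and `v`, the edge `uv` is removed and everything else is unchanged. -/
def subdivideEdge {W : Type} (H : SimpleGraph W) (u v : W) : SimpleGraph (Option W) :=
  SimpleGraph.fromRel fun x y =>
    (∃ a b : W, x = some a ∧ y = some b ∧ H.Adj a b ∧ ¬(a = u ∧ b = v) ∧ ¬(a = v ∧ b = u)) ∨
    (x = none ∧ (y = some u ∨ y = some v))

/-- `Subdivision H H'` holds when `H'` is obtained from `H` by repeatedly subdividing edges. -/
inductive Subdivision : {A : Type} → SimpleGraph A → {B : Type} → SimpleGraph B → Prop where
  | refl {A : Type} (G : SimpleGraph A) : Subdivision G G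
  | step {A : Type} {G : SimpleGraph A} {B : Type} {H : SimpleGraph B} {u v : B} :
      Subdivision G H → H.Adj u v → Subdivision G (subdivideEdge H u v)

/-- `G` contains an induced subdivision of `H`, i.e. `H` is an induced topological minor
of `G`: some subdivision of `H` is isomorphic to an induced subgraph of `G`. -/
def ContainsInducedSubdivision {A V : Type} (H : SimpleGraph A) (G : SimpleGraph V) : Prop :=
  ∃ (B : Type) (H' : SimpleGraph B), Subdivision H H' ∧ Nonempty (H' ↪g G)

/-! ### Particular graphs -/

/-- `2P₂`: the disjoint union of two edges. -/
def twoP2 : SimpleGraph (Fin 4) :=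
  SimpleGraph.fromRel fun v w => (v = 0 ∧ w = 1) ∨ (v = 2 ∧ w = 3)

/-- The diamond: `K₄` minus the edge `03`. -/
def diamond : SimpleGraph (Fin 4) :=
  SimpleGraph.fromRel fun v w => ¬(v = 0 ∧ w = 3) ∧ ¬(v = 3 ∧ w = 0)

/-- The butterfly: two triangles `{0,1,2}` and `{0,3,4}` sharing the vertex `0`. -/
def butterfly : SimpleGraph (Fin 5) :=
  SimpleGraph.fromRel fun v w =>
    (v = 0 ∧ w = 1) ∨ (v = 0 ∧ w = 2) ∨ (v = 1 ∧ w = 2) ∨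
    (v = 0 ∧ w = 3) ∨ (v = 0 ∧ w = 4) ∨ (v = 3 ∧ w = 4)

/-- The house: the `5`-cycle `0-1-2-3-4-0` together with the chord `03`. -/
def house : SimpleGraph (Fin 5) :=
  SimpleGraph.fromRel fun v w =>
    (v = 0 ∧ w = 1) ∨ (v = 1 ∧ w = 2) ∨ (v = 2 ∧ w = 3) ∨
    (v = 3 ∧ w = 4) ∨ (v = 0 ∧ w = 4) ∨ (v = 0 ∧ w = 3)

/-- `K₃ + P₁`: a triangle together with an isolated vertex. -/
def k3PlusP1 : SimpleGraph (Fin 4) :=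
  SimpleGraph.fromRel fun v w => (v = 0 ∧ w = 1) ∨ (v = 0 ∧ w = 2) ∨ (v = 1 ∧ w = 2)

/-- The (short) `k`-theta: vertices `a = inl 0`, `b = inl 1`, `aᵢ = inr (i, 0)`,
`bᵢ = inr (i, 1)`, with edges `a aᵢ`, `aᵢ bᵢ`, `bᵢ b`. -/
def thetaGraph (k : ℕ) : SimpleGraph (Fin 2 ⊕ Fin k × Fin 2) :=
  SimpleGraph.fromRel fun v w =>
    (∃ i, v = Sum.inl 0 ∧ w = Sum.inr (i, 0)) ∨
    (∃ i, v = Sum.inl 1 ∧ w = Sum.inr (i, 1)) ∨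
    (∃ i, v = Sum.inr (i, 0) ∧ w = Sum.inr (i, 1))

/-- The (short) `k`-prism: two `k`-cliques `{(i,0)}` and `{(i,1)}` with a perfect matching. -/
def prismGraph (k : ℕ) : SimpleGraph (Fin k × Fin 2) :=
  SimpleGraph.fromRel fun v w => (v.2 = w.2 ∧ v.1 ≠ w.1) ∨ (v.1 = w.1 ∧ v.2 ≠ w.2)

/-- The `k`-skinny ladder: paths `p_i = (i,0)`, `q_i = (i,1)`, independent set `r_i = (i,2)`,
with edges `p_i p_{i+1}`, `q_i q_{i+1}`, `p_i r_i`, `q_i r_i`. -/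
def skinnyLadder (k : ℕ) : SimpleGraph (Fin k × Fin 3) :=
  SimpleGraph.fromRel fun v w =>
    (v.2 = w.2 ∧ v.2 ≠ 2 ∧ w.1.val = v.1.val + 1) ∨
    (v.1 = w.1 ∧ v.2 ≠ 2 ∧ w.2 = 2)

/-- `gammaGraph p q r` is the graph `Γ` consisting of two vertices `a = inl 0` and `b = inl 1`
joined by three internally disjoint paths with `p`, `q`, `r` internal vertices respectively
(so of lengths `p+1`, `q+1`, `r+1`); i.e. `Γ_{p+1, q+1, r+1}`. -/
def gammaGraph (p q r : ℕ) : SimpleGraph (Fin 2 ⊕ (Fin p ⊕ (Fin q ⊕ Fin r))) :=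
  SimpleGraph.fromRel fun v w =>
    match v, w with
    | Sum.inl x, Sum.inl y => x = 0 ∧ y = 1 ∧ (p = 0 ∨ q = 0 ∨ r = 0)
    | Sum.inl x, Sum.inr (Sum.inl t) => (x = 0 ∧ t.val = 0) ∨ (x = 1 ∧ t.val = p - 1)
    | Sum.inl x, Sum.inr (Sum.inr (Sum.inl t)) => (x = 0 ∧ t.val = 0) ∨ (x = 1 ∧ t.val = q - 1)
    | Sum.inl x, Sum.inr (Sum.inr (Sum.inr t)) => (x = 0 ∧ t.val = 0) ∨ (x = 1 ∧ t.val = r - 1)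
    | Sum.inr (Sum.inl t), Sum.inr (Sum.inl s) => s.val = t.val + 1
    | Sum.inr (Sum.inr (Sum.inl t)), Sum.inr (Sum.inr (Sum.inl s)) => s.val = t.val + 1
    | Sum.inr (Sum.inr (Sum.inr t)), Sum.inr (Sum.inr (Sum.inr s)) => s.val = t.val + 1
    | _, _ => False

/-- The long twin wheel on a cycle of length `n`: the cycle `0-1-⋯-(n-1)-0` on `Fin n`
together with a center adjacent exactly to the consecutive vertices `0`, `1`, `2`. -/
def longTwinWheel (n : ℕ) : SimpleGraph (Fin n ⊕ Unit) :=
  SimpleGraph.fromRel fun v w =>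
    match v, w with
    | Sum.inl a, Sum.inl b => b.val = a.val + 1 ∨ (a.val = n - 1 ∧ b.val = 0)
    | Sum.inl a, Sum.inr _ => a.val = 0 ∨ a.val = 1 ∨ a.val = 2
    | _, _ => False

/-! ### Thin walks -/

/-- A thin walk in `H`: a walk whose vertices are pairwise distinct except that possibly the two
endpoints coincide, and all of whose internal vertices have degree `2` in `H`. -/
def IsThinWalk {V : Type} (H : SimpleGraph V) {x y : V} (p : H.Walk x y) : Prop :=
  p.support.tail.Nodup ∧ p.support.dropLast.Nodup ∧
    ∀ v ∈ p.support.tail.dropLast, (H.neighborSet v).ncard = 2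

/-! ### Creatures -/

/-- A `k`-creature in `G` on the pairwise disjoint nonempty vertex sets `A`, `B`, `X`, `Y`. -/
def IsCreature {V : Type} (G : SimpleGraph V) (k : ℕ) (A B X Y : Set V) : Prop :=
  A.Nonempty ∧ B.Nonempty ∧
  Disjoint A B ∧ Disjoint A X ∧ Disjoint A Y ∧ Disjoint B X ∧ Disjoint B Y ∧ Disjoint X Y ∧
  (G.induce A).Connected ∧ (G.induce B).Connected ∧
  (∀ a ∈ A, ∀ b ∈ B, ¬ G.Adj a b) ∧
  (∀ a ∈ A, ∀ y ∈ Y, ¬ G.Adj a y) ∧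
  (∀ b ∈ B, ∀ x ∈ X, ¬ G.Adj b x) ∧
  (∀ x ∈ X, ∃ a ∈ A, G.Adj x a) ∧
  (∀ y ∈ Y, ∃ b ∈ B, G.Adj y b) ∧
  ∃ (x : Fin k → V) (y : Fin k → V), Function.Injective x ∧ Function.Injective y ∧
    X = Set.range x ∧ Y = Set.range y ∧ ∀ i j, G.Adj (x i) (y j) ↔ i = j

/-- `G` is `k`-creature-free. -/
def CreatureFree {V : Type} (G : SimpleGraph V) (k : ℕ) : Prop :=
  ¬ ∃ A B X Y : Set V, IsCreature G k A B X Y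

/-! ### Distance to minor-closed classes, feedback vertex set number -/

/-- `cFam F G`: the least size of a vertex set `S` such that `G − S` has no minor isomorphic
to a member of the family `F`. -/
noncomputable def cFam {V : Type} (F : ∀ n : ℕ, SimpleGraph (Fin n) → Prop)
    (G : SimpleGraph V) : ℕ :=
  sInf {k | ∃ S : Set V, S.ncard = k ∧
    ∀ (n : ℕ) (H : SimpleGraph (Fin n)), F n H → ¬ IsMinorOf H (G.induce Sᶜ)}

/-- The feedback vertex set number of `G`. -/
noncomputable def fvs {V : Type} (G : SimpleGraph V) : ℕ :=
  sInf {k | ∃ S : Set V, S.ncard = k ∧ (G.induce Sᶜ).IsAcyclic}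

/-! ### Long unichords and long thetas -/

/-- `G` has a long unichord: an edge which is the unique chord of some cycle of length ≥ 5. -/
def HasLongUnichord {V : Type} (G : SimpleGraph V) : Prop :=
  ∃ (v : V) (c : G.Walk v v), c.IsCycle ∧ 5 ≤ c.length ∧
    ∃ a b : V, a ∈ c.support ∧ b ∈ c.support ∧ G.Adj a b ∧ s(a, b) ∉ c.edges ∧
      ∀ x y : V, x ∈ c.support → y ∈ c.support → G.Adj x y → s(x, y) ∉ c.edges →
        s(x, y) = s(a, b)

/-- `G` is long-theta-free: no induced subgraph of `G` is a theta `Γ_{i,j,k}` with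
`i, j, k ≥ 2` and at least one of `i, j, k` at least `3`. -/
def LongThetaFree {V : Type} (G : SimpleGraph V) : Prop :=
  ¬ ∃ i j k : ℕ, 2 ≤ i ∧ 2 ≤ j ∧ 2 ≤ k ∧ (3 ≤ i ∨ 3 ≤ j ∨ 3 ≤ k) ∧
    Nonempty (gammaGraph (i - 1) (j - 1) (k - 1) ↪g G)

section connectivity

variable {V : Type} {G : SimpleGraph V}

/-- `v` can be reached from `u` inside the vertex set `X`. -/
def ReachIn (G : SimpleGraph V) (X : Set V) : V → V → Prop :=
  Relation.ReflTransGen fun a b => G.Adj a b ∧ a ∈ X ∧ b ∈ X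

/-- The vertex set `X` is connected (or empty). -/
def IsConn (G : SimpleGraph V) (X : Set V) : Prop :=
  ∀ u ∈ X, ∀ v ∈ X, ReachIn G X u v

lemma ReachIn.mono {X Y : Set V} (h : X ⊆ Y) {u v : V} (hr : ReachIn G X u v) :
    ReachIn G Y u v := by
  induction hr with
  | refl => exact Relation.ReflTransGen.refl
  | tail _ hab ih => exact ih.tail ⟨hab.1, h hab.2.1, h hab.2.2⟩

lemma ReachIn.symm {X : Set V} {u v : V} (hr : ReachIn G X u v) : ReachIn G X v u := by
  induction hr with
  | refl => exact Relation.ReflTransGen.refl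
  | tail _ hab ih => exact Relation.ReflTransGen.head ⟨hab.1.symm, hab.2.2, hab.2.1⟩ ih

lemma ReachIn.trans {X : Set V} {u v w : V} (h : ReachIn G X u v) (h' : ReachIn G X v w) :
    ReachIn G X u w :=
  Relation.ReflTransGen.trans h h'

lemma ReachIn.of_adj {X : Set V} {u v : V} (h : G.Adj u v) (hu : u ∈ X) (hv : v ∈ X) :
    ReachIn G X u v :=
  Relation.ReflTransGen.single ⟨h, hu, hv⟩

lemma ReachIn.mem {X : Set V} {u v : V} (h : ReachIn G X u v) (hu : u ∈ X) : v ∈ X := by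
  induction h with
  | refl => exact hu
  | tail _ h _ => exact h.2.2

lemma isConn_singleton (v : V) : IsConn G {v} := by
  rintro u rfl w rfl
  exact Relation.ReflTransGen.refl

lemma IsConn.union {X Y : Set V} (hX : IsConn G X) (hY : IsConn G Y) {a b : V} (ha : a ∈ X)
    (hb : b ∈ Y) (hab : G.Adj a b) : IsConn G (X ∪ Y) := by
  have key : ∀ u ∈ X ∪ Y, ReachIn G (X ∪ Y) u a := by
    rintro u (hu | hu)
    · exact (hX u hu a ha).mono Set.subset_union_left
    · exact ((hY u hu b hb).mono Set.subset_union_right).trans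
        (ReachIn.of_adj hab.symm (Or.inr hb) (Or.inl ha))
  exact fun u hu v hv => (key u hu).trans (key v hv).symm

lemma IsConn.union_of_mem {X Y : Set V} (hX : IsConn G X) (hY : IsConn G Y) {a : V} (ha : a ∈ X)
    (hb : a ∈ Y) : IsConn G (X ∪ Y) := by
  have key : ∀ u ∈ X ∪ Y, ReachIn G (X ∪ Y) u a := by
    rintro u (hu | hu)
    · exact (hX u hu a ha).mono Set.subset_union_left
    · exact (hY u hu a hb).mono Set.subset_union_right
  exact fun u hu v hv => (key u hu).trans (key v hv).symm

lemma IsConn.insert {X : Set V} (hX : IsConn G X) {a v : V} (ha : a ∈ X) (hav : G.Adj v a) :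
    IsConn G (insert v X) := by
  rw [Set.insert_eq]
  exact (isConn_singleton v).union hX rfl ha hav

lemma isConn_interval {p : ℕ → V} {a b : ℕ} (h : ∀ i, a ≤ i → i < b → G.Adj (p i) (p (i + 1))) :
    IsConn G {v | ∃ i, a ≤ i ∧ i ≤ b ∧ p i = v} := by
  have key : ∀ i, a ≤ i → i ≤ b → ReachIn G {v | ∃ i, a ≤ i ∧ i ≤ b ∧ p i = v} (p a) (p i) := by
    intro i hi
    induction i, hi using Nat.le_induction with
    | base => intro _; exact Relation.ReflTransGen.refl
    | succ i hi ih =>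
      intro hb
      exact (ih (by omega)).trans (ReachIn.of_adj (h i hi (by omega)) ⟨i, hi, by omega, rfl⟩
        ⟨i + 1, by omega, hb, rfl⟩)
  rintro u ⟨i, hi, hi', rfl⟩ v ⟨j, hj, hj', rfl⟩
  exact (key i hi hi').symm.trans (key j hj hj')

/-- The component of `v` in `M \ F`, together with a vertex of `F` attached to it. -/
lemma IsConn.exists_component {M F : Set V} (hM : IsConn G M) {v f : V} (hv : v ∈ M) (hvF : v ∉ F)
    (hf : f ∈ M) (hfF : f ∈ F) :
    ∃ T : Set V, T ⊆ M ∧ (∀ w ∈ T, w ∉ F) ∧ v ∈ T ∧ IsConn G T ∧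
      (∀ w ∈ M, w ∉ F → ∀ t ∈ T, G.Adj t w → w ∈ T) ∧
      ∃ t ∈ T, ∃ q ∈ M, q ∈ F ∧ G.Adj t q := by
  set T : Set V := {w | ReachIn G (M \ F) v w} with hT
  have hTM : ∀ w ∈ T, w ∈ M \ F := fun w hw => ReachIn.mem hw ⟨hv, hvF⟩
  have hconn : ∀ w, ReachIn G (M \ F) v w → ReachIn G T v w := by
    intro w hw
    induction hw with
    | refl => exact Relation.ReflTransGen.refl
    | tail h1 h2 ih => exact ih.trans (ReachIn.of_adj h2.1 h1 (h1.tail h2))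
  refine ⟨T, fun w hw => (hTM w hw).1, fun w hw => (hTM w hw).2, Relation.ReflTransGen.refl,
    fun u hu w hw => (hconn u hu).symm.trans (hconn w hw), ?_, ?_⟩
  · exact fun w hw hwF t ht hadj => Relation.ReflTransGen.tail ht ⟨hadj, hTM t ht, hw, hwF⟩
  · by_contra! hcon
    have : ∀ w, ReachIn G M v w → w ∈ T := by
      intro w hw
      induction hw with
      | refl => exact Relation.ReflTransGen.refl
      | tail h1 h2 ih =>
        refine Relation.ReflTransGen.tail ih ⟨h2.1, hTM _ ih, h2.2.2, fun hF => ?_⟩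
        exact hcon _ ih _ h2.2.2 hF h2.1
    exact (hTM f (this f (hM v hv f hf))).2 hfF

/-- Two vertices joined inside `X` are joined by an induced path inside `X`. -/
lemma ReachIn.exists_induced_path {X : Set V} {u v : V} (h : ReachIn G X u v) (hu : u ∈ X) :
    ∃ (n : ℕ) (p : ℕ → V), p 0 = u ∧ p n = v ∧ (∀ i ≤ n, p i ∈ X) ∧
      (∀ i ≤ n, ∀ j ≤ n, p i = p j → i = j) ∧
      (∀ i < n, G.Adj (p i) (p (i + 1))) ∧
      (∀ i ≤ n, ∀ j ≤ n, G.Adj (p i) (p j) → i + 1 = j ∨ j + 1 = i) := by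
  let K : SimpleGraph V :=
    { Adj := fun a b => G.Adj a b ∧ a ∈ X ∧ b ∈ X
      symm := ⟨fun _ _ hab => ⟨hab.1.symm, hab.2.2, hab.2.1⟩⟩
      loopless := ⟨fun a ha => G.loopless.irrefl a ha.1⟩ }
  have hreach : K.Reachable u v := by
    induction h with
    | refl => exact Reachable.refl _
    | tail _ h2 ih => exact ih.trans (Adj.reachable (G := K) h2)
  obtain ⟨w, hw⟩ := hreach.exists_walk_length_eq_dist
  have hadj : ∀ i < w.length, K.Adj (w.getVert i) (w.getVert (i + 1)) :=
    fun i hi => w.adj_getVert_succ hi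
  have hmem : ∀ i ≤ w.length, w.getVert i ∈ X := by
    intro i hi
    rcases Nat.eq_zero_or_pos i with rfl | hpos
    · simpa using hu
    · have := hadj (i - 1) (by omega)
      rw [Nat.sub_add_cancel hpos] at this
      exact this.2.2
  have hdist : ∀ i ≤ w.length, K.dist u (w.getVert i) = i := by
    intro i hi
    apply le_antisymm
    · have := dist_le (w.take i)
      rw [Walk.take_length] at this
      omega
    · have h1 := dist_le (w.drop i)
      rw [Walk.drop_length] at h1
      have h2 := (w.take i).reachable.dist_triangle_left v
      omega
  refine ⟨w.length, w.getVert, by simp, by simp, hmem, ?_, fun i hi => (hadj i hi).1, ?_⟩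
  · intro i hi j hj hij
    rw [← hdist i hi, ← hdist j hj, hij]
  · intro i hi j hj hij
    have hK : K.Adj (w.getVert i) (w.getVert j) := ⟨hij, hmem i hi, hmem j hj⟩
    have hne : i ≠ j := by rintro rfl; exact K.loopless.irrefl _ hK
    have h1 := hK.diff_dist_adj (u := u)
    rw [hdist i hi, hdist j hj] at h1
    omega

end connectivity

section houseRealization

variable {V : Type}

lemma subdivideEdge_adj_some {W : Type} {H : SimpleGraph W} {u v a b : W} :
    (subdivideEdge H u v).Adj (some a) (some b) ↔
      H.Adj a b ∧ ¬(a = u ∧ b = v) ∧ ¬(a = v ∧ b = u) := by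
  simp only [subdivideEdge, fromRel_adj]
  constructor
  · rintro ⟨-, (⟨a', b', ha, hb, h⟩ | ⟨h, -⟩) | (⟨a', b', ha, hb, h⟩ | ⟨h, -⟩)⟩
    · cases ha; cases hb; exact h
    · cases h
    · cases ha; cases hb; exact ⟨h.1.symm, fun h' => h.2.2 ⟨h'.2, h'.1⟩, fun h' => h.2.1 ⟨h'.2,
        h'.1⟩⟩
    · cases h
  · intro h
    exact ⟨fun e => h.1.ne (Option.some.inj e), Or.inl (Or.inl ⟨a, b, rfl, rfl, h⟩)⟩

lemma subdivideEdge_adj_none {W : Type} {H : SimpleGraph W} {u v a : W} :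
    (subdivideEdge H u v).Adj none (some a) ↔ a = u ∨ a = v := by
  simp [subdivideEdge, fromRel_adj]

lemma subdivideEdge_adj_none' {W : Type} {H : SimpleGraph W} {u v a : W} :
    (subdivideEdge H u v).Adj (some a) none ↔ a = u ∨ a = v := by
  rw [adj_comm, subdivideEdge_adj_none]

/-- Some subdivision of the house can be drawn on `S` with adjacency relation `E`. -/
def Realized (E : V → V → Prop) (S : Set V) : Prop :=
  ∃ (B : Type) (H' : SimpleGraph B) (f : B → V), Subdivision house H' ∧ Function.Injective f ∧
    Set.range f = S ∧ ∀ b b', H'.Adj b b' ↔ E (f b) (f b')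

lemma Realized.congr {E E' : V → V → Prop} {S S' : Set V} (h : Realized E S) (hS : S = S')
    (hE : ∀ u v, E u v ↔ E' u v) : Realized E' S' := by
  obtain ⟨B, H', f, h1, h2, h3, h4⟩ := h
  exact ⟨B, H', f, h1, h2, h3.trans hS, fun b b' => (h4 b b').trans (hE _ _)⟩

lemma Realized.subdivide {E E' : V → V → Prop} {S : Set V} (h : Realized E S) {x y a : V}
    (hx : x ∈ S) (hy : y ∈ S) (ha : a ∉ S) (hxy : E x y)
    (hE : ∀ u ∈ S, ∀ v ∈ S, E' u v ↔ E u v ∧ ¬(u = x ∧ v = y) ∧ ¬(u = y ∧ v = x))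
    (hl : ∀ u ∈ S, E' a u ↔ u = x ∨ u = y) (hr : ∀ u ∈ S, E' u a ↔ u = x ∨ u = y)
    (haa : ¬ E' a a) : Realized E' (insert a S) := by
  obtain ⟨B, H', f, h1, h2, rfl, h4⟩ := h
  obtain ⟨bx, rfl⟩ := hx
  obtain ⟨by', rfl⟩ := hy
  refine ⟨Option B, subdivideEdge H' bx by', fun o => o.elim a f, h1.step ((h4 _ _).2 hxy), ?_, ?_,
    ?_⟩
  · rintro (_ | u) (_ | v) huv
    · rfl
    · exact absurd ⟨v, huv.symm⟩ ha
    · exact absurd ⟨u, huv⟩ ha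
    · exact congrArg some (h2 huv)
  · ext w
    simp only [Set.mem_range, Option.exists, Option.elim, Set.mem_insert_iff, eq_comm]
  · rintro (_ | u) (_ | v)
    · simpa using haa
    · rw [subdivideEdge_adj_none]
      simp only [Option.elim, hl _ ⟨v, rfl⟩, h2.eq_iff]
    · rw [subdivideEdge_adj_none']
      simp only [Option.elim, hr _ ⟨u, rfl⟩, h2.eq_iff]
    · rw [subdivideEdge_adj_some, h4]
      simp only [Option.elim, hE _ ⟨u, rfl⟩ _ ⟨v, rfl⟩, h2.eq_iff]

/-- `{u, v} = {x, y}`. -/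
def IsPair (x y u v : V) : Prop := (u = x ∧ v = y) ∨ (u = y ∧ v = x)

/-- `u, v` are consecutive on the path `p 0, …, p n`. -/
def IsStep (p : ℕ → V) (n : ℕ) (u v : V) : Prop := ∃ i < n, IsPair (p i) (p (i + 1)) u v

lemma isStep_succ {p : ℕ → V} {n : ℕ} {u v : V} :
    IsStep p (n + 1) u v ↔ IsPair (p 0) (p 1) u v ∨ IsStep (fun i => p (i + 1)) n u v := by
  constructor
  · rintro ⟨_ | i, hi, h⟩
    · exact Or.inl h
    · exact Or.inr ⟨i, by omega, h⟩
  · rintro (h | ⟨i, hi, h⟩)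
    · exact ⟨0, by omega, h⟩
    · exact ⟨i + 1, by omega, h⟩

lemma isStep_one {p : ℕ → V} {u v : V} : IsStep p 1 u v ↔ IsPair (p 0) (p 1) u v := by
  rw [isStep_succ]
  simp [IsStep]

lemma Realized.extend (n : ℕ) : ∀ {E : V → V → Prop} {S : Set V} {p : ℕ → V}
    (_ : Realized (fun u v => E u v ∨ IsPair (p 0) (p (n + 1)) u v) S)
    (_ : ∀ u v, E u v → u ∈ S ∧ v ∈ S) (_ : p 0 ∈ S) (_ : p (n + 1) ∈ S)
    (_ : ¬ E (p 0) (p (n + 1))) (_ : ¬ E (p (n + 1)) (p 0))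
    (_ : p 0 ≠ p (n + 1)) (_ : ∀ i, 0 < i → i < n + 1 → p i ∉ S)
    (_ : ∀ i, 0 < i → i < n + 1 → ∀ j, 0 < j → j < n + 1 → p i = p j → i = j),
    Realized (fun u v => E u v ∨ IsStep p (n + 1) u v) (S ∪ {w | ∃ i ≤ n + 1, p i = w}) := by
  induction n with
  | zero =>
    intro E S p h hES h0 h1 _ _ _ _ _
    refine h.congr ?_ ?_
    · symm
      apply Set.union_eq_self_of_subset_right
      rintro w ⟨i, hi, rfl⟩
      interval_cases i
      · exact h0
      · exact h1
    · intro u v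
      rw [isStep_one]
  | succ n ih =>
    intro E S p h hES h0 h1 hn hn' hne hS hinj
    have hp1 : p 1 ∉ S := hS 1 (by omega) (by omega)
    have ne0 : p 1 ≠ p 0 := fun e => hp1 (e ▸ h0)
    have ne1 : p 1 ≠ p (n + 1 + 1) := fun e => hp1 (e ▸ h1)
    have hmem : ∀ u ∈ S, u ≠ p 1 := fun u hu e => hp1 (e ▸ hu)
    have step : Realized (fun u v => (E u v ∨ IsPair (p 0) (p 1) u v) ∨
        IsPair (p 1) (p (n + 1 + 1)) u v) (insert (p 1) S) := by
      refine h.subdivide h0 h1 hp1 (Or.inr (Or.inl ⟨rfl, rfl⟩)) ?_ ?_ ?_ ?_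
      · intro u hu v hv
        have := hmem u hu
        have := hmem v hv
        simp only [IsPair]
        constructor
        · rintro ((he | h) | h)
          · refine ⟨Or.inl he, ?_, ?_⟩
            · rintro ⟨rfl, rfl⟩; exact hn he
            · rintro ⟨rfl, rfl⟩; exact hn' he
          · tauto
          · tauto
        · tauto
      · intro u hu
        have := hmem u hu
        have : ¬ E (p 1) u := fun e => hp1 (hES _ _ e).1
        simp only [IsPair]
        tauto
      · intro u hu
        have := hmem u hu
        have : ¬ E u (p 1) := fun e => hp1 (hES _ _ e).2
        simp only [IsPair]
        tauto
      · have : ¬ E (p 1) (p 1) := fun e => hp1 (hES _ _ e).2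
        simp only [IsPair]
        tauto
    have := ih (E := fun u v => E u v ∨ IsPair (p 0) (p 1) u v) (S := insert (p 1) S)
      (p := fun i => p (i + 1)) step ?_ (Or.inl rfl) (Or.inr h1) ?_ ?_ ?_ ?_ ?_
    · refine this.congr ?_ ?_
      · ext w
        simp only [Set.mem_union, Set.mem_insert_iff, Set.mem_ofPred_eq]
        constructor
        · rintro ((rfl | h) | ⟨i, hi, rfl⟩)
          · exact Or.inr ⟨1, by omega, rfl⟩
          · exact Or.inl h
          · exact Or.inr ⟨i + 1, by omega, rfl⟩
        · rintro (h | ⟨_ | i, hi, rfl⟩)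
          · exact Or.inl (Or.inr h)
          · exact Or.inl (Or.inr h0)
          · exact Or.inr ⟨i, by omega, rfl⟩
      · intro u v
        rw [isStep_succ (n := n + 1), or_assoc]
    · rintro u v (h | ⟨rfl, rfl⟩ | ⟨rfl, rfl⟩)
      · exact ⟨Or.inr (hES _ _ h).1, Or.inr (hES _ _ h).2⟩
      · exact ⟨Or.inr h0, Or.inl rfl⟩
      · exact ⟨Or.inl rfl, Or.inr h0⟩
    · rintro (h | ⟨h, -⟩ | ⟨-, h⟩)
      · exact hp1 (hES _ _ h).1
      · exact ne0 h
      · exact hne h.symm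
    · rintro (h | ⟨h, -⟩ | ⟨-, h⟩)
      · exact hp1 (hES _ _ h).2
      · exact hne h.symm
      · exact ne0 h
    · exact ne1
    · intro i hi hi' hmem
      rcases hmem with e | e
      · have := hinj _ (by omega) (by omega) 1 (by omega) (by omega) e
        omega
      · exact hS _ (by omega) (by omega) e
    · intro i hi hi' j hj hj' e
      have := hinj _ (by omega) (by omega) _ (by omega) (by omega) e
      omega

end houseRealization

section theta

variable {V : Type}

lemma realized_house {x y c a b : V} (h : [x, a, b, y, c].Nodup) :
    Realized (fun u v => (IsPair x c u v ∨ IsPair c y u v ∨ IsPair x a u v ∨ IsPair a b u v ∨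
      IsPair b y u v) ∨ IsPair x y u v) {x, y, c, a, b} := by
  simp only [List.nodup_cons, List.mem_cons, List.not_mem_nil, or_false, not_or] at h
  obtain ⟨⟨h1, h2, h3, h4⟩, ⟨h5, h6, h7⟩, ⟨h8, h9⟩, h10, -⟩ := h
  refine ⟨Fin 5, house, ![x, a, b, y, c], .refl _, ?_, ?_, ?_⟩
  · intro i j hij
    fin_cases i <;> fin_cases j <;> simp_all [eq_comm]
  · ext w
    simp only [Matrix.range_cons, Matrix.range_empty, Set.mem_union, Set.mem_insert_iff,
      Set.mem_singleton_iff]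
    simp
    tauto
  · intro i j
    fin_cases i <;> fin_cases j <;> simp_all [house, fromRel_adj, IsPair, eq_comm]

/-- `p` is a path of length `n` from `x` to `y` through `X`, induced up to the pair `x, y`. -/
structure IsLinkPath (G : SimpleGraph V) (x y : V) (X : Set V) (p : ℕ → V) (n : ℕ) : Prop where
  zero : p 0 = x
  last : p n = y
  mem : ∀ i, 0 < i → i < n → p i ∈ X
  inj : ∀ i ≤ n, ∀ j ≤ n, p i = p j → i = j
  adj : ∀ i < n, G.Adj (p i) (p (i + 1))
  ind : ∀ i ≤ n, ∀ j ≤ n, G.Adj (p i) (p j) → i + 1 = j ∨ j + 1 = i ∨ IsPair x y (p i) (p j)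

/-- The sets `X` and `Y` are disjoint and there are no edges between them. -/
def Anti (G : SimpleGraph V) (X Y : Set V) : Prop :=
  ∀ u ∈ X, ∀ v ∈ Y, u ≠ v ∧ ¬ G.Adj u v

lemma Anti.symm {G : SimpleGraph V} {X Y : Set V} (h : Anti G X Y) : Anti G Y X :=
  fun u hu v hv => ⟨(h v hv u hu).1.symm, fun e => (h v hv u hu).2 e.symm⟩

variable {G : SimpleGraph V} {x y : V}

lemma IsLinkPath.cases {X : Set V} {p : ℕ → V} {n : ℕ} (h : IsLinkPath G x y X p n) {i : ℕ}
    (hi : i ≤ n) : p i = x ∨ p i = y ∨ p i ∈ X := by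
  rcases Nat.eq_zero_or_pos i with rfl | h0
  · exact Or.inl h.zero
  · rcases hi.lt_or_eq with h1 | rfl
    · exact Or.inr (Or.inr (h.mem i h0 h1))
    · exact Or.inr (Or.inl h.last)

lemma IsLinkPath.step_of_adj {X : Set V} {p : ℕ → V} {n : ℕ} (h : IsLinkPath G x y X p n)
    {u v : V} (hu : ∃ i ≤ n, p i = u) (hv : ∃ i ≤ n, p i = v) (huv : G.Adj u v) :
    IsStep p n u v ∨ IsPair x y u v := by
  obtain ⟨i, hi, rfl⟩ := hu
  obtain ⟨j, hj, rfl⟩ := hv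
  rcases h.ind i hi j hj huv with rfl | rfl | h
  · exact Or.inl ⟨i, by omega, Or.inl ⟨rfl, rfl⟩⟩
  · exact Or.inl ⟨j, by omega, Or.inr ⟨rfl, rfl⟩⟩
  · exact Or.inr h

lemma IsLinkPath.step_of_adj_anti {X Y : Set V} {p q : ℕ → V} {n m : ℕ}
    (h : IsLinkPath G x y X p n) (h' : IsLinkPath G x y Y q m) (hXY : Anti G X Y)
    {u v : V} (hu : ∃ i ≤ n, p i = u) (hv : ∃ i ≤ m, q i = v) (huv : G.Adj u v) :
    IsStep p n u v ∨ IsStep q m u v ∨ IsPair x y u v := by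
  have hend : ∀ {Z : Set V} {r : ℕ → V} {k : ℕ}, IsLinkPath G x y Z r k → ∀ w,
      (w = x ∨ w = y) → ∃ i ≤ k, r i = w := by
    rintro Z r k hr w (rfl | rfl)
    · exact ⟨0, by omega, hr.zero⟩
    · exact ⟨k, le_rfl, hr.last⟩
  have hu' : u = x ∨ u = y ∨ u ∈ X := by
    obtain ⟨i, hi, rfl⟩ := hu
    exact h.cases hi
  have hv' : v = x ∨ v = y ∨ v ∈ Y := by
    obtain ⟨i, hi, rfl⟩ := hv
    exact h'.cases hi
  by_cases hux : u = x ∨ u = y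
  · exact Or.inr (h'.step_of_adj (hend h' u hux) hv huv)
  by_cases hvx : v = x ∨ v = y
  · rcases h.step_of_adj hu (hend h v hvx) huv with h | h
    · exact Or.inl h
    · exact Or.inr (Or.inr h)
  exact absurd huv (hXY u (by tauto) v (by tauto)).2

lemma IsPair.symm {x y u v : V} (h : IsPair x y u v) : IsPair x y v u := by
  rcases h with ⟨h, h'⟩ | ⟨h, h'⟩
  · exact Or.inr ⟨h', h⟩
  · exact Or.inl ⟨h', h⟩

lemma IsLinkPath.adj_of_step {X : Set V} {p : ℕ → V} {n : ℕ} (h : IsLinkPath G x y X p n)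
    {u v : V} (huv : IsStep p n u v) : G.Adj u v := by
  obtain ⟨i, hi, ⟨rfl, rfl⟩ | ⟨rfl, rfl⟩⟩ := huv
  · exact h.adj i hi
  · exact (h.adj i hi).symm

lemma IsStep.mem {p : ℕ → V} {n : ℕ}
    {u v : V} (huv : IsStep p n u v) : (∃ i ≤ n, p i = u) ∧ ∃ i ≤ n, p i = v := by
  obtain ⟨i, hi, ⟨rfl, rfl⟩ | ⟨rfl, rfl⟩⟩ := huv
  · exact ⟨⟨i, by omega, rfl⟩, ⟨i + 1, by omega, rfl⟩⟩
  · exact ⟨⟨i + 1, by omega, rfl⟩, ⟨i, by omega, rfl⟩⟩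

lemma IsPair.mem {x y u v : V} {S : Set V} (h : IsPair x y u v) (hx : x ∈ S) (hy : y ∈ S) :
    u ∈ S ∧ v ∈ S := by
  rcases h with ⟨rfl, rfl⟩ | ⟨rfl, rfl⟩
  · exact ⟨hx, hy⟩
  · exact ⟨hy, hx⟩

lemma not_isPair {x y u v : V} (h : u ≠ x) (h' : u ≠ y) : ¬ IsPair x y u v := by
  rintro (⟨e, -⟩ | ⟨e, -⟩)
  · exact h e
  · exact h' e

lemma contains_house_of_theta {X₁ X₂ X₃ : Set V} {p₁ p₂ p₃ : ℕ → V} {n₁ n₂ n₃ : ℕ}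
    (hxy : x ≠ y) (hx₁ : x ∉ X₁) (hx₂ : x ∉ X₂) (hx₃ : x ∉ X₃) (hy₁ : y ∉ X₁) (hy₂ : y ∉ X₂)
    (hy₃ : y ∉ X₃) (h₁₂ : Anti G X₁ X₂) (h₁₃ : Anti G X₁ X₃) (h₂₃ : Anti G X₂ X₃)
    (hp₁ : IsLinkPath G x y X₁ p₁ (n₁ + 1)) (hp₂ : IsLinkPath G x y X₂ p₂ (n₂ + 2))
    (hp₃ : IsLinkPath G x y X₃ p₃ (n₃ + 3)) (hadj : G.Adj x y → n₁ = 0) :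
    ContainsInducedSubdivision house G := by
  have n12 : ∀ u ∈ X₁, u ∉ X₂ := fun u h h' => (h₁₂ u h u h').1 rfl
  have n13 : ∀ u ∈ X₁, u ∉ X₃ := fun u h h' => (h₁₃ u h u h').1 rfl
  have n23 : ∀ u ∈ X₂, u ∉ X₃ := fun u h h' => (h₂₃ u h u h').1 rfl
  have hc : p₂ 1 ∈ X₂ := hp₂.mem 1 (by omega) (by omega)
  have ha : p₃ 1 ∈ X₃ := hp₃.mem 1 (by omega) (by omega)
  have hb : p₃ 2 ∈ X₃ := hp₃.mem 2 (by omega) (by omega)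
  have hab : p₃ 1 ≠ p₃ 2 := fun e => by
    have := hp₃.inj 1 (by omega) 2 (by omega) e
    omega
  have hca : p₂ 1 ≠ p₃ 1 := (h₂₃ _ hc _ ha).1
  have hcb : p₂ 1 ≠ p₃ 2 := (h₂₃ _ hc _ hb).1
  have hcx : p₂ 1 ≠ x := fun e => hx₂ (e ▸ hc)
  have hcy : p₂ 1 ≠ y := fun e => hy₂ (e ▸ hc)
  have hax : p₃ 1 ≠ x := fun e => hx₃ (e ▸ ha)
  have hay : p₃ 1 ≠ y := fun e => hy₃ (e ▸ ha)
  have hbx : p₃ 2 ≠ x := fun e => hx₃ (e ▸ hb)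
  have hby : p₃ 2 ≠ y := fun e => hy₃ (e ▸ hb)
  have base := realized_house (x := x) (y := y) (c := p₂ 1) (a := p₃ 1) (b := p₃ 2) (by
    simp only [List.nodup_cons, List.mem_cons, List.not_mem_nil, or_false, not_or]
    exact ⟨⟨hax.symm, hbx.symm, hxy, hcx.symm⟩, ⟨hab, hay, hca.symm⟩, ⟨hby, hcb.symm⟩, hcy.symm, by
      simp⟩)
  have stage₁ := Realized.extend n₁ (p := p₁) (S := {x, y, p₂ 1, p₃ 1, p₃ 2})
    (by rw [hp₁.zero, hp₁.last]; exact base) ?_ (by rw [hp₁.zero]; simp) (by rw [hp₁.last]; simp)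
    ?_ ?_ (by rw [hp₁.zero, hp₁.last]; exact hxy) ?_ ?_
  rotate_left
  · rintro u v (h | h | h | h | h) <;> exact h.mem (by simp) (by simp)
  · rw [hp₁.zero, hp₁.last]
    rintro (h | h | h | h | h) <;> revert h
    · exact fun h => not_isPair hxy.symm hcy.symm h.symm
    · exact not_isPair hcx.symm hxy
    · exact fun h => not_isPair hxy.symm hay.symm h.symm
    · exact not_isPair hax.symm hbx.symm
    · exact not_isPair hbx.symm hxy
  · rw [hp₁.zero, hp₁.last]
    rintro (h | h | h | h | h) <;> revert h
    · exact not_isPair hxy.symm hcy.symm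
    · exact fun h => not_isPair hcx.symm hxy h.symm
    · exact not_isPair hxy.symm hay.symm
    · exact fun h => not_isPair hax.symm hbx.symm h.symm
    · exact fun h => not_isPair hbx.symm hxy h.symm
  · intro i hi hi' hmem
    have h := hp₁.mem i hi hi'
    simp only [Set.mem_insert_iff, Set.mem_singleton_iff] at hmem
    rcases hmem with e | e | e | e | e <;> rw [e] at h
    · exact hx₁ h
    · exact hy₁ h
    · exact n12 _ h hc
    · exact n13 _ h ha
    · exact n13 _ h hb
  · exact fun i _ hi j _ hj e => hp₁.inj i (by omega) j (by omega) e
  have hs₁ : ∀ {u v}, IsStep p₁ (n₁ + 1) u v → (u = x ∨ u = y ∨ u ∈ X₁) ∧ (v = x ∨ v = y ∨ v ∈ X₁)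
      := by
    intro u v h
    obtain ⟨⟨i, hi, rfl⟩, ⟨j, hj, rfl⟩⟩ := h.mem
    exact ⟨hp₁.cases hi, hp₁.cases hj⟩
  have hs₂ : ∀ {u v}, IsStep p₂ (n₂ + 2) u v → (u = x ∨ u = y ∨ u ∈ X₂) ∧ (v = x ∨ v = y ∨ v ∈ X₂)
      := by
    intro u v h
    obtain ⟨⟨i, hi, rfl⟩, ⟨j, hj, rfl⟩⟩ := h.mem
    exact ⟨hp₂.cases hi, hp₂.cases hj⟩
  have hcX₁ : p₂ 1 ∉ X₁ := fun h => n12 _ h hc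
  have haX₁ : p₃ 1 ∉ X₁ := fun h => n13 _ h ha
  have hbX₁ : p₃ 2 ∉ X₁ := fun h => n13 _ h hb
  have haX₂ : p₃ 1 ∉ X₂ := fun h => n23 _ h ha
  have hbX₂ : p₃ 2 ∉ X₂ := fun h => n23 _ h hb
  have stage₂ := Realized.extend n₂ (p := fun i => p₂ (i + 1))
    (E := fun u v => IsPair x (p₂ 1) u v ∨ IsPair x (p₃ 1) u v ∨ IsPair (p₃ 1) (p₃ 2) u v ∨
      IsPair (p₃ 2) y u v ∨ IsStep p₁ (n₁ + 1) u v)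
    (stage₁.congr rfl (fun u v => by
      rw [show p₂ (n₂ + 1 + 1) = y from hp₂.last]
      clear * -
      tauto)) ?_ (by simp) (Or.inl (by rw [show p₂ (n₂ + 1 + 1) = y from hp₂.last]; simp))
    ?_ ?_ (by rw [show p₂ (n₂ + 1 + 1) = y from hp₂.last]; exact hcy) ?_ ?_
  rotate_left
  · rintro u v (h | h | h | h | h)
    · exact h.mem (Or.inl (by simp)) (Or.inl (by simp))
    · exact h.mem (Or.inl (by simp)) (Or.inl (by simp))
    · exact h.mem (Or.inl (by simp)) (Or.inl (by simp))
    · exact h.mem (Or.inl (by simp)) (Or.inl (by simp))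
    · have := h.mem
      exact ⟨Or.inr this.1, Or.inr this.2⟩
  · rw [show p₂ (n₂ + 1 + 1) = y from hp₂.last]
    rintro (h | h | h | h | h)
    · exact not_isPair hxy.symm hcy.symm h.symm
    · exact not_isPair hcx hca h
    · exact not_isPair hca hcb h
    · exact not_isPair hcb hcy h
    · rcases (hs₁ h).1 with e | e | e
      · exact hcx e
      · exact hcy e
      · exact hcX₁ e
  · rw [show p₂ (n₂ + 1 + 1) = y from hp₂.last]
    rintro (h | h | h | h | h)
    · exact not_isPair hxy.symm hcy.symm h
    · exact not_isPair hcx hca h.symm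
    · exact not_isPair hca hcb h.symm
    · exact not_isPair hcb hcy h.symm
    · rcases (hs₁ h).2 with e | e | e
      · exact hcx e
      · exact hcy e
      · exact hcX₁ e
  · intro i hi hi' hmem
    have h : p₂ (i + 1) ∈ X₂ := hp₂.mem _ (by omega) (by omega)
    simp only [Set.mem_union, Set.mem_insert_iff, Set.mem_singleton_iff] at hmem
    rcases hmem with (e | e | e | e | e) | ⟨j, hj, e⟩
    · exact hx₂ (e ▸ h)
    · exact hy₂ (e ▸ h)
    · have := hp₂.inj _ (by omega) 1 (by omega) e
      omega
    · exact n23 _ h (e ▸ ha)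
    · exact n23 _ h (e ▸ hb)
    · rw [← e] at h
      rcases hp₁.cases hj with e' | e' | e'
      · exact hx₂ (e' ▸ h)
      · exact hy₂ (e' ▸ h)
      · exact n12 _ e' h
  · intro i _ hi j _ hj e
    have := hp₂.inj _ (by omega) _ (by omega) e
    omega
  have stage₃ := Realized.extend n₃ (p := fun i => p₃ (i + 2))
    (E := fun u v => IsPair x (p₃ 1) u v ∨ IsPair (p₃ 1) (p₃ 2) u v ∨ IsStep p₁ (n₁ + 1) u v ∨
      IsStep p₂ (n₂ + 2) u v)
    (stage₂.congr rfl (fun u v => by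
      rw [show p₃ (n₃ + 1 + 2) = y from hp₃.last, isStep_succ (p := p₂) (n := n₂ + 1), hp₂.zero]
      clear * -
      tauto)) ?_ (Or.inl (Or.inl (by simp)))
      (Or.inl (Or.inl (by rw [show p₃ (n₃ + 1 + 2) = y from hp₃.last]; simp)))
    ?_ ?_ (by rw [show p₃ (n₃ + 1 + 2) = y from hp₃.last]; exact hby) ?_ ?_
  rotate_left
  · rintro u v (h | h | h | h)
    · exact h.mem (Or.inl (Or.inl (by simp))) (Or.inl (Or.inl (by simp)))
    · exact h.mem (Or.inl (Or.inl (by simp))) (Or.inl (Or.inl (by simp)))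
    · have := h.mem
      exact ⟨Or.inl (Or.inr this.1), Or.inl (Or.inr this.2)⟩
    · rw [isStep_succ, hp₂.zero] at h
      rcases h with h | h
      · exact h.mem (Or.inl (Or.inl (by simp))) (Or.inl (Or.inl (by simp)))
      · have := h.mem
        exact ⟨Or.inr this.1, Or.inr this.2⟩
  · rw [show p₃ (n₃ + 1 + 2) = y from hp₃.last]
    rintro (h | h | h | h)
    · exact not_isPair hbx hab.symm h
    · exact not_isPair hay.symm hby.symm h.symm
    · rcases (hs₁ h).1 with e | e | e
      · exact hbx e
      · exact hby e
      · exact hbX₁ e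
    · rcases (hs₂ h).1 with e | e | e
      · exact hbx e
      · exact hby e
      · exact hbX₂ e
  · rw [show p₃ (n₃ + 1 + 2) = y from hp₃.last]
    rintro (h | h | h | h)
    · exact not_isPair hbx hab.symm h.symm
    · exact not_isPair hay.symm hby.symm h
    · rcases (hs₁ h).2 with e | e | e
      · exact hbx e
      · exact hby e
      · exact hbX₁ e
    · rcases (hs₂ h).2 with e | e | e
      · exact hbx e
      · exact hby e
      · exact hbX₂ e
  · intro i hi hi' hmem
    have h : p₃ (i + 2) ∈ X₃ := hp₃.mem _ (by omega) (by omega)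
    simp only [Set.mem_union, Set.mem_insert_iff, Set.mem_singleton_iff] at hmem
    rcases hmem with ((e | e | e | e | e) | ⟨j, hj, e⟩) | ⟨j, hj, e⟩
    · exact hx₃ (e ▸ h)
    · exact hy₃ (e ▸ h)
    · exact n23 _ hc (e ▸ h)
    · have := hp₃.inj _ (by omega) 1 (by omega) e
      omega
    · have := hp₃.inj _ (by omega) 2 (by omega) e
      omega
    · rw [← e] at h
      rcases hp₁.cases hj with e' | e' | e'
      · exact hx₃ (e' ▸ h)
      · exact hy₃ (e' ▸ h)
      · exact n13 _ e' h
    · rw [← e] at h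
      rcases hp₂.cases (i := j + 1) (by omega) with e' | e' | e'
      · exact hx₃ (e' ▸ h)
      · exact hy₃ (e' ▸ h)
      · exact n23 _ e' h
  · intro i _ hi j _ hj e
    have := hp₃.inj _ (by omega) _ (by omega) e
    omega
  obtain ⟨B, H', f, hsub, hinj, hrange, hf⟩ := stage₃
  refine ⟨B, H', hsub, ⟨⟨⟨f, hinj⟩, ?_⟩⟩⟩
  intro b b'
  change G.Adj (f b) (f b') ↔ H'.Adj b b'
  have hmem : ∀ b, (∃ i ≤ n₁ + 1, p₁ i = f b) ∨ (∃ i ≤ n₂ + 2, p₂ i = f b) ∨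
      (∃ i ≤ n₃ + 3, p₃ i = f b) := by
    intro b
    have : f b ∈ Set.range f := ⟨b, rfl⟩
    rw [hrange] at this
    rcases this with (((e | e | e | e | e) | ⟨j, hj, e⟩) | ⟨j, hj, e⟩) | ⟨j, hj, e⟩
    · exact Or.inl ⟨0, by omega, by rw [hp₁.zero, e]⟩
    · exact Or.inl ⟨_, le_rfl, by rw [hp₁.last, e]⟩
    · exact Or.inr (Or.inl ⟨1, by omega, e.symm⟩)
    · exact Or.inr (Or.inr ⟨1, by omega, e.symm⟩)
    · exact Or.inr (Or.inr ⟨2, by omega, e.symm⟩)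
    · exact Or.inl ⟨j, hj, e⟩
    · exact Or.inr (Or.inl ⟨j + 1, by omega, e⟩)
    · exact Or.inr (Or.inr ⟨j + 2, by omega, e⟩)
  have heq : ∀ u v, ((IsPair x (p₃ 1) u v ∨ IsPair (p₃ 1) (p₃ 2) u v ∨ IsStep p₁ (n₁ + 1) u v ∨
      IsStep p₂ (n₂ + 2) u v) ∨ IsStep (fun i => p₃ (i + 2)) (n₃ + 1) u v) ↔
      (IsStep p₁ (n₁ + 1) u v ∨ IsStep p₂ (n₂ + 2) u v ∨ IsStep p₃ (n₃ + 3) u v) := by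
    intro u v
    rw [isStep_succ (p := p₃) (n := n₃ + 2), isStep_succ (n := n₃ + 1), hp₃.zero]
    clear * -
    tauto
  refine Iff.trans ?_ ((hf b b').trans (heq _ _)).symm
  have hpair : ∀ u v, G.Adj u v → IsPair x y u v → IsStep p₁ (n₁ + 1) u v := by
    intro u v huv h
    have : n₁ = 0 := by
      apply hadj
      rcases h with ⟨rfl, rfl⟩ | ⟨rfl, rfl⟩
      · exact huv
      · exact huv.symm
    refine ⟨0, by omega, ?_⟩
    have hl := hp₁.last
    rw [this] at hl
    rw [hp₁.zero, hl]
    exact h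
  constructor
  · intro huv
    have hp := hpair _ _ huv
    clear hf heq hrange hpair hadj base stage₁ stage₂ hsub hinj
    rcases hmem b with hu | hu | hu <;> rcases hmem b' with hv | hv | hv
    · have := hp₁.step_of_adj hu hv huv; clear * - this hp; tauto
    · have := hp₁.step_of_adj_anti hp₂ h₁₂ hu hv huv; clear * - this hp; tauto
    · have := hp₁.step_of_adj_anti hp₃ h₁₃ hu hv huv; clear * - this hp; tauto
    · have := hp₂.step_of_adj_anti hp₁ h₁₂.symm hu hv huv; clear * - this hp; tauto
    · have := hp₂.step_of_adj hu hv huv; clear * - this hp; tauto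
    · have := hp₂.step_of_adj_anti hp₃ h₂₃ hu hv huv; clear * - this hp; tauto
    · have := hp₃.step_of_adj_anti hp₁ h₁₃.symm hu hv huv; clear * - this hp; tauto
    · have := hp₃.step_of_adj_anti hp₂ h₂₃.symm hu hv huv; clear * - this hp; tauto
    · have := hp₃.step_of_adj hu hv huv; clear * - this hp; tauto
  · rintro (h | h | h)
    · exact hp₁.adj_of_step h
    · exact hp₂.adj_of_step h
    · exact hp₃.adj_of_step h

end theta

section linking

variable {V : Type} {G : SimpleGraph V} {x y : V}

/-- `X` is a connected set avoiding `x` and `y` in which both have neighbours. -/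
structure Link (G : SimpleGraph V) (x y : V) (X : Set V) : Prop where
  conn : IsConn G X
  left_notMem : x ∉ X
  right_notMem : y ∉ X
  left : ∃ z ∈ X, G.Adj x z
  right : ∃ z ∈ X, G.Adj y z

lemma Link.exists_path {X : Set V} (h : Link G x y X) (hxy : x ≠ y) :
    ∃ (p : ℕ → V) (n : ℕ), IsLinkPath G x y X p (n + 2) := by
  obtain ⟨a, ha, hxa⟩ := h.left
  obtain ⟨b, hb, hyb⟩ := h.right
  let K : SimpleGraph V :=
    { Adj := fun u v => G.Adj u v ∧ ¬ IsPair x y u v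
      symm := ⟨fun _ _ e => ⟨e.1.symm, fun e' => e.2 e'.symm⟩⟩
      loopless := ⟨fun u e => G.loopless.irrefl u e.1⟩ }
  have hX : ∀ {u v}, ReachIn G X u v → ReachIn K ({x, y} ∪ X) u v := by
    intro u v huv
    induction huv with
    | refl => exact Relation.ReflTransGen.refl
    | tail _ e ih =>
      refine ih.tail ⟨⟨e.1, ?_⟩, Or.inr e.2.1, Or.inr e.2.2⟩
      refine not_isPair ?_ ?_
      · rintro rfl; exact h.left_notMem e.2.1
      · rintro rfl; exact h.right_notMem e.2.1
  have hr : ReachIn K ({x, y} ∪ X) x y := by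
    have h1 : K.Adj x a := ⟨hxa, fun e => not_isPair (fun e : a = x => h.left_notMem (e ▸ ha))
      (fun e : a = y => h.right_notMem (e ▸ ha)) e.symm⟩
    have h2 : K.Adj b y := ⟨hyb.symm, not_isPair (fun e => h.left_notMem (e ▸ hb))
      (fun e => h.right_notMem (e ▸ hb))⟩
    exact ((ReachIn.of_adj h1 (Or.inl (Or.inl rfl)) (Or.inr ha)).trans
      (hX (h.conn a ha b hb))).trans (ReachIn.of_adj h2 (Or.inr hb) (Or.inl (Or.inr rfl)))
  obtain ⟨n, p, h0, hn, hmem, hinj, hadj, hind⟩ := hr.exists_induced_path (Or.inl (Or.inl rfl))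
  match n, hn, hmem, hinj, hadj, hind with
  | 0, hn, _, _, _, _ => exact absurd (h0.symm.trans hn) hxy
  | 1, hn, _, _, hadj, _ =>
    have := hadj 0 (by omega)
    rw [h0, zero_add, hn] at this
    exact absurd (Or.inl ⟨rfl, rfl⟩) this.2
  | n + 2, hn, hmem, hinj, hadj, hind =>
    refine ⟨p, n, h0, hn, ?_, hinj, fun i hi => (hadj i hi).1, ?_⟩
    · intro i hi hi'
      rcases hmem i hi'.le with (e | e) | e
      · have := hinj i hi'.le 0 (by omega) (e.trans h0.symm)
        omega
      · have := hinj i hi'.le _ le_rfl ((show p i = y from e).trans hn.symm)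
        omega
      · exact e
    · intro i hi j hj hij
      by_cases hp : IsPair x y (p i) (p j)
      · exact Or.inr (Or.inr hp)
      · have := hind i hi j hj ⟨hij, hp⟩
        tauto

lemma Link.exists_long_path {X : Set V} (h : Link G x y X) (hxy : x ≠ y)
    (hX : ∀ z ∈ X, G.Adj x z → ¬ G.Adj y z) :
    ∃ (p : ℕ → V) (n : ℕ), IsLinkPath G x y X p (n + 3) := by
  obtain ⟨p, n, hp⟩ := h.exists_path hxy
  match n, hp with
  | 0, hp =>
    have h1 := hp.adj 0 (by omega)
    have h2 := hp.adj 1 (by omega)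
    have hl : p (1 + 1) = y := hp.last
    rw [hp.zero, zero_add] at h1
    rw [hl] at h2
    exact absurd h2.symm (hX _ (hp.mem 1 (by omega) (by omega)) h1)
  | n + 1, hp => exact ⟨p, n, hp⟩

/-- Two anticomplete links between adjacent vertices: each contains a common neighbour. -/
lemma exists_common_neighbor_of_adj (hG : ¬ ContainsInducedSubdivision house G)
    (hxy : G.Adj x y) {X₁ X₂ : Set V} (h₁ : Link G x y X₁) (h₂ : Link G x y X₂)
    (h₁₂ : Anti G X₁ X₂) : ∃ z ∈ X₁, G.Adj x z ∧ G.Adj y z := by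
  by_contra! hcon
  obtain ⟨p₃, n₃, hp₃⟩ := h₁.exists_long_path hxy.ne hcon
  obtain ⟨p₂, n₂, hp₂⟩ := h₂.exists_path hxy.ne
  have hp₁ : IsLinkPath G x y ∅ (fun i => if i = 0 then x else y) (0 + 1) := by
    refine ⟨rfl, rfl, fun i _ _ => by omega, ?_, ?_, ?_⟩
    · intro i hi j hj hij
      have := hxy.ne
      have := hxy.ne.symm
      interval_cases i <;> interval_cases j <;> simp_all
    · intro i hi
      interval_cases i
      simpa using hxy
    · intro i hi j hj hij
      interval_cases i <;> interval_cases j <;> simp_all [IsPair]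
  exact hG (contains_house_of_theta hxy.ne (Set.notMem_empty _) h₂.left_notMem h₁.left_notMem
    (Set.notMem_empty _) h₂.right_notMem h₁.right_notMem (fun _ h => absurd h (Set.notMem_empty _))
    (fun _ h => absurd h (Set.notMem_empty _)) h₁₂.symm hp₁ hp₂ hp₃ fun _ => rfl)

/-- Three anticomplete links between nonadjacent vertices: each contains a common neighbour. -/
lemma exists_common_neighbor_of_not_adj (hG : ¬ ContainsInducedSubdivision house G)
    (hne : x ≠ y) (hxy : ¬ G.Adj x y) {X₁ X₂ X₃ : Set V} (h₁ : Link G x y X₁)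
    (h₂ : Link G x y X₂) (h₃ : Link G x y X₃) (h₁₂ : Anti G X₁ X₂) (h₁₃ : Anti G X₁ X₃)
    (h₂₃ : Anti G X₂ X₃) : ∃ z ∈ X₁, G.Adj x z ∧ G.Adj y z := by
  by_contra! hcon
  obtain ⟨p₃, n₃, hp₃⟩ := h₁.exists_long_path hne hcon
  obtain ⟨p₂, n₂, hp₂⟩ := h₂.exists_path hne
  obtain ⟨p₁, n₁, hp₁⟩ := h₃.exists_path hne
  exact hG (contains_house_of_theta hne h₃.left_notMem h₂.left_notMem h₁.left_notMem
    h₃.right_notMem h₂.right_notMem h₁.right_notMem h₂₃.symm h₁₃.symm h₁₂.symm hp₁ hp₂ hp₃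
    fun e => absurd e hxy)

end linking

section sides

variable {V : Type} {G : SimpleGraph V}

lemma exists_component_of_mem {M : Set V} {v : V} (hv : v ∈ M) :
    ∃ T : Set V, T ⊆ M ∧ v ∈ T ∧ IsConn G T ∧ ∀ w ∈ M, ∀ t ∈ T, G.Adj t w → w ∈ T := by
  set T : Set V := {w | ReachIn G M v w} with hT
  have hTM : ∀ w ∈ T, w ∈ M := fun w hw => ReachIn.mem hw hv
  have hconn : ∀ w, ReachIn G M v w → ReachIn G T v w := by
    intro w hw
    induction hw with
    | refl => exact Relation.ReflTransGen.refl
    | tail h1 h2 ih => exact ih.trans (ReachIn.of_adj h2.1 h1 (h1.tail h2))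
  exact ⟨T, hTM, Relation.ReflTransGen.refl,
    fun u hu w hw => (hconn u hu).symm.trans (hconn w hw),
    fun w hw t ht hadj => Relation.ReflTransGen.tail ht ⟨hadj, hTM t ht, hw⟩⟩

lemma IsConn.subset_of_closed {C T : Set V} (hC : IsConn G C) {v : V} (hvC : v ∈ C) (hvT : v ∈ T)
    (hT : ∀ w ∈ C, ∀ t ∈ T, G.Adj t w → w ∈ T) : C ⊆ T := by
  intro w hw
  have := hC v hvC w hw
  induction this with
  | refl => exact hvT
  | tail h1 h2 ih => exact hT _ h2.2.2 _ (ih h2.2.1) h2.1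

/-- Disjoint anticomplete connected sets `A`, `B` both of which every vertex of `S` sees. -/
structure TwoSides (G : SimpleGraph V) (A B S : Set V) : Prop where
  connA : IsConn G A
  connB : IsConn G B
  anti : Anti G A B
  notA : ∀ s ∈ S, s ∉ A
  notB : ∀ s ∈ S, s ∉ B
  nbrA : ∀ s ∈ S, ∃ a ∈ A, G.Adj s a
  nbrB : ∀ s ∈ S, ∃ b ∈ B, G.Adj s b

lemma TwoSides.symm {A B S : Set V} (h : TwoSides G A B S) : TwoSides G B A S :=
  ⟨h.connB, h.connA, h.anti.symm, h.notB, h.notA, h.nbrB, h.nbrA⟩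

/-- `s` and `t` both have neighbours in the connected set `Z ⊆ A`, but no common one. -/
structure Far (G : SimpleGraph V) (A S : Set V) (s t : V) (Z : Set V) : Prop where
  left : s ∈ S
  right : t ∈ S
  ne : s ≠ t
  sub : Z ⊆ A
  link : Link G s t Z
  no_common : ∀ z ∈ Z, G.Adj s z → ¬ G.Adj t z

variable {A B S : Set V}

lemma TwoSides.link_right (h : TwoSides G A B S) {s t : V} (hs : s ∈ S) (ht : t ∈ S) :
    Link G s t B :=
  ⟨h.connB, h.notB s hs, h.notB t ht, h.nbrB s hs, h.nbrB t ht⟩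

lemma Far.not_adj (hG : ¬ ContainsInducedSubdivision house G) (h : TwoSides G A B S) {s t : V}
    {Z : Set V} (hf : Far G A S s t Z) : ¬ G.Adj s t := by
  intro hst
  obtain ⟨z, hz, h1, h2⟩ := exists_common_neighbor_of_adj hG hst hf.link
    (h.link_right hf.left hf.right) (fun u hu v hv => h.anti u (hf.sub hu) v hv)
  exact hf.no_common z hz h1 h2

lemma TwoSides.dominated_of_not_far [Finite V] (h : TwoSides G A B S) (hA : A.Nonempty)
    (hfar : ∀ s t Z, ¬ Far G A S s t Z) : ∃ a ∈ A, ∀ s ∈ S, G.Adj s a := by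
  obtain ⟨a, ha, hmax⟩ := Set.exists_max_image A (fun a => (S ∩ {s | G.Adj s a}).ncard)
    (Set.toFinite _) hA
  refine ⟨a, ha, ?_⟩
  by_contra! hcon
  obtain ⟨t, ht, hta⟩ := hcon
  obtain ⟨f, hf, htf⟩ := h.nbrA t ht
  obtain ⟨D, hDA, hDt, haD, hD, -, d, hd, c, hc, htc, hdc⟩ :=
    h.connA.exists_component (F := {w | G.Adj t w}) ha hta hf htf
  have hZ : insert c D ⊆ A := Set.insert_subset hc hDA
  have key : ∀ s ∈ S, G.Adj s a → G.Adj s c := by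
    intro s hs hsa
    by_contra hsc
    refine hfar s t (insert c D) ⟨hs, ht, ?_, hZ, ⟨hD.insert hd hdc.symm, fun e =>
      h.notA s hs (hZ e), fun e => h.notA t ht (hZ e), ⟨a, Or.inr haD, hsa⟩, ⟨c, Or.inl rfl, htc⟩⟩,
      ?_⟩
    · rintro rfl
      exact hta hsa
    · rintro z (rfl | hz) h1 h2
      · exact hsc h1
      · exact hDt z hz h2
  have := hmax c hc
  refine absurd this (not_le.2 (Set.ncard_lt_ncard ⟨fun s hs => ⟨hs.1, key s hs.1 hs.2⟩, fun hsub =>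
    hta (hsub ⟨ht, htc⟩).2⟩ (Set.toFinite _)))

lemma Anti.not_mem {X Y : Set V} (h : Anti G X Y) {u : V} (hu : u ∈ X) : u ∉ Y :=
  fun hv => (h u hu u hv).1 rfl

/-- A vertex of `S` far from `s` and `t` reaches the connected set `Z ⊆ A` through `A`, avoiding
the neighbourhoods of `s` and `t`. -/
lemma TwoSides.exists_tentacle (hG : ¬ ContainsInducedSubdivision house G)
    (h : TwoSides G A B S) {s t u : V} (hs : s ∈ S) (ht : t ∈ S) (hu : u ∈ S) (hus : u ≠ s)
    (hut : u ≠ t) (hs' : ¬ G.Adj u s) (ht' : ¬ G.Adj u t) {Z : Set V} (hZA : Z ⊆ A)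
    (hZ : Link G s t Z) :
    ∃ T : Set V, IsConn G T ∧ u ∈ T ∧ T ⊆ insert u A ∧ (∀ w ∈ T, w ∉ Z) ∧
      (∀ w ∈ T, ¬ G.Adj s w) ∧ (∀ w ∈ T, ¬ G.Adj t w) ∧ ∃ w ∈ T, ∃ z ∈ Z, G.Adj w z := by
  obtain ⟨z₀, hz₀, hsz₀⟩ := hZ.left
  obtain ⟨a, ha, hua⟩ := h.nbrA u hu
  have huA := h.notA u hu
  obtain ⟨T, hTM, hTF, huT, hT, hTmax, τ, hτ, q, hq, hqF, hτq⟩ :=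
    (h.connA.insert ha hua).exists_component (v := u) (f := z₀)
      (F := {w | G.Adj s w ∨ G.Adj t w ∨ w ∈ Z}) (Or.inl rfl)
      (by rintro (e | e | e)
          · exact hs' e.symm
          · exact ht' e.symm
          · exact huA (hZA e)) (Or.inr (hZA hz₀)) (Or.inr (Or.inr hz₀))
  refine ⟨T, hT, huT, hTM, fun w hw e => hTF w hw (Or.inr (Or.inr e)),
    fun w hw e => hTF w hw (Or.inl e), fun w hw e => hTF w hw (Or.inr (Or.inl e)), ?_⟩
  by_contra! hcon
  have hqA : q ∈ A := by
    rcases hq with rfl | hq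
    · exact absurd hqF (hTF _ huT)
    · exact hq
  have hZF : ∀ z ∈ Z, z ∉ {w | w ∈ T ∨ ∃ t ∈ T, G.Adj t w} := by
    rintro z hz (e | ⟨w, hw, e⟩)
    · exact hTF z e (Or.inr (Or.inr hz))
    · exact hcon w hw z hz e
  obtain ⟨D, hDA, hDF, hzD, hD, hDmax, d, hd, x, hxA, hxF, hdx⟩ :=
    h.connA.exists_component (v := z₀) (f := q) (hZA hz₀) (hZF z₀ hz₀) hqA (Or.inr ⟨τ, hτ, hτq⟩)
  have hZD : Z ⊆ D := hZ.conn.subset_of_closed hz₀ hzD fun w hw c hc e =>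
    hDmax w (hZA hw) (hZF w hw) c hc e
  have hxT : x ∉ T := fun e => hDF d hd (Or.inr ⟨x, e, hdx.symm⟩)
  obtain ⟨w, hw, hwx⟩ : ∃ t ∈ T, G.Adj t x := hxF.resolve_left hxT
  have hTS : ∀ y ∈ S, y ≠ u → y ∉ T := by
    intro y hy hyu e
    rcases hTM e with e | e
    · exact hyu e
    · exact h.notA y hy e
  obtain ⟨b, hb, hub⟩ := h.nbrB u hu
  have main : ∀ y ∈ S, y ≠ u → G.Adj x y → (∀ w ∈ T, ¬ G.Adj y w) → (∃ z ∈ Z, G.Adj y z) →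
      False := by
    rintro y hy hyu hxy hyT ⟨z, hz, hyz⟩
    obtain ⟨c, hc, hxc, hyc⟩ := exists_common_neighbor_of_adj hG hxy (X₁ := T ∪ B) (X₂ := D)
      ⟨hT.union h.connB huT hb hub, fun e => e.elim hxT (h.anti.not_mem hxA),
        fun e => e.elim (hTS y hy hyu) (h.notB y hy), ⟨w, Or.inl hw, hwx.symm⟩,
        (h.nbrB y hy).imp fun b hb => ⟨Or.inr hb.1, hb.2⟩⟩
      ⟨hD, fun e => hDF x e hxF, fun e => h.notA y hy (hDA e), ⟨d, hd, hdx.symm⟩, ⟨z, hZD hz, hyz⟩⟩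
      (by
        rintro v (hv | hv) v' hv'
        · exact ⟨fun e => hDF v' hv' (Or.inl (e ▸ hv)), fun e => hDF v' hv' (Or.inr ⟨v, hv, e⟩)⟩
        · exact h.anti.symm v hv v' (hDA hv'))
    rcases hc with hc | hc
    · exact hyT c hc hyc
    · exact (h.anti x hxA c hc).2 hxc
  by_cases hxZ : G.Adj s x ∨ G.Adj t x ∨ x ∈ Z
  · rcases hxZ with e | e | e
    · exact main s hs hus.symm e.symm (fun w hw e => hTF w hw (Or.inl e)) hZ.left
    · exact main t ht hut.symm e.symm (fun w hw e => hTF w hw (Or.inr (Or.inl e))) hZ.right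
    · exact hcon w hw x e hwx
  · exact hxT (hTmax x (Or.inr hxA) hxZ w hw hwx)

/-- A connected set attached to a hole can be shrunk so as to see a single vertex of one side. -/
lemma exists_single_attachment (hG : ¬ ContainsInducedSubdivision house G) {p : ℕ → V} {m : ℕ}
    (hinj : ∀ i ≤ m, ∀ j ≤ m, p i = p j → i = j) (hadj : ∀ i < m, G.Adj (p i) (p (i + 1)))
    (hind : ∀ i ≤ m, ∀ j ≤ m, G.Adj (p i) (p j) → i + 1 = j ∨ j + 1 = i) {X Y : Set V}
    (hY : IsConn G Y) (hYP : ∀ y ∈ Y, ∀ i, 0 < i → i ≤ m → y ≠ p i ∧ ¬ G.Adj y (p i))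
    (hY₀ : ∃ y ∈ Y, G.Adj (p 0) y) (hX : IsConn G X)
    (hXP : ∀ x ∈ X, ∀ i ≤ m, x ≠ p i) (hXY : ∀ x ∈ X, x ∉ Y) (hX₀ : ∀ x ∈ X, ¬ G.Adj x (p 0))
    (hXP' : ∃ x ∈ X, ∃ i, 0 < i ∧ i ≤ m ∧ G.Adj x (p i)) (hXY' : ∃ x ∈ X, ∃ y ∈ Y, G.Adj x y) :
    ∃ X' ⊆ X, IsConn G X' ∧ (∃ x ∈ X', ∃ y ∈ Y, G.Adj x y) ∧
      ∃ i, 0 < i ∧ i ≤ m ∧ (∃ x ∈ X', G.Adj x (p i)) ∧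
        ∀ x ∈ X', ∀ j, 0 < j → j ≤ m → G.Adj x (p j) → j = i := by
  classical
  set F : Set V := {w | ∃ i, 0 < i ∧ i ≤ m ∧ G.Adj w (p i)} with hF
  obtain ⟨y, hyX, y', hy', hyy'⟩ := hXY'
  obtain ⟨f, hfX, hfF⟩ := hXP'
  obtain ⟨T, x, hTX, hxX, hxF, hTF, hTx, hTY, hxTY, hTxY⟩ : ∃ (T : Set V) (x : V), T ⊆ X ∧ x ∈ X ∧
      x ∈ F ∧ (∀ w ∈ T, w ∉ F) ∧ IsConn G (insert x T) ∧ IsConn G (T ∪ Y) ∧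
      (∃ z ∈ T ∪ Y, G.Adj x z) ∧ ∃ z ∈ insert x T, ∃ y ∈ Y, G.Adj z y := by
    by_cases hyF : y ∈ F
    · refine ⟨∅, y, Set.empty_subset _, hyX, hyF, fun w hw => absurd hw (Set.notMem_empty w), ?_,
        ?_,
        ⟨y', Or.inr hy', hyy'⟩, y, Or.inl rfl, y', hy', hyy'⟩
      · simpa using isConn_singleton y
      · simpa using hY
    · obtain ⟨T, hTX, hTF, hyT, hT, -, t, ht, q, hq, hqF, htq⟩ :=
        hX.exists_component hyX hyF hfX hfF
      exact ⟨T, q, hTX, hq, hqF, hTF, hT.insert ht htq.symm, hT.union hY hyT hy' hyy',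
        ⟨t, Or.inl ht, htq.symm⟩, y, Or.inr hyT, y', hy', hyy'⟩
  have hx : ∃ i, 0 < i ∧ i ≤ m ∧ G.Adj x (p i) := hxF
  obtain ⟨hi0, him, hxi⟩ := Nat.find_spec hx
  have hmin : ∀ j, 0 < j → j ≤ m → G.Adj x (p j) → Nat.find hx ≤ j :=
    fun j h1 h2 h3 => Nat.find_min' hx ⟨h1, h2, h3⟩
  generalize Nat.find hx = i at hi0 him hxi hmin
  refine ⟨insert x T, Set.insert_subset hxX hTX, hTx, hTxY, i, hi0, him, ⟨x, Or.inl rfl, hxi⟩, ?_⟩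
  rintro z (rfl | hz) j hj0 hjm hzj
  swap
  · exact absurd ⟨j, hj0, hjm, hzj⟩ (hTF z hz)
  by_contra hne
  have hij : i < j := lt_of_le_of_ne (hmin j hj0 hjm hzj) (Ne.symm hne)
  obtain ⟨y₀, hy₀, hpy₀⟩ := hY₀
  refine absurd (exists_common_neighbor_of_adj hG hxi
    (X₁ := {v | ∃ a, 0 ≤ a ∧ a ≤ i - 1 ∧ p a = v} ∪ (T ∪ Y))
    (X₂ := {v | ∃ a, i + 1 ≤ a ∧ a ≤ j ∧ p a = v})
    ⟨(isConn_interval fun a _ ha => hadj a (by omega)).union hTY ⟨0, le_rfl, by omega, rfl⟩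
        (Or.inr hy₀) hpy₀, ?_, ?_, hxTY.imp fun c hc => ⟨Or.inr hc.1, hc.2⟩,
        ⟨p (i - 1), Or.inl ⟨i - 1, by omega, le_rfl, rfl⟩, ?_⟩⟩
    ⟨isConn_interval fun a _ ha => hadj a (by omega), ?_, ?_, ⟨p j, ⟨j, by omega, le_rfl, rfl⟩,
      hzj⟩,
      ⟨p (i + 1), ⟨i + 1, le_rfl, by omega, rfl⟩, hadj i (by omega)⟩⟩ ?_) ?_
  · rintro (⟨a, -, ha, e⟩ | e | e)
    · exact hXP z hxX a (by omega) e.symm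
    · exact hTF z e hxF
    · exact hXY z hxX e
  · rintro (⟨a, -, ha, e⟩ | e | e)
    · have := hinj a (by omega) i him e
      omega
    · exact hXP _ (hTX e) i him rfl
    · exact (hYP _ e i hi0 him).1 rfl
  · have := hadj (i - 1) (by omega)
    rw [Nat.sub_add_cancel hi0] at this
    exact this.symm
  · rintro ⟨a, -, ha, e⟩
    exact hXP z hxX a (by omega) e.symm
  · rintro ⟨a, ha, ha', e⟩
    have := hinj a (by omega) i him e
    omega
  · rintro u (⟨a, -, ha, rfl⟩ | hu | hu) v ⟨b, hb, hb', rfl⟩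
    · refine ⟨fun e => ?_, fun e => ?_⟩
      · have := hinj a (by omega) b (by omega) e
        omega
      · have := hind a (by omega) b (by omega) e
        omega
    · exact ⟨hXP u (hTX hu) b (by omega), fun e => hTF u hu ⟨b, by omega, by omega, e⟩⟩
    · exact hYP u hu b (by omega) (by omega)
  · rintro ⟨c, hc, hzc, hpc⟩
    rcases hc with ⟨a, -, ha, rfl⟩ | hc | hc
    · have := hind _ him a (by omega) hpc
      rcases Nat.eq_zero_or_pos a with rfl | ha0
      · exact hX₀ z hxX hzc
      · have := hmin a ha0 (by omega) hzc
        omega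
    · exact hTF c hc ⟨i, hi0, him, hpc.symm⟩
    · exact (hYP c hc i hi0 him).2 hpc.symm

end sides

section outerVertices

variable {V : Type} {G : SimpleGraph V} {A B S : Set V}

lemma IsLinkPath.adj_consecutive {x y : V} {X : Set V} {p : ℕ → V} {n : ℕ}
    (h : IsLinkPath G x y X p n) (hxy : ¬ G.Adj x y) :
    ∀ i ≤ n, ∀ j ≤ n, G.Adj (p i) (p j) → i + 1 = j ∨ j + 1 = i := by
  intro i hi j hj hij
  rcases h.ind i hi j hj hij with e | e | ⟨e, e'⟩ | ⟨e, e'⟩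
  · exact Or.inl e
  · exact Or.inr e
  · rw [e, e'] at hij
    exact absurd hij hxy
  · rw [e, e'] at hij
    exact absurd hij.symm hxy

/-- A connected set seeing exactly one interior vertex of each of two anticomplete paths joining
`s` to `t`: the two vertices seen are adjacent to `s`. -/
lemma adj_start_of_single_attachments (hG : ¬ ContainsInducedSubdivision house G) {s t : V}
    {p q : ℕ → V} {n m : ℕ} (hAB : Anti G A B) (hst : ¬ G.Adj s t) (hsA : s ∉ A) (hsB : s ∉ B)
    (htA : t ∉ A) (htB : t ∉ B) (hp : IsLinkPath G s t A p n) (hq : IsLinkPath G s t B q m)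
    {X : Set V} (hX : IsConn G X) (hXp : ∀ x ∈ X, ∀ i ≤ n, x ≠ p i)
    (hXq : ∀ x ∈ X, ∀ i ≤ m, x ≠ q i) (hXs : ∀ x ∈ X, ¬ G.Adj x s) (hXt : ∀ x ∈ X, ¬ G.Adj x t)
    {i j : ℕ} (hi : 0 < i) (hin : i < n) (hj : 0 < j) (hjm : j < m)
    (hXi : ∃ x ∈ X, G.Adj x (p i)) (hXj : ∃ x ∈ X, G.Adj x (q j))
    (hpi : ∀ x ∈ X, ∀ a, 0 < a → a < n → G.Adj x (p a) → a = i)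
    (hqj : ∀ x ∈ X, ∀ a, 0 < a → a < m → G.Adj x (q a) → a = j) :
    G.Adj s (p i) ∧ G.Adj t (p i) := by
  have hpA := hp.mem i hi hin
  have hqB := hq.mem j hj hjm
  have hne : p i ≠ q j := (hAB _ hpA _ hqB).1
  have hnadj : ¬ G.Adj (p i) (q j) := (hAB _ hpA _ hqB).2
  have hpc := hp.adj_consecutive hst
  have hqc := hq.adj_consecutive hst
  obtain ⟨x, hx, hxi⟩ := hXi
  obtain ⟨x', hx', hxj⟩ := hXj
  have hXp' : p i ∉ X := fun e => hXp _ e i hin.le rfl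
  have hXq' : q j ∉ X := fun e => hXq _ e j hjm.le rfl
  have LX : Link G (p i) (q j) X := ⟨hX, hXp', hXq', ⟨x, hx, hxi.symm⟩, ⟨x', hx', hxj.symm⟩⟩
  have hpq : ∀ a, 0 < a → a < n → ∀ b, 0 < b → b < m → p a ≠ q b ∧ ¬ G.Adj (p a) (q b) :=
    fun a ha ha' b hb hb' => hAB _ (hp.mem a ha ha') _ (hq.mem b hb hb')
  have hpi1 : G.Adj (p i) (p (i - 1)) := by
    have := hp.adj (i - 1) (by omega)
    rw [Nat.sub_add_cancel hi] at this
    exact this.symm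
  have hqj1 : G.Adj (q j) (q (j - 1)) := by
    have := hq.adj (j - 1) (by omega)
    rw [Nat.sub_add_cancel hj] at this
    exact this.symm
  have h0 : p 0 = q 0 := hp.zero.trans hq.zero.symm
  have hl : p n = q m := hp.last.trans hq.last.symm
  have p_ne : ∀ a ≤ n, ∀ b, 0 < b → b < m → p a ≠ q b := by
    intro a ha b hb hb' e
    have hbB := hq.mem b hb hb'
    rw [← e] at hbB
    rcases hp.cases ha with e' | e' | e'
    · exact hsB (e' ▸ hbB)
    · exact htB (e' ▸ hbB)
    · exact hAB.not_mem e' hbB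
  have q_ne : ∀ b ≤ m, ∀ a, 0 < a → a < n → q b ≠ p a := by
    intro b hb a ha ha' e
    have haA := hp.mem a ha ha'
    rw [← e] at haA
    rcases hq.cases hb with e' | e' | e'
    · exact hsA (e' ▸ haA)
    · exact htA (e' ▸ haA)
    · exact hAB.not_mem haA e'
  have L₁ : Link G (p i) (q j)
      ({v | ∃ a, 0 ≤ a ∧ a ≤ i - 1 ∧ p a = v} ∪ {v | ∃ a, 0 ≤ a ∧ a ≤ j - 1 ∧ q a = v}) := by
    refine ⟨(isConn_interval fun a _ ha => hp.adj a (by omega)).union_of_mem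
      (isConn_interval fun a _ ha => hq.adj a (by omega)) ⟨0, le_rfl, by omega, rfl⟩
      ⟨0, le_rfl, by omega, h0.symm⟩, ?_, ?_, ⟨p (i - 1), Or.inl ⟨i - 1, by omega, by omega, rfl⟩,
        hpi1⟩,
      ⟨q (j - 1), Or.inr ⟨j - 1, by omega, by omega, rfl⟩, hqj1⟩⟩
    · rintro (⟨a, -, ha, e⟩ | ⟨a, -, ha, e⟩)
      · have := hp.inj a (by omega) i (by omega) e
        omega
      · exact q_ne a (by omega) i hi hin e
    · rintro (⟨a, -, ha, e⟩ | ⟨a, -, ha, e⟩)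
      · exact p_ne a (by omega) j hj hjm e
      · have := hq.inj a (by omega) j (by omega) e
        omega
  have L₂ : Link G (p i) (q j)
      ({v | ∃ a, i + 1 ≤ a ∧ a ≤ n ∧ p a = v} ∪ {v | ∃ a, j + 1 ≤ a ∧ a ≤ m ∧ q a = v}) := by
    refine ⟨(isConn_interval fun a _ ha => hp.adj a (by omega)).union_of_mem
      (isConn_interval fun a _ ha => hq.adj a (by omega)) ⟨n, by omega, le_rfl, rfl⟩
      ⟨m, by omega, le_rfl, hl.symm⟩, ?_, ?_,
      ⟨p (i + 1), Or.inl ⟨i + 1, by omega, by omega, rfl⟩, hp.adj i hin⟩,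
      ⟨q (j + 1), Or.inr ⟨j + 1, by omega, by omega, rfl⟩, hq.adj j hjm⟩⟩
    · rintro (⟨a, ha', ha, e⟩ | ⟨a, ha', ha, e⟩)
      · have := hp.inj a (by omega) i (by omega) e
        omega
      · exact q_ne a (by omega) i hi hin e
    · rintro (⟨a, ha', ha, e⟩ | ⟨a, ha', ha, e⟩)
      · exact p_ne a (by omega) j hj hjm e
      · have := hq.inj a (by omega) j (by omega) e
        omega
  have cross : ∀ {r r' : ℕ → V} {k k' : ℕ}, r 0 = r' 0 → r k = r' k' →
      (∀ a, 0 < a → a < k → ∀ b, 0 < b → b < k' → r a ≠ r' b ∧ ¬ G.Adj (r a) (r' b)) →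
      (∀ a ≤ k, ∀ b ≤ k, r a = r b → a = b) → (∀ a ≤ k', ∀ b ≤ k', r' a = r' b → a = b) →
      (∀ a ≤ k, ∀ b ≤ k, G.Adj (r a) (r b) → a + 1 = b ∨ b + 1 = a) →
      (∀ a ≤ k', ∀ b ≤ k', G.Adj (r' a) (r' b) → a + 1 = b ∨ b + 1 = a) →
      ∀ a b, a + 1 < k → 1 < b → b ≤ k' → r a ≠ r' b ∧ ¬ G.Adj (r a) (r' b) := by
    intro r r' k k' h0 hl hrr hinj hinj' hc hc' a b ha hb hb'
    rcases Nat.eq_zero_or_pos a with rfl | ha0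
    · rw [h0]
      refine ⟨fun e => ?_, fun e => ?_⟩
      · have := hinj' 0 (by omega) b hb' e
        omega
      · have := hc' 0 (by omega) b hb' e
        omega
    · rcases hb'.lt_or_eq with hb' | rfl
      · exact hrr a ha0 (by omega) b (by omega) hb'
      · rw [← hl]
        refine ⟨fun e => ?_, fun e => ?_⟩
        · have := hinj a (by omega) k le_rfl e
          omega
        · have := hc a (by omega) k le_rfl e
          omega
  have A₁₂ : Anti G
      ({v | ∃ a, 0 ≤ a ∧ a ≤ i - 1 ∧ p a = v} ∪ {v | ∃ a, 0 ≤ a ∧ a ≤ j - 1 ∧ q a = v})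
      ({v | ∃ a, i + 1 ≤ a ∧ a ≤ n ∧ p a = v} ∪ {v | ∃ a, j + 1 ≤ a ∧ a ≤ m ∧ q a = v}) := by
    rintro u (⟨a, -, ha, rfl⟩ | ⟨a, -, ha, rfl⟩) v (⟨b, hb, hb', rfl⟩ | ⟨b, hb, hb', rfl⟩)
    · refine ⟨fun e => ?_, fun e => ?_⟩
      · have := hp.inj a (by omega) b (by omega) e
        omega
      · have := hpc a (by omega) b (by omega) e
        omega
    · exact cross h0 hl hpq hp.inj hq.inj hpc hqc a b (by omega) (by omega) hb'
    · exact cross h0.symm hl.symm (fun a ha ha' b hb hb' => ⟨(hpq b hb hb' a ha ha').1.symm,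
        fun e => (hpq b hb hb' a ha ha').2 e.symm⟩) hq.inj hp.inj hqc hpc a b (by omega) (by omega)
          hb'
    · refine ⟨fun e => ?_, fun e => ?_⟩
      · have := hq.inj a (by omega) b (by omega) e
        omega
      · have := hqc a (by omega) b (by omega) e
        omega
  have AX : ∀ x ∈ X, ∀ a ≤ n, a ≠ i → x ≠ p a ∧ ¬ G.Adj x (p a) := by
    intro x hx a ha hai
    refine ⟨hXp x hx a ha, fun e => ?_⟩
    rcases Nat.eq_zero_or_pos a with rfl | ha0
    · rw [hp.zero] at e
      exact hXs x hx e
    · rcases ha.lt_or_eq with ha | rfl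
      · exact hai (hpi x hx a ha0 ha e)
      · rw [hp.last] at e
        exact hXt x hx e
  have BX : ∀ x ∈ X, ∀ a ≤ m, a ≠ j → x ≠ q a ∧ ¬ G.Adj x (q a) := by
    intro x hx a ha hai
    refine ⟨hXq x hx a ha, fun e => ?_⟩
    rcases Nat.eq_zero_or_pos a with rfl | ha0
    · rw [hq.zero] at e
      exact hXs x hx e
    · rcases ha.lt_or_eq with ha | rfl
      · exact hai (hqj x hx a ha0 ha e)
      · rw [hq.last] at e
        exact hXt x hx e
  have AX₁ : Anti G X
      ({v | ∃ a, 0 ≤ a ∧ a ≤ i - 1 ∧ p a = v} ∪ {v | ∃ a, 0 ≤ a ∧ a ≤ j - 1 ∧ q a = v}) := by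
    rintro u hu v (⟨a, -, ha, rfl⟩ | ⟨a, -, ha, rfl⟩)
    · exact AX u hu a (by omega) (by omega)
    · exact BX u hu a (by omega) (by omega)
  have AX₂ : Anti G X
      ({v | ∃ a, i + 1 ≤ a ∧ a ≤ n ∧ p a = v} ∪ {v | ∃ a, j + 1 ≤ a ∧ a ≤ m ∧ q a = v}) := by
    rintro u hu v (⟨a, ha', ha, rfl⟩ | ⟨a, ha', ha, rfl⟩)
    · exact AX u hu a (by omega) (by omega)
    · exact BX u hu a (by omega) (by omega)
  constructor
  · obtain ⟨c, hc, hpc', hqc'⟩ := exists_common_neighbor_of_not_adj hG hne hnadj L₁ L₂ LX A₁₂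
      AX₁.symm AX₂.symm
    rcases hc with ⟨a, -, ha, rfl⟩ | ⟨a, -, ha, rfl⟩ <;> rcases Nat.eq_zero_or_pos a with rfl | ha0
    · rw [hp.zero] at hpc'
      exact hpc'.symm
    · exact absurd hqc'.symm (hpq a ha0 (by omega) j hj hjm).2
    · rw [hq.zero] at hpc'
      exact hpc'.symm
    · exact absurd hpc' (hpq i hi hin a ha0 (by omega)).2
  · obtain ⟨c, hc, hpc', hqc'⟩ := exists_common_neighbor_of_not_adj hG hne hnadj L₂ L₁ LX A₁₂.symm
      AX₂.symm AX₁.symm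
    rcases hc with ⟨a, ha', ha, rfl⟩ | ⟨a, ha', ha, rfl⟩ <;> rcases ha.lt_or_eq with ha0 | rfl
    · exact absurd hqc'.symm (hpq a (by omega) ha0 j hj hjm).2
    · rw [hp.last] at hpc'
      exact hpc'.symm
    · exact absurd hpc' (hpq i hi hin a (by omega) ha0).2
    · rw [hq.last] at hpc'
      exact hpc'.symm

lemma IsLinkPath.link_interior {s t : V} {p : ℕ → V} {n : ℕ} (hsA : s ∉ A) (htA : t ∉ A)
    (hp : IsLinkPath G s t A p (n + 2)) :
    Link G s t {v | ∃ i, 1 ≤ i ∧ i ≤ n + 1 ∧ p i = v} := by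
  have hsub : ∀ v, (∃ i, 1 ≤ i ∧ i ≤ n + 1 ∧ p i = v) → v ∈ A := by
    rintro v ⟨i, hi, hi', rfl⟩
    exact hp.mem i hi (by omega)
  refine ⟨isConn_interval fun a _ ha => hp.adj a (by omega), fun e => hsA (hsub _ e),
    fun e => htA (hsub _ e), ⟨p 1, ⟨1, le_rfl, by omega, rfl⟩, ?_⟩,
    ⟨p (n + 1), ⟨n + 1, by omega, le_rfl, rfl⟩, ?_⟩⟩
  · rw [← hp.zero]
    exact hp.adj 0 (by omega)
  · rw [← hp.last]
    exact (hp.adj (n + 1) (by omega)).symm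

/-- Every other vertex of `S` is adjacent to one of two far vertices of `S`. -/
lemma Far.adj_or_adj (hG : ¬ ContainsInducedSubdivision house G) (h : TwoSides G A B S) {s t : V}
    {Z : Set V} (hf : Far G A S s t Z) {u : V} (hu : u ∈ S) (hus : u ≠ s) (hut : u ≠ t) :
    G.Adj u s ∨ G.Adj u t := by
  by_contra! hcon
  obtain ⟨hs', ht'⟩ := hcon
  have hst := hf.not_adj hG h
  have hsA := h.notA s hf.left
  have hsB := h.notB s hf.left
  have htA := h.notA t hf.right
  have htB := h.notB t hf.right
  obtain ⟨p, n, hp⟩ := hf.link.exists_long_path hf.ne hf.no_common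
  replace hp : IsLinkPath G s t A p (n + 3) :=
    ⟨hp.zero, hp.last, fun i h1 h2 => hf.sub (hp.mem i h1 h2), hp.inj, hp.adj, hp.ind⟩
  obtain ⟨q, m, hq⟩ := (h.link_right hf.left hf.right).exists_path hf.ne
  have hpc := hp.adj_consecutive hst
  have hqc := hq.adj_consecutive hst
  have hpA : ∀ v, (∃ i, 1 ≤ i ∧ i ≤ n + 2 ∧ p i = v) → v ∈ A := by
    rintro v ⟨i, hi, hi', rfl⟩
    exact hp.mem i hi (by omega)
  have hqB : ∀ v, (∃ i, 1 ≤ i ∧ i ≤ m + 1 ∧ q i = v) → v ∈ B := by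
    rintro v ⟨i, hi, hi', rfl⟩
    exact hq.mem i hi (by omega)
  have LP := hp.link_interior hsA htA
  have LQ := hq.link_interior hsB htB
  obtain ⟨T, hT, huT, hTA, hTZ, hTs, hTt, w, hwT, _, ⟨i₀, hi₀, hi₀', rfl⟩, hw⟩ :=
    h.exists_tentacle hG hf.left hf.right hu hus hut hs' ht' hpA LP
  obtain ⟨U, hU, huU, hUB, hUZ, hUs, hUt, w', hwU, z', ⟨j₀, hj₀, hj₀', rfl⟩, hw'⟩ :=
    h.symm.exists_tentacle hG hf.left hf.right hu hus hut hs' ht' hqB LQ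
  have hXs : ∀ x ∈ T ∪ U, ¬ G.Adj x s := fun x hx e => hx.elim (fun hx => hTs x hx e.symm)
    fun hx => hUs x hx e.symm
  have hXt : ∀ x ∈ T ∪ U, ¬ G.Adj x t := fun x hx e => hx.elim (fun hx => hTt x hx e.symm)
    fun hx => hUt x hx e.symm
  have hXcases : ∀ x ∈ T ∪ U, x = u ∨ (x ∈ A ∧ x ∈ T) ∨ (x ∈ B ∧ x ∈ U) := by
    rintro x (hx | hx)
    · rcases hTA hx with e | e
      · exact Or.inl e
      · exact Or.inr (Or.inl ⟨e, hx⟩)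
    · rcases hUB hx with e | e
      · exact Or.inl e
      · exact Or.inr (Or.inr ⟨e, hx⟩)
  have hXp : ∀ x ∈ T ∪ U, ∀ i ≤ n + 3, x ≠ p i := by
    rintro x hx i hi rfl
    have key : p i ≠ s ∧ p i ≠ t → p i ∈ A ∧ (∃ j, 1 ≤ j ∧ j ≤ n + 2 ∧ p j = p i) := by
      rintro ⟨h1, h2⟩
      have : i ≠ 0 := by rintro rfl; exact h1 hp.zero
      have : i ≠ n + 3 := by rintro rfl; exact h2 hp.last
      exact ⟨hp.mem i (by omega) (by omega), i, by omega, by omega, rfl⟩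
    rcases hXcases _ hx with e | ⟨e, e'⟩ | ⟨e, e'⟩
    · exact h.notA u hu (e ▸ (key ⟨fun e' => hus (e.symm.trans e'), fun e' => hut (e.symm.trans
        e')⟩).1)
    · exact hTZ _ e' (key ⟨fun e' => hsA (e' ▸ e), fun e' => htA (e' ▸ e)⟩).2
    · exact h.anti.not_mem (key ⟨fun e' => hsB (e' ▸ e), fun e' => htB (e' ▸ e)⟩).1 e
  have hXq : ∀ x ∈ T ∪ U, ∀ i ≤ m + 2, x ≠ q i := by
    rintro x hx i hi rfl
    have key : q i ≠ s ∧ q i ≠ t → q i ∈ B ∧ (∃ j, 1 ≤ j ∧ j ≤ m + 1 ∧ q j = q i) := by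
      rintro ⟨h1, h2⟩
      have : i ≠ 0 := by rintro rfl; exact h1 hq.zero
      have : i ≠ m + 2 := by rintro rfl; exact h2 hq.last
      exact ⟨hq.mem i (by omega) (by omega), i, by omega, by omega, rfl⟩
    rcases hXcases _ hx with e | ⟨e, e'⟩ | ⟨e, e'⟩
    · exact h.notB u hu (e ▸ (key ⟨fun e' => hus (e.symm.trans e'), fun e' => hut (e.symm.trans
        e')⟩).1)
    · exact h.anti.not_mem e (key ⟨fun e' => hsA (e' ▸ e), fun e' => htA (e' ▸ e)⟩).1
    · exact hUZ _ e' (key ⟨fun e' => hsB (e' ▸ e), fun e' => htB (e' ▸ e)⟩).2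
  obtain ⟨X, hXsub, hX, ⟨x₁, hx₁, _, ⟨j₁, hj₁, hj₁', rfl⟩, hxj₁⟩, i, hi, hi', hXi, hXi'⟩ :=
    exists_single_attachment hG (p := p) (m := n + 2) (X := T ∪ U)
      (Y := {v | ∃ i, 1 ≤ i ∧ i ≤ m + 1 ∧ q i = v})
      (fun i hi j hj => hp.inj i (by omega) j (by omega)) (fun i hi => hp.adj i (by omega))
      (fun i hi j hj => hpc i (by omega) j (by omega)) LQ.conn
      (fun y hy i hi hi' => h.anti.symm y (hqB y hy) _ (hp.mem i hi (by omega)))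
      (by rw [hp.zero]; exact LQ.left) (hT.union_of_mem hU huT huU)
      (fun x hx i hi => hXp x hx i (by omega))
      (by rintro x hx ⟨i, hi, hi', e⟩; exact hXq x hx i (by omega) e.symm)
      (by rw [hp.zero]; exact hXs) ⟨w, Or.inl hwT, i₀, hi₀, hi₀', hw⟩
      ⟨w', Or.inr hwU, q j₀, ⟨j₀, hj₀, hj₀', rfl⟩, hw'⟩
  obtain ⟨X', hXsub', hX', ⟨x₂, hx₂, _, ⟨i₂, hi₂, hi₂', rfl⟩, hxi₂⟩, j, hj, hj', hXj, hXj'⟩ :=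
    exists_single_attachment hG (p := q) (m := m + 1) (X := X)
      (Y := {v | ∃ i, 1 ≤ i ∧ i ≤ n + 2 ∧ p i = v})
      (fun i hi j hj => hq.inj i (by omega) j (by omega)) (fun i hi => hq.adj i (by omega))
      (fun i hi j hj => hqc i (by omega) j (by omega)) LP.conn
      (fun y hy i hi hi' => h.anti y (hpA y hy) _ (hq.mem i hi (by omega)))
      (by rw [hq.zero]; exact LP.left) hX
      (fun x hx i hi => hXq x (hXsub hx) i (by omega))
      (by rintro x hx ⟨i, hi, hi', e⟩; exact hXp x (hXsub hx) i (by omega) e.symm)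
      (by rw [hq.zero]; exact fun x hx => hXs x (hXsub hx)) ⟨x₁, hx₁, j₁, hj₁, hj₁', hxj₁⟩
      (hXi.imp fun x hx => ⟨hx.1, p i, ⟨i, hi, hi', rfl⟩, hx.2⟩)
  obtain rfl := hXi' x₂ (hXsub' hx₂) i₂ hi₂ hi₂' hxi₂
  obtain ⟨h1, h2⟩ := adj_start_of_single_attachments hG h.anti hst hsA hsB htA htB hp hq hX'
    (fun x hx => hXp x (hXsub (hXsub' hx))) (fun x hx => hXq x (hXsub (hXsub' hx)))
    (fun x hx => hXs x (hXsub (hXsub' hx))) (fun x hx => hXt x (hXsub (hXsub' hx)))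
    (i := i₂) (j := j) hi (by omega) hj (by omega) ⟨x₂, hx₂, hxi₂⟩ hXj
    (fun x hx a ha ha' e => hXi' x (hXsub' hx) a ha (by omega) e)
    (fun x hx a ha ha' e => hXj' x hx a ha (by omega) e)
  rw [← hp.zero] at h1
  rw [← hp.last] at h2
  have := hpc 0 (by omega) i₂ (by omega) h1
  have := hpc (n + 3) (by omega) i₂ (by omega) h2
  omega

end outerVertices

section pocket

variable {V : Type} {G : SimpleGraph V} {A B S : Set V}

lemma link_singleton {x y v : V} (hx : G.Adj x v) (hy : G.Adj y v) : Link G x y {v} :=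
  ⟨isConn_singleton v, hx.ne, hy.ne, ⟨v, rfl, hx⟩, ⟨v, rfl, hy⟩⟩

/-- A connected subset `Z` of `A` attached to the nonadjacent vertices `s` and `t` of `S` through
single distinct vertices `p` and `p'`, and maximal with respect to the common non-neighbours. -/
structure Pocket (G : SimpleGraph V) (A S : Set V) (s t p p' : V) (Z : Set V) : Prop where
  left : s ∈ S
  right : t ∈ S
  not_adj : ¬ G.Adj s t
  sub : Z ⊆ A
  conn : IsConn G Z
  mem_left : p ∈ Z
  mem_right : p' ∈ Z
  ne : p ≠ p'
  adj_left : G.Adj s p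
  adj_right : G.Adj t p'
  eq_left : ∀ z ∈ Z, G.Adj s z → z = p
  eq_right : ∀ z ∈ Z, G.Adj t z → z = p'
  boundary : ∀ a ∈ A, a ∉ Z → ∀ z ∈ Z, G.Adj z a → G.Adj s a ∨ G.Adj t a
  cover : ∀ u ∈ S, u ≠ s → u ≠ t → G.Adj u s ∨ G.Adj u t

variable {s t p p' : V} {Z : Set V}

lemma Pocket.symm (hP : Pocket G A S s t p p' Z) : Pocket G A S t s p' p Z :=
  ⟨hP.right, hP.left, fun e => hP.not_adj e.symm, hP.sub, hP.conn, hP.mem_right, hP.mem_left,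
    hP.ne.symm, hP.adj_right, hP.adj_left, hP.eq_right, hP.eq_left,
    fun a ha haZ z hz e => (hP.boundary a ha haZ z hz e).symm,
    fun u hu h1 h2 => (hP.cover u hu h2 h1).symm⟩

lemma Pocket.adj_of_adj_left (hG : ¬ ContainsInducedSubdivision house G) (h : TwoSides G A B S)
    (hP : Pocket G A S s t p p' Z) {u : V} (hu : u ∈ S) (huZ : ∃ z ∈ Z, G.Adj u z)
    (hus : G.Adj u s) : G.Adj u p := by
  have hZu : Link G u s Z := ⟨hP.conn, fun e => h.notA u hu (hP.sub e),
    fun e => h.notA s hP.left (hP.sub e), huZ, ⟨p, hP.mem_left, hP.adj_left⟩⟩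
  obtain ⟨z, hz, huz, hsz⟩ := exists_common_neighbor_of_adj hG hus hZu (h.link_right hu hP.left)
    fun a ha b hb => h.anti a (hP.sub ha) b hb
  exact hP.eq_left z hz hsz ▸ huz

lemma Pocket.false_of_attachment (hG : ¬ ContainsInducedSubdivision house G)
    (h : TwoSides G A B S) (hP : Pocket G A S s t p p' Z) {u x d₀ : V} {D : Set V} (hu : u ∈ S)
    (hut : u ≠ t) (huZ : ∀ z ∈ Z, ¬ G.Adj u z) (hD : IsConn G D) (hDA : D ⊆ insert u A)
    (huD : u ∈ D) (hZD : Anti G Z D) (hxA : x ∈ A) (hxZ : x ∉ Z) (hxz : ∃ z ∈ Z, G.Adj x z)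
    (hd₀ : d₀ ∈ D) (hxd₀ : G.Adj x d₀) (hxs : G.Adj x s) (hus : u ≠ s) : False := by
  have hsA := h.notA s hP.left
  have hsB := h.notB s hP.left
  have htA := h.notA t hP.right
  have htB := h.notB t hP.right
  have huA := h.notA u hu
  have huB := h.notB u hu
  have hst := hP.not_adj
  have hpA := hP.sub hP.mem_left
  have hpA' := hP.sub hP.mem_right
  obtain ⟨bs, hbs, hsbs⟩ := h.nbrB s hP.left
  obtain ⟨bt, hbt, htbt⟩ := h.nbrB t hP.right
  obtain ⟨bu, hbu, hubu⟩ := h.nbrB u hu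
  have hne : s ≠ t := by
    rintro rfl
    exact hP.ne (hP.eq_left p' hP.mem_right hP.adj_right).symm
  have hAB : ∀ {a b : V}, a ∈ A → b ∈ B → ¬ G.Adj a b := fun ha hb => (h.anti _ ha _ hb).2
  have hAnB : ∀ {a : V}, a ∈ A → a ∉ B := fun ha => h.anti.not_mem ha
  have neA : ∀ {v a : V}, v ∉ A → a ∈ A → v ≠ a := fun hv ha e => hv (e ▸ ha)
  have neB : ∀ {v a : V}, v ∉ B → a ∈ B → v ≠ a := fun hv ha e => hv (e ▸ ha)
  have hxD : x ∉ D := by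
    obtain ⟨z, hz, hxz⟩ := hxz
    exact fun e => (hZD z hz x e).2 hxz.symm
  have hsD : s ∉ D := fun e => (hDA e).elim (fun e => hus e.symm) hsA
  have L₁ : Link G x s Z := ⟨hP.conn, hxZ, fun e => hsA (hP.sub e), hxz,
    ⟨p, hP.mem_left, hP.adj_left⟩⟩
  have L₂ : Link G x s (D ∪ B) := ⟨hD.union h.connB huD hbu hubu,
    fun e => e.elim hxD (hAnB hxA), fun e => e.elim hsD hsB, ⟨d₀, Or.inl hd₀, hxd₀⟩,
    ⟨bs, Or.inr hbs, hsbs⟩⟩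
  have hA₁₂ : Anti G Z (D ∪ B) := by
    rintro z hz v (hv | hv)
    · exact hZD z hz v hv
    · exact h.anti z (hP.sub hz) v hv
  have hxp : G.Adj x p := by
    obtain ⟨z, hz, hxz, hsz⟩ := exists_common_neighbor_of_adj hG hxs L₁ L₂ hA₁₂
    exact hP.eq_left z hz hsz ▸ hxz
  obtain ⟨d, hd, hxd, hsd⟩ := exists_common_neighbor_of_adj hG hxs L₂ L₁ hA₁₂.symm
  replace hd : d ∈ D := hd.resolve_right fun hd => hAB hxA hd hxd
  have hTBconn : IsConn G (insert t B) := h.connB.insert hbt htbt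
  have hsTB : s ∉ insert t B := fun e => e.elim hne hsB
  have hATB : ∀ {a : V}, a ∈ A → a ∉ insert t B :=
    fun ha e => e.elim (fun e => htA (e ▸ ha)) (hAnB ha)
  have antiTB : ∀ {a : V}, a ∈ A → ¬ G.Adj a t → Anti G (insert t B) {a} := by
    rintro a ha hat v (rfl | hv) w rfl
    · exact ⟨neA htA ha, fun e => hat e.symm⟩
    · exact h.anti.symm v hv w ha
  by_cases hxt : G.Adj x t
  · obtain ⟨z, rfl | hz, hxz, hsz⟩ := exists_common_neighbor_of_adj hG hxs
      (X₁ := insert t B) ⟨hTBconn, hATB hxA, hsTB, ⟨t, Or.inl rfl, hxt⟩, ⟨bs, Or.inr hbs, hsbs⟩⟩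
      (link_singleton hxp hP.adj_left)
      (antiTB hpA fun e => hP.ne (hP.eq_right p hP.mem_left e.symm))
    · exact hst hsz
    · exact hAB hxA hz hxz
  obtain ⟨K, hKZ, hKp, hpK, hK, -, k, hk, _, -, rfl, hkp⟩ :=
    hP.conn.exists_component (F := {p}) hP.mem_right (fun e => hP.ne e.symm) hP.mem_left rfl
  have hsK : ∀ z ∈ K, ¬ G.Adj s z := fun z hz e => hKp z hz (hP.eq_left z (hKZ hz) e)
  have hKA : ∀ {z : V}, z ∈ K → z ∈ A := fun hz => hP.sub (hKZ hz)
  have hKTB : IsConn G (K ∪ insert t B) := hK.union hTBconn hpK (Or.inl rfl) hP.adj_right.symm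
  have hsKTB : s ∉ K ∪ insert t B := fun e => e.elim (fun e => hsA (hKA e)) hsTB
  by_cases hxK : ∃ z ∈ K, G.Adj x z
  swap
  · push Not at hxK
    obtain ⟨z, hz | rfl | hz, hsz, hpz⟩ := exists_common_neighbor_of_adj hG hP.adj_left
      (X₁ := K ∪ insert t B) ⟨hKTB, hsKTB, fun e => e.elim (fun e => hKp _ e rfl) (hATB hpA),
        ⟨bs, Or.inr (Or.inr hbs), hsbs⟩, ⟨k, Or.inl hk, hkp.symm⟩⟩
      (link_singleton hxs.symm hxp.symm) (by
        rintro v (hv | hv) w rfl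
        · exact ⟨fun e => hxZ (hKZ (e ▸ hv)), fun e => hxK v hv e.symm⟩
        · exact antiTB hxA hxt v hv w rfl)
    · exact hsK z hz hsz
    · exact hst hsz
    · exact hAB hpA hz hpz
  obtain ⟨k', hk', hxk'⟩ := hxK
  have hxK' : x ∉ K := fun e => hxZ (hKZ e)
  rcases hDA hd with rfl | hdA
  swap
  · by_cases hdt : G.Adj d t
    · obtain ⟨z, rfl | hz, hdz, hsz⟩ := exists_common_neighbor_of_adj hG hsd.symm
        (X₁ := insert t B) ⟨hTBconn, hATB hdA, hsTB, ⟨t, Or.inl rfl, hdt⟩, ⟨bs, Or.inr hbs, hsbs⟩⟩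
        (link_singleton hxd.symm hxs.symm) (antiTB hxA hxt)
      · exact hst hsz
      · exact hAB hdA hz hdz
    · obtain ⟨z, hz | rfl | hz, hsz, hxz⟩ := exists_common_neighbor_of_adj hG hxs.symm
        (X₁ := K ∪ insert t B) ⟨hKTB, hsKTB, fun e => e.elim hxK' (hATB hxA),
          ⟨bs, Or.inr (Or.inr hbs), hsbs⟩, ⟨k', Or.inl hk', hxk'⟩⟩
        (link_singleton hsd hxd) (by
          rintro v (hv | hv) w rfl
          · exact hZD v (hKZ hv) w hd
          · exact antiTB hdA hdt v hv w rfl)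
      · exact hsK z hz hsz
      · exact hst hsz
      · exact hAB hxA hz hxz
  by_cases hdt : G.Adj d t
  · obtain ⟨z, rfl | hz, hdz, htz⟩ := exists_common_neighbor_of_adj hG hdt
      (X₁ := insert x Z) ⟨by
        obtain ⟨z, hz, hxz⟩ := hxz
        exact hP.conn.insert hz hxz, fun e => e.elim (neA huA hxA) fun e => huA (hP.sub e),
        fun e => e.elim (neA htA hxA) fun e => htA (hP.sub e), ⟨x, Or.inl rfl, hxd.symm⟩,
        ⟨p', Or.inr hP.mem_right, hP.adj_right⟩⟩ (h.link_right hu hP.right) (by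
        rintro v (rfl | hv) w hw
        · exact h.anti v hxA w hw
        · exact h.anti v (hP.sub hv) w hw)
    · exact hxt htz.symm
    · exact huZ z hz hdz
  obtain ⟨T, hTM, hTs, htT, hT, -, t₀, ht₀, q, hqM, hsq, ht₀q⟩ :=
    hTBconn.exists_component (F := {w | G.Adj s w}) (v := t) (Or.inl rfl) hst
      (Or.inr hbs) hsbs
  have hqB : q ∈ B := hqM.resolve_left (by rintro rfl; exact hst hsq)
  have hKT : IsConn G (K ∪ T) := hK.union hT hpK htT hP.adj_right.symm
  have hdT : d ∉ T := fun e => (hTM e).elim hut huB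
  have hxKT : x ∉ K ∪ T := fun e => e.elim hxK' fun e => hATB hxA (hTM e)
  have hsKT : s ∉ K ∪ T := fun e => e.elim (fun e => hsA (hKA e)) fun e => hsTB (hTM e)
  have hxT : ∀ z ∈ T, ¬ G.Adj x z := by
    intro z hz hxz
    rcases hTM hz with rfl | hz
    · exact hxt hxz
    · exact hAB hxA hz hxz
  by_cases hdT' : ∃ z ∈ T, G.Adj d z
  · obtain ⟨t₁, ht₁, hdt₁⟩ := hdT'
    obtain ⟨z, hz | hz, hxz, hdz⟩ := exists_common_neighbor_of_adj hG hxd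
      (X₁ := K ∪ T) ⟨hKT, hxKT, fun e => e.elim (fun e => huA (hKA e)) hdT,
        ⟨k', Or.inl hk', hxk'⟩, ⟨t₁, Or.inr ht₁, hdt₁⟩⟩ (link_singleton hxs hsd.symm) (by
        rintro v hv w rfl
        refine ⟨fun e => hsKT (e ▸ hv), fun e => ?_⟩
        rcases hv with hv | hv
        · exact hsK v hv e.symm
        · exact hTs v hv e.symm)
    · exact huZ z (hKZ hz) hdz
    · exact hxT z hz hxz
  push Not at hdT'
  by_cases hdq : G.Adj d q
  · obtain ⟨z, hz | hz, hsz, hqz⟩ := exists_common_neighbor_of_adj hG hsq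
      (X₁ := Z ∪ T) ⟨hP.conn.union hT hP.mem_right htT hP.adj_right.symm,
        fun e => e.elim (fun e => hsA (hP.sub e)) fun e => hsTB (hTM e),
        fun e => e.elim (fun e => hAnB (hP.sub e) hqB) fun e => hTs q e hsq,
        ⟨_, Or.inl hP.mem_left, hP.adj_left⟩, ⟨t₀, Or.inr ht₀, ht₀q.symm⟩⟩
      (link_singleton hsd hdq.symm) (by
        rintro v (hv | hv) w rfl
        · exact hZD v hv w hd
        · exact ⟨fun e => hdT (e ▸ hv), fun e => hdT' v hv e.symm⟩)
    · exact hAB (hP.sub hz) hqB hqz.symm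
    · exact hTs z hz hsz
  · obtain ⟨z, rfl | hz | hz, hsz, hxz⟩ := exists_common_neighbor_of_adj hG hxs.symm
      (X₁ := insert q (K ∪ T)) ⟨hKT.insert (Or.inr ht₀) ht₀q.symm,
        fun e => e.elim (neB hsB hqB) hsKT, fun e => e.elim (fun e => hAnB hxA (e ▸ hqB)) hxKT,
        ⟨q, Or.inl rfl, hsq⟩, ⟨k', Or.inr (Or.inl hk'), hxk'⟩⟩
      (link_singleton hsd hxd) (by
        rintro v (rfl | hv | hv) w rfl
        · exact ⟨(neB huB hqB).symm, fun e => hdq e.symm⟩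
        · exact hZD v (hKZ hv) w hd
        · exact ⟨fun e => hdT (e ▸ hv), fun e => hdT' v hv e.symm⟩)
    · exact hAB hxA hqB hxz
    · exact hsK z hz hsz
    · exact hTs z hz hsz

lemma Pocket.adj_or_adj (hG : ¬ ContainsInducedSubdivision house G) (h : TwoSides G A B S)
    (hP : Pocket G A S s t p p' Z) {u : V} (hu : u ∈ S) : G.Adj u p ∨ G.Adj u p' := by
  by_cases hus : u = s
  · exact Or.inl (hus ▸ hP.adj_left)
  by_cases hut : u = t
  · exact Or.inr (hut ▸ hP.adj_right)
  by_cases huZ : ∃ z ∈ Z, G.Adj u z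
  · exact (hP.cover u hu hus hut).imp (hP.adj_of_adj_left hG h hu huZ)
      (hP.symm.adj_of_adj_left hG h hu huZ)
  push Not at huZ
  obtain ⟨a, ha, hua⟩ := h.nbrA u hu
  have huA := h.notA u hu
  obtain ⟨D, hDA, hDF, huD, hD, -, d₀, hd₀, x, hxM, hxF, hd₀x⟩ :=
    (h.connA.insert ha hua).exists_component (v := u) (f := p)
      (F := {w | w ∈ Z ∨ ∃ z ∈ Z, G.Adj z w}) (Or.inl rfl)
      (by
        rintro (e | ⟨z, hz, e⟩)
        · exact huA (hP.sub e)
        · exact huZ z hz e.symm)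
      (Or.inr (hP.sub hP.mem_left)) (Or.inl hP.mem_left)
  have hZD : Anti G Z D := fun z hz v hv =>
    ⟨fun e => hDF v hv (Or.inl (e ▸ hz)), fun e => hDF v hv (Or.inr ⟨z, hz, e⟩)⟩
  have hxZ : x ∉ Z := fun e => (hZD x e d₀ hd₀).2 hd₀x.symm
  obtain ⟨z, hz, hzx⟩ := hxF.resolve_left hxZ
  have hxA : x ∈ A := hxM.resolve_left (by rintro rfl; exact huZ z hz hzx.symm)
  rcases hP.boundary x hxA hxZ z hz hzx with e | e
  · exact (hP.false_of_attachment hG h hu hut huZ hD hDA huD hZD hxA hxZ ⟨z, hz, hzx.symm⟩ hd₀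
      hd₀x.symm e.symm hus).elim
  · exact (hP.symm.false_of_attachment hG h hu hus huZ hD hDA huD hZD hxA hxZ ⟨z, hz, hzx.symm⟩ hd₀
      hd₀x.symm e.symm hut).elim

lemma Far.exists_pocket (hG : ¬ ContainsInducedSubdivision house G) (h : TwoSides G A B S)
    (hf : Far G A S s t Z) : ∃ p p' Z', Pocket G A S s t p p' Z' := by
  have hst := hf.not_adj hG h
  have hsA := h.notA s hf.left
  have htA := h.notA t hf.right
  obtain ⟨p, n, hp⟩ := hf.link.exists_long_path hf.ne hf.no_common
  replace hp : IsLinkPath G s t A p (n + 3) :=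
    ⟨hp.zero, hp.last, fun i h1 h2 => hf.sub (hp.mem i h1 h2), hp.inj, hp.adj, hp.ind⟩
  have hpc := hp.adj_consecutive hst
  set Z₀ : Set V := {v | ∃ i, 1 ≤ i ∧ i ≤ n + 2 ∧ p i = v} with hZ₀
  have hZ₀c : IsConn G Z₀ := (hp.link_interior hsA htA).conn
  have hZ₀A : Z₀ ⊆ A := by
    rintro v ⟨i, hi, hi', rfl⟩
    exact hp.mem i hi (by omega)
  have h1 : p 1 ∈ Z₀ := ⟨1, le_rfl, by omega, rfl⟩
  have h2 : p (n + 2) ∈ Z₀ := ⟨n + 2, by omega, le_rfl, rfl⟩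
  obtain ⟨Z', hZ'M, hpZ', hZ', hmax⟩ := exists_component_of_mem (G := G) (v := p 1)
    (M := {w | w ∈ A ∧ (w ∈ Z₀ ∨ (¬ G.Adj s w ∧ ¬ G.Adj t w))}) ⟨hZ₀A h1, Or.inl h1⟩
  have hsub : Z₀ ⊆ Z' := hZ₀c.subset_of_closed h1 hpZ'
    fun w hw t ht e => hmax w ⟨hZ₀A hw, Or.inl hw⟩ t ht e
  refine ⟨p 1, p (n + 2), Z', hf.left, hf.right, hst, fun z hz => (hZ'M hz).1, hZ', hpZ', hsub h2,
    fun e => ?_, ?_, ?_, ?_, ?_, ?_, fun u hu => hf.adj_or_adj hG h hu⟩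
  · have := hp.inj 1 (by omega) (n + 2) (by omega) e
    omega
  · have := hp.adj 0 (by omega)
    rwa [hp.zero] at this
  · have := hp.adj (n + 2) (by omega)
    rw [hp.last] at this
    exact this.symm
  · intro z hz e
    obtain ⟨i, hi, hi', rfl⟩ := (hZ'M hz).2.resolve_right fun e' => e'.1 e
    rw [← hp.zero] at e
    have := hpc 0 (by omega) i (by omega) e
    congr 1
    omega
  · intro z hz e
    obtain ⟨i, hi, hi', rfl⟩ := (hZ'M hz).2.resolve_right fun e' => e'.2 e
    rw [← hp.last] at e
    have := hpc (n + 3) (by omega) i (by omega) e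
    congr 1
    omega
  · intro a ha haZ z hz e
    by_contra! hcon
    exact haZ (hmax a ⟨ha, Or.inr hcon⟩ z hz e)

/-- In a graph without induced subdivisions of the house, each of the two sides of a separator
contains two vertices dominating the separator. -/
lemma TwoSides.exists_dominating_pair [Finite V] (hG : ¬ ContainsInducedSubdivision house G)
    (h : TwoSides G A B S) (hA : A.Nonempty) :
    ∃ a ∈ A, ∃ a' ∈ A, ∀ s ∈ S, G.Adj s a ∨ G.Adj s a' := by
  by_cases hfar : ∃ s t Z, Far G A S s t Z
  · obtain ⟨s, t, Z, hf⟩ := hfar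
    obtain ⟨p, p', Z', hP⟩ := hf.exists_pocket hG h
    exact ⟨p, hP.sub hP.mem_left, p', hP.sub hP.mem_right, fun u hu => hP.adj_or_adj hG h hu⟩
  · push Not at hfar
    obtain ⟨a, ha, h'⟩ := h.dominated_of_not_far hA hfar
    exact ⟨a, ha, a, ha, fun s hs => Or.inl (h' s hs)⟩

end pocket

lemma nonempty_embedding {V W : Type} {H : SimpleGraph W} {G : SimpleGraph V} {f : W → V}
    (hf : Function.Injective f) (hadj : ∀ i j, G.Adj (f i) (f j) ↔ H.Adj i j) :
    Nonempty (H ↪g G) :=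
  ⟨⟨⟨f, hf⟩, hadj _ _⟩⟩

section separators

variable {V : Type} {G : SimpleGraph V}

lemma separates_iff {S : Set V} {a b : V} (ha : a ∉ S) :
    Separates G S a b ↔ ¬ ReachIn G Sᶜ a b := by
  constructor
  · intro h hr
    have key : ∀ w, ReachIn G Sᶜ a w → ∃ p : G.Walk a w, ∀ x ∈ p.support, x ∉ S := by
      intro w hw
      induction hw with
      | refl => exact ⟨Walk.nil, by simpa using ha⟩
      | tail _ h2 ih =>
        obtain ⟨p, hp⟩ := ih
        refine ⟨p.concat h2.1, fun x hx => ?_⟩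
        rw [Walk.support_concat, List.mem_append, List.mem_singleton] at hx
        rcases hx with hx | rfl
        · exact hp x hx
        · exact h2.2.2
    obtain ⟨p, hp⟩ := key b hr
    obtain ⟨x, hx, hxS⟩ := h p
    exact hp x hx hxS
  · intro h p
    by_contra! hcon
    apply h
    clear h
    induction p with
    | nil => exact Relation.ReflTransGen.refl
    | cons hadj q ih =>
      refine (ReachIn.of_adj hadj ha ?_).trans (ih ?_ fun x hx => hcon x ?_)
      · exact hcon _ (by simp)
      · exact hcon _ (by simp)
      · simp [hx]

/-- A minimal separator has two full sides, each closed outside of the separator. -/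
lemma IsMinimalSeparator.exists_twoSides {S : Set V} (h : IsMinimalSeparator G S) :
    ∃ A B, TwoSides G A B S ∧ A.Nonempty ∧ B.Nonempty ∧
      (∀ v, v ∉ S → (∃ a ∈ A, G.Adj v a) → v ∈ A) ∧
      (∀ v, v ∉ S → (∃ b ∈ B, G.Adj v b) → v ∈ B) := by
  obtain ⟨a, b, ha, hb, -, -, hsep, hmin⟩ := h
  rw [separates_iff ha] at hsep
  have closed : ∀ c, c ∉ S → ∀ v, v ∉ S → (∃ w ∈ {w | ReachIn G Sᶜ c w}, G.Adj v w) →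
      v ∈ {w | ReachIn G Sᶜ c w} := by
    rintro c hc v hv ⟨w, hw, hvw⟩
    exact Relation.ReflTransGen.tail hw ⟨hvw.symm, hw.mem hc, hv⟩
  have conn : ∀ c, c ∉ S → IsConn G {w | ReachIn G Sᶜ c w} := by
    intro c hc
    have key : ∀ w, ReachIn G Sᶜ c w → ReachIn G {w | ReachIn G Sᶜ c w} c w := by
      intro w hw
      induction hw with
      | refl => exact Relation.ReflTransGen.refl
      | tail h1 h2 ih => exact ih.trans (ReachIn.of_adj h2.1 h1 (h1.tail h2))
    exact fun u hu w hw => (key u hu).symm.trans (key w hw)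
  have nbr : ∀ c d, c ∉ S → ¬ ReachIn G Sᶜ c d → (∀ S' ⊂ S, ReachIn G S'ᶜ c d) →
      ∀ s ∈ S, ∃ w ∈ {w | ReachIn G Sᶜ c w}, G.Adj s w := by
    intro c d hc hcd hmin s hs
    by_contra! hcon
    refine hcd ?_
    have hr := hmin (S \ {s}) ⟨Set.sdiff_subset, fun e => (e hs).2 rfl⟩
    have key : ∀ w, ReachIn G (S \ {s})ᶜ c w → ReachIn G Sᶜ c w := by
      intro w hw
      induction hw with
      | refl => exact Relation.ReflTransGen.refl
      | @tail x y _ h2 ih =>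
        refine ih.tail ⟨h2.1, ih.mem hc, fun e => ?_⟩
        by_cases hs' : y = s
        · exact hcon _ ih (hs' ▸ h2.1.symm)
        · exact h2.2.2 ⟨e, hs'⟩
    exact key d hr
  have hmin' : ∀ S' ⊂ S, ReachIn G S'ᶜ a b := by
    intro S' hS'
    have := hmin S' hS'
    rw [separates_iff fun e => ha (hS'.1 e)] at this
    exact not_not.1 this
  refine ⟨{w | ReachIn G Sᶜ a w}, {w | ReachIn G Sᶜ b w}, ⟨conn a ha, conn b hb, ?_,
    fun s hs e => (ReachIn.mem e ha) hs, fun s hs e => (ReachIn.mem e hb) hs, nbr a b ha hsep hmin',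
    nbr b a hb (fun e => hsep e.symm) fun S' hS' => (hmin' S' hS').symm⟩,
    ⟨a, Relation.ReflTransGen.refl⟩, ⟨b, Relation.ReflTransGen.refl⟩, closed a ha, closed b hb⟩
  intro u hu v hv
  refine ⟨?_, fun e => hsep ?_⟩
  · rintro rfl
    exact hsep (hu.trans hv.symm)
  · exact (hu.trans (ReachIn.of_adj e (hu.mem ha) (hv.mem hb))).trans hv.symm

/-- The common part of two unions of two neighbourhoods. -/
def pairNeighborhood (G : SimpleGraph V) (q : (V × V) × V × V) : Set V :=
  {v | (G.Adj v q.1.1 ∨ G.Adj v q.1.2) ∧ (G.Adj v q.2.1 ∨ G.Adj v q.2.2)}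

lemma IsMinimalSeparator.eq_pairNeighborhood_of_house [Finite V]
    (hG : ¬ ContainsInducedSubdivision house G) {S : Set V} (h : IsMinimalSeparator G S) :
    ∃ q, pairNeighborhood G q = S := by
  obtain ⟨A, B, hAB, hA, hB, hA', hB'⟩ := h.exists_twoSides
  obtain ⟨a, ha, a', ha', hSA⟩ := hAB.exists_dominating_pair hG hA
  obtain ⟨b, hb, b', hb', hSB⟩ := hAB.symm.exists_dominating_pair hG hB
  refine ⟨((a, a'), b, b'), Set.Subset.antisymm ?_ fun s hs => ⟨hSA s hs, hSB s hs⟩⟩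
  rintro v ⟨h1, h2⟩
  by_contra hv
  exact hAB.anti.not_mem
    (hA' v hv (h1.elim (fun e => ⟨a, ha, e⟩) fun e => ⟨a', ha', e⟩))
    (hB' v hv (h2.elim (fun e => ⟨b, hb, e⟩) fun e => ⟨b', hb', e⟩))

lemma TwoSides.subsingleton_or_subsingleton (hG : ¬ ContainsInducedSubdivision twoP2 G)
    {A B S : Set V} (h : TwoSides G A B S) : A.Subsingleton ∨ B.Subsingleton := by
  have key : ∀ {X : Set V}, IsConn G X → ¬ X.Subsingleton → ∃ x ∈ X, ∃ y ∈ X, G.Adj x y := by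
    intro X hX hne
    rw [Set.not_subsingleton_iff] at hne
    obtain ⟨x, hx, y, hy, hxy⟩ := hne
    rcases (hX x hx y hy).cases_head with e | ⟨z, hz, -⟩
    · exact absurd e hxy
    · exact ⟨x, hx, z, hz.2.2, hz.1⟩
  by_contra! hcon
  obtain ⟨a, ha, a', ha', haa⟩ := key h.connA (Set.not_subsingleton_iff.2 hcon.1)
  obtain ⟨b, hb, b', hb', hbb⟩ := key h.connB (Set.not_subsingleton_iff.2 hcon.2)
  have h1 := h.anti a ha b hb
  have h2 := h.anti a ha b' hb'
  have h3 := h.anti a' ha' b hb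
  have h4 := h.anti a' ha' b' hb'
  refine hG ⟨_, twoP2, Subdivision.refl _, nonempty_embedding (f := ![a, a', b, b']) ?_ ?_⟩
  · have n1 := haa.ne
    have n2 := hbb.ne
    intro i j hij
    fin_cases i <;> fin_cases j <;> simp_all
  · intro i j
    have g1 : ¬ G.Adj b a := fun e => h1.2 (G.adj_symm e)
    have g2 : ¬ G.Adj b' a := fun e => h2.2 (G.adj_symm e)
    have g3 : ¬ G.Adj b a' := fun e => h3.2 (G.adj_symm e)
    have g4 : ¬ G.Adj b' a' := fun e => h4.2 (G.adj_symm e)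
    fin_cases i <;> fin_cases j <;>
      simp [twoP2, haa, haa.symm, hbb, hbb.symm, h1.2, h2.2, h3.2, h4.2, g1, g2, g3, g4]

lemma IsMinimalSeparator.eq_pairNeighborhood_of_twoP2
    (hG : ¬ ContainsInducedSubdivision twoP2 G) {S : Set V} (h : IsMinimalSeparator G S) :
    ∃ q, pairNeighborhood G q = S := by
  obtain ⟨A, B, hAB, hA, hB, hA', hB'⟩ := h.exists_twoSides
  have key : ∀ {X : Set V}, X.Subsingleton → X.Nonempty → (∀ s ∈ S, ∃ x ∈ X, G.Adj s x) →
      (∀ v, v ∉ S → (∃ x ∈ X, G.Adj v x) → v ∈ X) → ∃ q, pairNeighborhood G q = S := by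
    rintro X hX ⟨x, hx⟩ hS hX'
    have hS' : ∀ s ∈ S, G.Adj s x := by
      intro s hs
      obtain ⟨y, hy, hsy⟩ := hS s hs
      rwa [hX hx hy]
    refine ⟨((x, x), x, x), Set.Subset.antisymm ?_ fun s hs => ⟨Or.inl (hS' s hs), Or.inl (hS' s
      hs)⟩⟩
    rintro v ⟨h1, -⟩
    rw [or_self] at h1
    by_contra hv
    exact h1.ne (hX (hX' v hv ⟨x, hx, h1⟩) hx)
  rcases hAB.subsingleton_or_subsingleton hG with hs | hs
  · exact key hs hA hAB.nbrA hA'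
  · exact key hs hB hAB.nbrB hB'

lemma numMinSep_le {n : ℕ} {G : SimpleGraph (Fin n)}
    (h : ∀ S, IsMinimalSeparator G S → ∃ q, pairNeighborhood G q = S) : numMinSep G ≤ n ^ 4 := by
  calc numMinSep G ≤ (pairNeighborhood G '' Set.univ).ncard := by
        refine Set.ncard_le_ncard (fun S hS => ?_) (Set.toFinite _)
        obtain ⟨q, hq⟩ := h S hS
        exact ⟨q, trivial, hq⟩
    _ ≤ (Set.univ : Set ((Fin n × Fin n) × Fin n × Fin n)).ncard := Set.ncard_image_le
    _ = n ^ 4 := by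
        rw [Set.ncard_univ]
        simp only [Nat.card_prod, Nat.card_fin]
        ring

end separators

section containment

lemma Subdivision.trans {A B C : Type} {G : SimpleGraph A} {H : SimpleGraph B} {K : SimpleGraph C}
    (h : Subdivision G H) (h' : Subdivision H K) : Subdivision G K := by
  induction h' with
  | refl => exact h
  | step _ huv ih => exact ih.step huv

lemma Subdivision.restrict {B C : Type} {K : SimpleGraph B} {K' : SimpleGraph C}
    (h : Subdivision K K') {A : Type} {H : SimpleGraph A} (f : H ↪g K) :
    ∃ (A' : Type) (H' : SimpleGraph A'), Subdivision H H' ∧ Nonempty (H' ↪g K') := by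
  induction h with
  | refl => exact ⟨A, H, Subdivision.refl H, ⟨f⟩⟩
  | @step C L u v _ huv ih =>
    obtain ⟨A', H', hH', ⟨e⟩⟩ := ih
    by_cases huv' : ∃ a b, e a = u ∧ e b = v
    · obtain ⟨a, b, rfl, rfl⟩ := huv'
      refine ⟨_, _, hH'.step (e.map_adj_iff.1 huv),
        nonempty_embedding (f := Option.map e) (Option.map_injective e.injective) ?_⟩
      rintro (_ | x) (_ | y)
      · simp
      · simp [subdivideEdge_adj_none]
      · simp [subdivideEdge_adj_none']
      · simp [subdivideEdge_adj_some]
    · refine ⟨_, _, hH', nonempty_embedding (f := fun x => some (e x))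
        (fun x y hxy => e.injective (Option.some_injective _ hxy)) fun x y => ?_⟩
      rw [subdivideEdge_adj_some, e.map_adj_iff]
      exact ⟨fun h => h.1, fun h => ⟨h, fun e' => huv' ⟨x, y, e'⟩, fun e' => huv' ⟨y, x, e'.2,
        e'.1⟩⟩⟩

lemma ContainsInducedSubdivision.trans {A B V : Type} {H : SimpleGraph A} {K : SimpleGraph B}
    {G : SimpleGraph V} (h : ContainsInducedSubdivision H K)
    (h' : ContainsInducedSubdivision K G) : ContainsInducedSubdivision H G := by
  obtain ⟨_, H₁, hH₁, ⟨f⟩⟩ := h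
  obtain ⟨_, K₁, hK₁, ⟨g⟩⟩ := h'
  obtain ⟨_, H₂, hH₂, ⟨f'⟩⟩ := hK₁.restrict f
  exact ⟨_, H₂, hH₁.trans hH₂, ⟨g.comp f'⟩⟩

lemma ContainsInducedSubdivision.of_embedding {A V : Type} {H : SimpleGraph A}
    {G : SimpleGraph V} (f : H ↪g G) : ContainsInducedSubdivision H G :=
  ⟨A, H, Subdivision.refl H, ⟨f⟩⟩

lemma diamond_contained_in_house : ContainsInducedSubdivision diamond house := by
  refine ⟨_, _, (Subdivision.refl diamond).step (u := 0) (v := 1) (by simp [diamond]),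
    nonempty_embedding (f := fun o => o.elim 1 ![2, 0, 3, 4]) ?_ ?_⟩
  · rintro (_ | x) (_ | y) h
    · rfl
    · fin_cases y <;> simp at h
    · fin_cases x <;> simp at h
    · fin_cases x <;> fin_cases y <;> simp at h <;> rfl
  · rintro (_ | x) (_ | y)
    · simp
    · fin_cases y <;> simp [subdivideEdge_adj_none, house]
    · fin_cases x <;> simp [subdivideEdge_adj_none', house]
    · fin_cases x <;> fin_cases y <;> simp [subdivideEdge_adj_some, house, diamond]

theorem tame_of_contained {W : Type} {H : SimpleGraph W}
    (h : ContainsInducedSubdivision H twoP2 ∨ ContainsInducedSubdivision H house) :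
    Tame (fun n (G : SimpleGraph (Fin n)) => ¬ ContainsInducedSubdivision H G) := by
  refine ⟨Polynomial.X ^ 4, fun n G hG => ?_⟩
  rw [Polynomial.eval_pow, Polynomial.eval_X]
  refine numMinSep_le fun S hS => ?_
  rcases h with h | h
  · exact hS.eq_pairNeighborhood_of_twoP2 fun h' => hG (h.trans h')
  · exact hS.eq_pairNeighborhood_of_house fun h' => hG (h.trans h')

theorem contained_of_embedding {W : Type} {H : SimpleGraph W}
    (h : Nonempty (H ↪g twoP2) ∨ Nonempty (H ↪g diamond) ∨ Nonempty (H ↪g house)) :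
    ContainsInducedSubdivision H twoP2 ∨ ContainsInducedSubdivision H house := by
  rcases h with ⟨⟨f⟩⟩ | ⟨⟨f⟩⟩ | ⟨⟨f⟩⟩
  · exact Or.inl (.of_embedding f)
  · exact Or.inr ((ContainsInducedSubdivision.of_embedding f).trans diamond_contained_in_house)
  · exact Or.inr (.of_embedding f)

end containment

section growth

lemma tendsto_eval_div_pow (p : Polynomial ℕ) {c : ℝ} (hc : 1 < c) :
    Filter.Tendsto (fun n : ℕ => ((p.eval n : ℕ) : ℝ) / c ^ n) Filter.atTop (nhds 0) := by
  induction p using Polynomial.induction_on' with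
  | add p q hp hq =>
    have := hp.add hq
    simpa only [Polynomial.eval_add, Nat.cast_add, add_div, add_zero] using this
  | monomial k a =>
    have := (tendsto_pow_const_div_const_pow_of_one_lt k hc).const_mul (a : ℝ)
    simpa only [Polynomial.eval_monomial, Nat.cast_mul, Nat.cast_pow, mul_div_assoc, mul_zero]
      using this

lemma Tame.not_feral {𝒢 : ∀ n : ℕ, SimpleGraph (Fin n) → Prop} (h : Tame 𝒢) : ¬ Feral 𝒢 := by
  rintro ⟨c, hc, hf⟩
  obtain ⟨p, hp⟩ := h
  obtain ⟨N, hN⟩ := Filter.eventually_atTop.1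
    ((tendsto_eval_div_pow p hc).eventually (gt_mem_nhds one_pos))
  obtain ⟨n, hn, G, hG, hle⟩ := hf N
  have h1 := hN n hn
  rw [div_lt_one (by positivity)] at h1
  have h2 : (numMinSep G : ℝ) ≤ (p.eval n : ℕ) := by exact_mod_cast hp n G hG
  linarith

end growth

section manySeparators

variable {V : Type} {G : SimpleGraph V}

lemma Separates.map_iso {V' : Type} {G' : SimpleGraph V'} (φ : G ≃g G') {S : Set V} {a b : V}
    (h : Separates G S a b) : Separates G' (φ '' S) (φ a) (φ b) := by
  intro p
  obtain ⟨x, hx, hxS⟩ := h ((p.map φ.symm.toHom).copy (φ.symm_apply_apply a)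
    (φ.symm_apply_apply b))
  rw [Walk.support_copy, Walk.support_map, List.mem_map] at hx
  obtain ⟨y, hy, rfl⟩ := hx
  exact ⟨y, hy, _, hxS, φ.apply_symm_apply y⟩

lemma IsMinimalSeparator.map_iso {V' : Type} {G' : SimpleGraph V'} (φ : G ≃g G') {S : Set V}
    (h : IsMinimalSeparator G S) : IsMinimalSeparator G' (φ '' S) := by
  obtain ⟨a, b, ha, hb, hab, hadj, hsep, hmin⟩ := h
  refine ⟨φ a, φ b, ?_, ?_, fun e => hab (φ.injective e), fun e => hadj (φ.map_adj_iff.1 e),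
    hsep.map_iso φ, fun S' hS' hsep' => ?_⟩
  · rintro ⟨x, hx, e⟩
    exact ha (φ.injective e ▸ hx)
  · rintro ⟨x, hx, e⟩
    exact hb (φ.injective e ▸ hx)
  · have := hsep'.map_iso φ.symm
    rw [φ.symm_apply_apply, φ.symm_apply_apply] at this
    refine hmin _ ⟨?_, fun hsub => hS'.2 ?_⟩ this
    · rintro _ ⟨y, hy, rfl⟩
      obtain ⟨x, hx, rfl⟩ := hS'.1 hy
      rwa [φ.symm_apply_apply]
    · rintro _ ⟨x, hx, rfl⟩
      obtain ⟨y, hy, rfl⟩ := hsub hx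
      rwa [φ.apply_symm_apply]

lemma isMinimalSeparator_of_side {S A : Set V} {a b : V} (haA : a ∈ A) (hbA : b ∉ A)
    (ha : a ∉ S) (hb : b ∉ S) (hA : ∀ v ∈ A, ∀ w, G.Adj v w → w ∈ A ∨ w ∈ S)
    (hS : ∀ s ∈ S, ReachIn G (insert s Sᶜ) a b) : IsMinimalSeparator G S := by
  refine ⟨a, b, ha, hb, fun e => hbA (e ▸ haA), fun e => (hA a haA b e).elim hbA hb, ?_, ?_⟩
  · rw [separates_iff ha]
    intro hr
    have key : ∀ w, ReachIn G Sᶜ a w → w ∈ A := by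
      intro w hw
      induction hw with
      | refl => exact haA
      | tail _ h2 ih => exact (hA _ ih _ h2.1).resolve_right h2.2.2
    exact hbA (key b hr)
  · intro S' hS'
    rw [separates_iff fun e => ha (hS'.1 e), not_not]
    obtain ⟨s, hs, hsS'⟩ := Set.exists_of_ssubset hS'
    refine (hS s hs).mono ?_
    rintro v (rfl | hv)
    · exact hsS'
    · exact fun e => hv (hS'.1 e)

lemma exists_copy_numMinSep_ge [Fintype V] (G : SimpleGraph V) {ι : Type} [Fintype ι]
    {F : ι → Set V} (hF : Function.Injective F) (hmin : ∀ i, IsMinimalSeparator G (F i)) :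
    ∃ G' : SimpleGraph (Fin (Fintype.card V)), Nonempty (G' ↪g G) ∧
      Fintype.card ι ≤ numMinSep G' := by
  let e := Fintype.equivFin V
  let φ : G ≃g G.comap e.symm := ⟨e, by simp⟩
  refine ⟨G.comap e.symm, ⟨φ.symm.toEmbedding⟩, ?_⟩
  have hinj : Function.Injective fun i => φ '' F i := fun i j hij => hF
    (φ.injective.image_injective hij)
  calc Fintype.card ι = (Set.univ : Set ι).ncard := by
        rw [Set.ncard_univ, Nat.card_eq_fintype_card]
    _ = ((fun i => φ '' F i) '' Set.univ).ncard := (Set.ncard_image_of_injective _ hinj).symm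
    _ ≤ numMinSep (G.comap e.symm) := by
        refine Set.ncard_le_ncard ?_ (Set.toFinite _)
        rintro _ ⟨i, -, rfl⟩
        exact (hmin i).map_iso φ

lemma exists_contains_of_not_feral {W : Type} {H : SimpleGraph W}
    (hH : ¬ Feral (fun n (G : SimpleGraph (Fin n)) => ¬ ContainsInducedSubdivision H G))
    {V : ℕ → Type} [∀ k, Fintype (V k)] (G : ∀ k, SimpleGraph (V k))
    (hcard : ∀ k, k ≤ Fintype.card (V k) ∧ Fintype.card (V k) ≤ 2 * k + 4)
    (F : ∀ k, (Fin k → Fin 2) → Set (V k)) (hF : ∀ k, Function.Injective (F k))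
    (hmin : ∀ k x, IsMinimalSeparator (G k) (F k x)) :
    ∃ k, ContainsInducedSubdivision H (G k) := by
  by_contra! hcon
  refine hH ⟨11 / 10, by norm_num, fun N => ?_⟩
  obtain ⟨G', ⟨f⟩, hle⟩ := exists_copy_numMinSep_ge (G (N + 2)) (hF (N + 2)) (hmin (N + 2))
  refine ⟨_, le_trans (by omega) (hcard (N + 2)).1, G',
    fun h => hcon (N + 2) (h.trans (.of_embedding f)), ?_⟩
  rw [Fintype.card_fun, Fintype.card_fin, Fintype.card_fin] at hle
  calc (11 / 10 : ℝ) ^ Fintype.card (V (N + 2)) ≤ (11 / 10) ^ (2 * (N + 2) + 4) :=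
        pow_le_pow_right₀ (by norm_num) (hcard (N + 2)).2
    _ = ((11 / 10) ^ 2) ^ N * (11 / 10) ^ 8 := by
        rw [← pow_mul, ← pow_add]
        congr 1
    _ ≤ 2 ^ N * 4 := by
        gcongr
        · norm_num
        · norm_num
    _ = ((2 ^ (N + 2) : ℕ) : ℝ) := by push_cast; ring
    _ ≤ numMinSep G' := by exact_mod_cast hle

lemma ReachIn.of_eq_or_adj {X : Set V} {u v : V} (h : u = v ∨ G.Adj u v) (hu : u ∈ X) (hv : v ∈ X) :
    ReachIn G X u v := by
  rcases h with rfl | h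
  · exact Relation.ReflTransGen.refl
  · exact ReachIn.of_adj h hu hv

lemma isMinimalSeparator_thetaGraph {k : ℕ} (x : Fin k → Fin 2) :
    IsMinimalSeparator (thetaGraph k) (Set.range fun i => Sum.inr (i, x i)) := by
  refine isMinimalSeparator_of_side (a := Sum.inl 0) (b := Sum.inl 1)
    (A := {v | v = Sum.inl 0 ∨ ∃ i, v = Sum.inr (i, 0) ∧ x i = 1}) (Or.inl rfl) (by simp)
    (by simp) (by simp) ?_ ?_
  · rintro v (rfl | ⟨i, rfl, hi⟩) w hw
    · rcases w with w | ⟨j, l⟩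
      · simp [thetaGraph] at hw
      · have hl : l = 0 := by simpa [thetaGraph] using hw
        subst hl
        rcases Fin.exists_fin_two.1 ⟨x j, rfl⟩ with h | h
        · exact Or.inr ⟨j, by simp [← h]⟩
        · exact Or.inl (Or.inr ⟨j, rfl, h⟩)
    · rcases w with w | ⟨j, l⟩
      · have : w = 0 := by simpa [thetaGraph] using hw
        exact Or.inl (Or.inl (by rw [this]))
      · have : i = j ∧ l = 1 := by
          simp [thetaGraph] at hw
          tauto
        obtain ⟨rfl, rfl⟩ := this
        exact Or.inr ⟨i, by simp [hi]⟩
  · rintro _ ⟨i, rfl⟩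
    have hmem : ∀ j : Fin 2, (Sum.inr (i, j) : Fin 2 ⊕ Fin k × Fin 2) ∈
        insert (Sum.inr (i, x i)) (Set.range fun i => (Sum.inr (i, x i) : Fin 2 ⊕ Fin k × Fin 2))ᶜ
            := by
      intro j
      by_cases h : j = x i
      · exact Or.inl (by rw [h])
      · refine Or.inr ?_
        rintro ⟨i', e⟩
        have e' := Sum.inr.inj e
        rw [Prod.mk.injEq] at e'
        obtain ⟨rfl, rfl⟩ := e'
        exact h rfl
    exact (ReachIn.of_adj (v := Sum.inr (i, 0)) (by simp [thetaGraph]) (Or.inr (by simp))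
      (hmem 0)).trans
        ((ReachIn.of_adj (v := Sum.inr (i, 1)) (by simp [thetaGraph]) (hmem 0) (hmem 1)).trans
          (ReachIn.of_adj (by simp [thetaGraph]) (hmem 1) (Or.inr (by simp))))

lemma isMinimalSeparator_prismGraph {k : ℕ} (x : Fin k → Fin 2) {i₀ i₁ : Fin k} (h₀ : x i₀ = 0)
    (h₁ : x i₁ = 1) : IsMinimalSeparator (prismGraph k) (Set.range fun i => (i, x i)) := by
  refine isMinimalSeparator_of_side (a := (i₁, 0)) (b := (i₀, 1))
    (A := {v | v.2 = 0 ∧ x v.1 = 1}) ⟨rfl, h₁⟩ (by simp) (by simp [h₁]) (by simp [h₀]) ?_ ?_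
  · rintro ⟨i, _⟩ ⟨rfl, hi⟩ ⟨j, l⟩ hw
    simp only [prismGraph, fromRel_adj] at hw
    by_cases hl : l = 0
    · subst hl
      rcases Fin.exists_fin_two.1 ⟨x j, rfl⟩ with h | h
      · exact Or.inr ⟨j, by simp [← h]⟩
      · exact Or.inl ⟨rfl, h⟩
    · have hij : i = j := by
        simp at hw
        tauto
      subst hij
      exact Or.inr ⟨i, by simp at hi ⊢; omega⟩
  · rintro _ ⟨i, rfl⟩
    have hmem : ∀ j : Fin 2, (i, j) ∈ insert (i, x i) (Set.range fun i => (i, x i))ᶜ := by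
      intro j
      by_cases h : j = x i
      · exact Or.inl (by rw [h])
      · refine Or.inr ?_
        rintro ⟨i', e⟩
        simp at e
        obtain ⟨rfl, rfl⟩ := e
        exact h rfl
    have hadj : ∀ i j l, ((i, l) : Fin k × Fin 2) = (j, l) ∨ (prismGraph k).Adj (i, l) (j, l) := by
      intro i j l
      by_cases h : i = j
      · exact Or.inl (by rw [h])
      · exact Or.inr (by simp [prismGraph, h])
    exact (ReachIn.of_eq_or_adj (hadj _ _ _) (Or.inr (by simp [h₁])) (hmem 0)).trans
      ((ReachIn.of_adj (by simp [prismGraph]) (hmem 0) (hmem 1)).trans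
        (ReachIn.of_eq_or_adj (hadj _ _ _) (hmem 1) (Or.inr (by simp [h₀]))))

lemma exists_thetaGraph_of_not_feral {W : Type} {H : SimpleGraph W}
    (hH : ¬ Feral (fun n (G : SimpleGraph (Fin n)) => ¬ ContainsInducedSubdivision H G)) :
    ∃ k, ContainsInducedSubdivision H (thetaGraph k) := by
  refine exists_contains_of_not_feral hH thetaGraph (fun k => ?_)
    (fun k x => Set.range fun i => Sum.inr (i, x i)) (fun k x y hxy => ?_)
    fun k x => isMinimalSeparator_thetaGraph x
  · simp only [Fintype.card_sum, Fintype.card_prod, Fintype.card_fin]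
    omega
  · ext1 i
    obtain ⟨j, hj⟩ := hxy.le ⟨i, rfl⟩
    simp at hj
    obtain ⟨rfl, e⟩ := hj
    exact e.symm

lemma exists_prismGraph_of_not_feral {W : Type} {H : SimpleGraph W}
    (hH : ¬ Feral (fun n (G : SimpleGraph (Fin n)) => ¬ ContainsInducedSubdivision H G)) :
    ∃ k, ContainsInducedSubdivision H (prismGraph k) := by
  have hinj : ∀ k, Function.Injective fun x : Fin k → Fin 2 =>
      Set.range fun i => (i, (Fin.cons 0 (Fin.cons 1 x) : Fin (k + 2) → Fin 2) i) := by
    intro k x y hxy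
    have key : (Fin.cons 0 (Fin.cons 1 x) : Fin (k + 2) → Fin 2) = Fin.cons 0 (Fin.cons 1 y) := by
      ext1 i
      obtain ⟨j, hj⟩ := hxy.le ⟨i, rfl⟩
      rw [Prod.mk.injEq] at hj
      obtain ⟨rfl, e⟩ := hj
      exact e.symm
    exact Fin.cons_right_injective _ (Fin.cons_right_injective _ key)
  obtain ⟨k, hk⟩ := exists_contains_of_not_feral hH (fun k => prismGraph (k + 2))
    (fun k => by simp only [Fintype.card_prod, Fintype.card_fin]; omega) _ hinj
    fun k x => isMinimalSeparator_prismGraph _ (i₀ := 0) (i₁ := 1) rfl rfl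
  exact ⟨_, hk⟩

end manySeparators

section smallGraphs

variable {V W : Type} {G : SimpleGraph V} {H : SimpleGraph W}

lemma subdivideEdge_comm (H : SimpleGraph W) (u v : W) :
    subdivideEdge H u v = subdivideEdge H v u := by
  ext (_ | a) (_ | b)
  · simp
  · rw [subdivideEdge_adj_none, subdivideEdge_adj_none, or_comm]
  · rw [subdivideEdge_adj_none', subdivideEdge_adj_none', or_comm]
  · rw [subdivideEdge_adj_some, subdivideEdge_adj_some]
    tauto

/-- `P` and its complement are cliques, and the edges between them form a matching. -/
def MatchedCliques (G : SimpleGraph V) (P : Set V) : Prop :=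
  (∀ a ∈ P, ∀ b ∈ P, a ≠ b → G.Adj a b) ∧ (∀ a ∉ P, ∀ b ∉ P, a ≠ b → G.Adj a b) ∧
    (∀ a ∈ P, ∀ b ∉ P, ∀ b' ∉ P, G.Adj a b → G.Adj a b' → b = b') ∧
    ∀ a ∈ P, ∀ a' ∈ P, ∀ b ∉ P, G.Adj a b → G.Adj a' b → a = a'

/-- `w` has at most two neighbours, and all other vertices form a clique. -/
def CliquePlusVertex (G : SimpleGraph V) (w : V) : Prop :=
  (∀ a b, a ≠ w → b ≠ w → a ≠ b → G.Adj a b) ∧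
    ∀ p q r, G.Adj w p → G.Adj w q → G.Adj w r → p = q ∨ q = r ∨ p = r

/-- Two vertices `a, b, c` with at least three neighbours each cannot be distinct. -/
def AtMostTwoBranch (G : SimpleGraph V) : Prop :=
  ∀ t : Fin 3 → V, Function.Injective t →
    ¬ ∀ i, ∃ n : Fin 3 → V, Function.Injective n ∧ ∀ j, G.Adj (t i) (n j)

/-- Every nonempty set that misses some vertex and its neighbours has a vertex with at most one
neighbour in the set. -/
def NoAvoidedCycle (G : SimpleGraph V) : Prop :=
  ∀ (C : Set V) (w : V), w ∉ C → (∀ c ∈ C, ¬ G.Adj w c) → C.Nonempty →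
    ∃ c ∈ C, ∀ p ∈ C, ∀ q ∈ C, G.Adj c p → G.Adj c q → p = q

lemma MatchedCliques.compl {P : Set V} (h : MatchedCliques G P) : MatchedCliques G Pᶜ := by
  obtain ⟨h1, h2, h3, h4⟩ := h
  simp only [MatchedCliques, Set.mem_compl_iff, not_not]
  exact ⟨h2, h1, fun a ha b hb b' hb' e e' => h4 b hb b' hb' a ha e.symm e'.symm,
    fun a ha a' ha' b hb e e' => h3 b hb a ha a' ha' e.symm e'.symm⟩

lemma MatchedCliques.comap {P : Set V} (h : MatchedCliques G P) (f : H ↪g G) :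
    MatchedCliques H (f ⁻¹' P) := by
  obtain ⟨h1, h2, h3, h4⟩ := h
  refine ⟨fun a ha b hb e => f.map_adj_iff.1 (h1 _ ha _ hb (f.injective.ne e)),
    fun a ha b hb e => f.map_adj_iff.1 (h2 _ ha _ hb (f.injective.ne e)),
    fun a ha b hb b' hb' e e' => f.injective
      (h3 _ ha _ hb _ hb' (f.map_adj_iff.2 e) (f.map_adj_iff.2 e')),
    fun a ha a' ha' b hb e e' => f.injective
      (h4 _ ha _ ha' _ hb (f.map_adj_iff.2 e) (f.map_adj_iff.2 e'))⟩

lemma CliquePlusVertex.comap {w : W} (f : H ↪g G) (h : CliquePlusVertex G (f w)) :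
    CliquePlusVertex H w := by
  refine ⟨fun a b ha hb e => f.map_adj_iff.1 (h.1 _ _ (f.injective.ne ha) (f.injective.ne hb)
    (f.injective.ne e)), fun p q r hp hq hr => ?_⟩
  simpa only [f.injective.eq_iff] using
    h.2 _ _ _ (f.map_adj_iff.2 hp) (f.map_adj_iff.2 hq) (f.map_adj_iff.2 hr)

lemma matchedCliques_or_cliquePlusVertex_comap (f : H ↪g G)
    (h : (∃ P, MatchedCliques G P) ∨ ∃ w, CliquePlusVertex G w) :
    (∃ P, MatchedCliques H P) ∨ ∃ w, CliquePlusVertex H w := by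
  rcases h with ⟨P, h⟩ | ⟨w, h⟩
  · exact Or.inl ⟨_, h.comap f⟩
  · by_cases hw : ∃ v, f v = w
    · obtain ⟨v, rfl⟩ := hw
      exact Or.inr ⟨v, h.comap f⟩
    · push Not at hw
      refine Or.inl ⟨Set.univ, fun a _ b _ e => f.map_adj_iff.1
        (h.1 _ _ (hw a) (hw b) (f.injective.ne e)), ?_, ?_, ?_⟩ <;> simp

lemma AtMostTwoBranch.comap (h : AtMostTwoBranch G) (f : H ↪g G) : AtMostTwoBranch H := by
  intro t ht hn
  refine h (f ∘ t) (f.injective.comp ht) fun i => ?_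
  obtain ⟨n, hinj, hadj⟩ := hn i
  exact ⟨f ∘ n, f.injective.comp hinj, fun j => f.map_adj_iff.2 (hadj j)⟩

lemma NoAvoidedCycle.comap (h : NoAvoidedCycle G) (f : H ↪g G) : NoAvoidedCycle H := by
  intro C w hw hadj hC
  obtain ⟨_, ⟨c, hc, rfl⟩, hcc⟩ := h (f '' C) (f w) (fun e => hw (f.injective.mem_set_image.1 e))
    (by rintro _ ⟨c, hc, rfl⟩ e; exact hadj c hc (f.map_adj_iff.1 e)) (hC.image f)
  exact ⟨c, hc, fun p hp q hq e e' => f.injective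
    (hcc _ ⟨p, hp, rfl⟩ _ ⟨q, hq, rfl⟩ (f.map_adj_iff.2 e) (f.map_adj_iff.2 e'))⟩

lemma matchedCliques_or_cliquePlusVertex_of_subdivideEdge {u v : W} (huv : H.Adj u v)
    (h : (∃ P, MatchedCliques (subdivideEdge H u v) P) ∨
      ∃ w, CliquePlusVertex (subdivideEdge H u v) w) :
    ∃ w, CliquePlusVertex H w := by
  have hnadj : ¬ (subdivideEdge H u v).Adj (some u) (some v) := by
    simp [subdivideEdge_adj_some]
  rcases h with ⟨P, h⟩ | ⟨w, h⟩
  · wlog hP : none ∈ P generalizing P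
    · exact this Pᶜ h.compl hP
    wlog hu : some u ∈ P generalizing u v
    · by_cases hv : some v ∈ P
      · rw [subdivideEdge_comm] at h hnadj
        exact this huv.symm (fun e => hnadj e.symm) h hv
      · have := h.2.2.1 _ hP _ hu _ hv (subdivideEdge_adj_none.2 (Or.inl rfl))
          (subdivideEdge_adj_none.2 (Or.inr rfl))
        exact absurd (Option.some.inj this) huv.ne
    have hQ : ∀ a, a ≠ u → some a ∉ P := by
      intro a ha haP
      rcases subdivideEdge_adj_none.1 (h.1 _ hP _ haP (by simp)) with rfl | rfl
      · exact ha rfl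
      · exact hnadj (h.1 _ hu _ haP fun e => huv.ne (Option.some.inj e))
    refine ⟨u, fun a b ha hb e => (subdivideEdge_adj_some.1 (h.2.1 _ (hQ a ha) _ (hQ b hb)
      fun e' => e (Option.some.inj e'))).1, ?_⟩
    have key : ∀ p q, H.Adj u p → H.Adj u q → p ≠ v → q ≠ v → p = q := by
      intro p q hp hq hpv hqv
      refine Option.some.inj (h.2.2.1 _ hu _ (hQ p hp.ne') _ (hQ q hq.ne') ?_ ?_)
      · exact subdivideEdge_adj_some.2 ⟨hp, fun e => hpv e.2, fun e => huv.ne e.1⟩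
      · exact subdivideEdge_adj_some.2 ⟨hq, fun e => hqv e.2, fun e => huv.ne e.1⟩
    intro p q r hp hq hr
    have h1 := key p q hp hq
    have h2 := key q r hq hr
    have h3 := key p r hp hr
    by_cases e1 : p = v <;> by_cases e2 : q = v <;> by_cases e3 : r = v <;> simp_all
  · have hwn : w ≠ none := by
      rintro rfl
      exact hnadj (h.1 _ _ (by simp) (by simp) fun e => huv.ne (Option.some.inj e))
    have hother : ∀ a b : W, some a ≠ w → some b ≠ w → a = b := by
      intro a b ha hb
      by_contra hab
      have h1 := subdivideEdge_adj_none.1 (h.1 _ _ hwn.symm ha (by simp))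
      have h2 := subdivideEdge_adj_none.1 (h.1 _ _ hwn.symm hb (by simp))
      have h3 := h.1 _ _ ha hb fun e => hab (Option.some.inj e)
      rcases h1 with rfl | rfl <;> rcases h2 with rfl | rfl
      · exact hab rfl
      · exact hnadj h3
      · exact hnadj h3.symm
      · exact hab rfl
    obtain ⟨x, rfl⟩ := Option.ne_none_iff_exists'.1 hwn
    refine ⟨x, fun a b ha hb e => absurd (hother a b (by simpa) (by simpa)) e,
      fun p q r hp hq _ => Or.inl (hother p q ?_ ?_)⟩
    · simpa using hp.ne'
    · simpa using hq.ne'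

/-- The neighbour of `a` in `subdivideEdge H u v` on the (possibly subdivided) edge `ap`. -/
noncomputable def liftNeighbor (u v a p : W) : Option W :=
  open Classical in if (a = u ∧ p = v) ∨ (a = v ∧ p = u) then none else some p

lemma subdivideEdge_adj_liftNeighbor {u v a p : W} (h : H.Adj a p) :
    (subdivideEdge H u v).Adj (some a) (liftNeighbor u v a p) := by
  unfold liftNeighbor
  split_ifs with e
  · exact subdivideEdge_adj_none'.2 (e.imp And.left And.left)
  · exact subdivideEdge_adj_some.2 ⟨h, fun e' => e (Or.inl e'), fun e' => e (Or.inr e')⟩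

lemma liftNeighbor_injective {u v : W} (huv : u ≠ v) (a : W) :
    Function.Injective (liftNeighbor u v a) := by
  intro p q h
  unfold liftNeighbor at h
  split_ifs at h with e1 e2
  · rcases e1 with ⟨rfl, rfl⟩ | ⟨rfl, rfl⟩ <;> rcases e2 with ⟨e, rfl⟩ | ⟨e, rfl⟩ <;>
      first | rfl | exact absurd e huv | exact absurd e.symm huv
  · exact Option.some.inj h

lemma AtMostTwoBranch.of_subdivideEdge {u v : W} (huv : H.Adj u v)
    (h : AtMostTwoBranch (subdivideEdge H u v)) : AtMostTwoBranch H := by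
  intro t ht hn
  refine h (some ∘ t) ((Option.some_injective _).comp ht) fun i => ?_
  obtain ⟨n, hinj, hadj⟩ := hn i
  exact ⟨liftNeighbor u v (t i) ∘ n, (liftNeighbor_injective huv.ne _).comp hinj,
    fun j => subdivideEdge_adj_liftNeighbor (hadj j)⟩

lemma NoAvoidedCycle.of_subdivideEdge {u v : W} (huv : H.Adj u v)
    (h : NoAvoidedCycle (subdivideEdge H u v)) : NoAvoidedCycle H := by
  intro C w hw hadj hC
  by_contra! hcon
  have hmem : ∀ c ∈ C, ∀ p ∈ C, liftNeighbor u v c p ∈ some '' C ∪ {x | x = none ∧ u ∈ C ∧ v ∈ C}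
      := by
    intro c hc p hp
    unfold liftNeighbor
    split_ifs with e
    · rcases e with ⟨rfl, rfl⟩ | ⟨rfl, rfl⟩
      · exact Or.inr ⟨rfl, hc, hp⟩
      · exact Or.inr ⟨rfl, hp, hc⟩
    · exact Or.inl ⟨p, hp, rfl⟩
  obtain ⟨c, hc, hcc⟩ := h (some '' C ∪ {x | x = none ∧ u ∈ C ∧ v ∈ C}) (some w) (by simpa)
    (by
      rintro _ (⟨c, hc, rfl⟩ | ⟨rfl, hu, hv⟩) e
      · exact hadj c hc (subdivideEdge_adj_some.1 e).1
      · rcases subdivideEdge_adj_none'.1 e with rfl | rfl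
        · exact hw hu
        · exact hw hv) ((hC.image some).mono Set.subset_union_left)
  rcases hc with ⟨c, hc, rfl⟩ | ⟨rfl, hu, hv⟩
  · obtain ⟨p, hp, q, hq, hcp, hcq, hpq⟩ := hcon c hc
    exact hpq (liftNeighbor_injective huv.ne c (hcc _ (hmem c hc p hp) _ (hmem c hc q hq)
      (subdivideEdge_adj_liftNeighbor hcp) (subdivideEdge_adj_liftNeighbor hcq)))
  · exact huv.ne (Option.some.inj (hcc _ (Or.inl ⟨u, hu, rfl⟩) _ (Or.inl ⟨v, hv, rfl⟩)
      (subdivideEdge_adj_none.2 (Or.inl rfl)) (subdivideEdge_adj_none.2 (Or.inr rfl))))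

lemma matchedCliques_prismGraph (k : ℕ) : MatchedCliques (prismGraph k) {x | x.2 = 0} := by
  refine ⟨?_, ?_, ?_, ?_⟩
  · rintro ⟨a, _⟩ rfl ⟨b, _⟩ rfl h
    have h' : a ≠ b := by simpa using h
    simp [prismGraph, h']
  · rintro ⟨a, i⟩ hi ⟨b, j⟩ hj h
    obtain rfl : i = 1 := by simp at hi; omega
    obtain rfl : j = 1 := by simp at hj; omega
    have h' : a ≠ b := by simpa using h
    simp [prismGraph, h']
  · rintro ⟨a, _⟩ rfl ⟨b, i⟩ hi ⟨b', j⟩ hj h h'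
    obtain rfl : i = 1 := by simp at hi; omega
    obtain rfl : j = 1 := by simp at hj; omega
    simp [prismGraph] at h h' ⊢
    grind
  · rintro ⟨a, _⟩ rfl ⟨a', _⟩ rfl ⟨b, i⟩ hi h h'
    obtain rfl : i = 1 := by simp at hi; omega
    simp [prismGraph] at h h' ⊢
    grind

lemma exists_of_thetaGraph_adj_inr {k : ℕ} {i : Fin k} {j : Fin 2} {x : Fin 2 ⊕ Fin k × Fin 2}
    (h : (thetaGraph k).Adj (Sum.inr (i, j)) x) : x = Sum.inl j ∨ x = Sum.inr (i, j + 1) := by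
  rcases x with x | ⟨i', j'⟩
  · simp [thetaGraph] at h
    simp
    omega
  · simp [thetaGraph] at h
    simp
    omega

lemma atMostTwoBranch_thetaGraph (k : ℕ) : AtMostTwoBranch (thetaGraph k) := by
  intro t ht hn
  have key : ∀ i, ∃ j : Fin 2, t i = Sum.inl j := by
    intro i
    obtain ⟨n, hinj, hadj⟩ := hn i
    rcases hti : t i with j | ⟨a, j⟩
    · exact ⟨j, rfl⟩
    · rw [hti] at hadj
      have h0 := exists_of_thetaGraph_adj_inr (hadj 0)
      have h1 := exists_of_thetaGraph_adj_inr (hadj 1)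
      have h2 := exists_of_thetaGraph_adj_inr (hadj 2)
      have h01 : n 0 ≠ n 1 := hinj.ne (by decide)
      have h02 : n 0 ≠ n 2 := hinj.ne (by decide)
      have h12 : n 1 ≠ n 2 := hinj.ne (by decide)
      rcases h0 with h0 | h0 <;> rcases h1 with h1 | h1 <;> rcases h2 with h2 | h2 <;>
        exfalso <;> first
        | exact h01 (h0.trans h1.symm)
        | exact h02 (h0.trans h2.symm)
        | exact h12 (h1.trans h2.symm)
  choose s hs using key
  have : Function.Injective s := fun i j h => ht (by rw [hs, hs, h])
  simpa using Fintype.card_le_of_injective s this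

lemma noAvoidedCycle_thetaGraph (k : ℕ) : NoAvoidedCycle (thetaGraph k) := by
  intro C w hw hadj hC
  by_contra! hcon
  have hinr : ∀ i j, Sum.inr (i, j) ∈ C → Sum.inl j ∈ C ∧ Sum.inr (i, j + 1) ∈ C := by
    intro i j hc
    obtain ⟨p, hp, q, hq, hcp, hcq, hpq⟩ := hcon _ hc
    rcases exists_of_thetaGraph_adj_inr hcp with rfl | rfl <;>
      rcases exists_of_thetaGraph_adj_inr hcq with rfl | rfl
    · exact absurd rfl hpq
    · exact ⟨hp, hq⟩
    · exact ⟨hq, hp⟩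
    · exact absurd rfl hpq
  have hex : ∃ i j, Sum.inr (i, j) ∈ C := by
    obtain ⟨j | ⟨i, j⟩, hc⟩ := hC
    · obtain ⟨p, hp, -, -, hcp, -⟩ := hcon _ hc
      rcases p with p | ⟨i, j⟩
      · simp [thetaGraph] at hcp
      · exact ⟨i, j, hp⟩
    · exact ⟨i, j, hc⟩
  obtain ⟨i, j, hc⟩ := hex
  have hall : ∀ l : Fin 2, Sum.inl l ∈ C := by
    intro l
    by_cases h : l = j
    · exact h ▸ (hinr i j hc).1
    · have : l = j + 1 := by omega
      exact this ▸ (hinr i _ (hinr i j hc).2).1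
  rcases w with l | ⟨i, l⟩
  · exact hw (hall l)
  · refine hadj _ (hall l) ?_
    fin_cases l <;> simp [thetaGraph]

end smallGraphs

section classification

variable {W : Type} {H : SimpleGraph W}

lemma nonempty_embedding_of_labels {m : ℕ} {T : SimpleGraph (Fin m)} (L : Fin m → W → Prop)
    (hcover : ∀ w, ∃ i, L i w) (huniq : ∀ i w w', L i w → L i w' → w = w')
    (hadj : ∀ i j, i < j → ∀ w w', L i w → L j w' → (T.Adj i j ↔ H.Adj w w')) :
    Nonempty (H ↪g T) := by
  choose f hf using hcover
  refine nonempty_embedding (f := f) (fun a b e => huniq _ _ _ (hf a) (e ▸ hf b)) fun a b => ?_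
  rcases lt_trichotomy (f a) (f b) with h | h | h
  · exact hadj _ _ h _ _ (hf a) (hf b)
  · have hab : a = b := huniq _ _ _ (hf a) (h ▸ hf b)
    simp [hab]
  · rw [adj_comm, hadj _ _ h _ _ (hf b) (hf a), adj_comm]

lemma MatchedCliques.embeds_twoP2 {P : Set W} (h : MatchedCliques H P) {p q : W}
    (hp : ∀ a ∈ P, ∀ b ∈ P, a ≠ p → b ≠ p → a = b) (hq : ∀ a ∉ P, ∀ b ∉ P, a ≠ q → b ≠ q → a = b)
    (hno : ∀ a ∈ P, ∀ b ∉ P, ¬ H.Adj a b) : Nonempty (H ↪g twoP2) := by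
  obtain ⟨h1, h2, -, -⟩ := h
  refine nonempty_embedding_of_labels ![fun w => w ∈ P ∧ w = p, fun w => w ∈ P ∧ w ≠ p,
    fun w => w ∉ P ∧ w = q, fun w => w ∉ P ∧ w ≠ q] ?_ ?_ ?_
  · intro w
    simp only [Fin.exists_fin_succ]
    simp
    tauto
  · intro i w w'
    fin_cases i <;> simp <;> grind
  · intro i j hij w w'
    fin_cases i <;> fin_cases j <;> simp [twoP2] at hij ⊢ <;> grind

lemma MatchedCliques.embeds_house_of_path {P : Set W} (h : MatchedCliques H P) {p q : W}
    (hpP : p ∈ P) (hqP : q ∉ P) (hpq : H.Adj p q)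
    (hp : ∀ a ∈ P, ∀ b ∈ P, a ≠ p → b ≠ p → a = b) (hq : ∀ a ∉ P, ∀ b ∉ P, a ≠ q → b ≠ q → a = b)
    (hno : ∀ a ∈ P, ∀ b ∉ P, a ≠ p → b ≠ q → ¬ H.Adj a b) : Nonempty (H ↪g house) := by
  obtain ⟨h1, h2, h3, h4⟩ := h
  have hs : ∀ a b, H.Adj a b → H.Adj b a := fun a b e => e.symm
  refine nonempty_embedding_of_labels ![fun w => w = p, fun w => w = q,
    fun w => w ∉ P ∧ w ≠ q, fun _ => False, fun w => w ∈ P ∧ w ≠ p] ?_ ?_ ?_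
  · intro w
    simp only [Fin.exists_fin_succ]
    simp
    tauto
  · intro i w w'
    fin_cases i <;> simp <;> grind
  · intro i j hij w w'
    fin_cases i <;> fin_cases j <;> simp [house] at hij ⊢ <;> grind

lemma MatchedCliques.embeds_house {P : Set W} (h : MatchedCliques H P) {p p' q : W}
    (hpP : p ∈ P) (hp'P : p' ∈ P) (hne : p ≠ p') (hqP : q ∉ P) (hpq : H.Adj p q)
    (hp : ∀ a ∈ P, ∀ b ∈ P, a ≠ p → a ≠ p' → b ≠ p → b ≠ p' → a = b)
    (hq : ∀ a ∉ P, ∀ b ∉ P, a ≠ q → b ≠ q → a = b)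
    (hadj : ∀ b ∉ P, b ≠ q → H.Adj p' b) : Nonempty (H ↪g house) := by
  obtain ⟨h1, h2, h3, h4⟩ := h
  have hs : ∀ a b, H.Adj a b → H.Adj b a := fun a b e => e.symm
  refine nonempty_embedding_of_labels ![fun w => w = p, fun w => w = q,
    fun w => w ∉ P ∧ w ≠ q, fun w => w = p', fun w => w ∈ P ∧ w ≠ p ∧ w ≠ p'] ?_ ?_ ?_
  · intro w
    simp only [Fin.exists_fin_succ]
    simp
    tauto
  · intro i w w'
    fin_cases i <;> simp <;> grind
  · intro i j hij w w'
    fin_cases i <;> fin_cases j <;> simp [house] at hij ⊢ <;> grind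

lemma embeds_diamond {w x y : W} (hwx : H.Adj w x) (hwy : H.Adj w y) (hxy : x ≠ y)
    (hclique : ∀ a b, a ≠ w → b ≠ w → a ≠ b → H.Adj a b)
    (hw : ∀ a, a ≠ x → a ≠ y → ¬ H.Adj w a)
    (hsub : ∀ a b, a ≠ w → a ≠ x → a ≠ y → b ≠ w → b ≠ x → b ≠ y → a = b) :
    Nonempty (H ↪g diamond) := by
  have hx := hwx.ne
  have hy := hwy.ne
  have hs : ∀ a b, H.Adj a b → H.Adj b a := fun a b e => e.symm
  refine nonempty_embedding_of_labels ![fun v => v = w, fun v => v = x, fun v => v = y,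
    fun v => v ≠ w ∧ v ≠ x ∧ v ≠ y] ?_ ?_ ?_
  · intro v
    simp only [Fin.exists_fin_succ]
    simp
    tauto
  · intro i v v'
    fin_cases i
    · exact fun e e' => e.trans e'.symm
    · exact fun e e' => e.trans e'.symm
    · exact fun e e' => e.trans e'.symm
    · exact fun e e' => hsub _ _ e.1 e.2.1 e.2.2 e'.1 e'.2.1 e'.2.2
  · intro i j hij v v'
    fin_cases i <;> fin_cases j <;> simp [diamond] at hij ⊢ <;> grind

lemma injective_vec_three {a b c : W} (hab : a ≠ b) (hac : a ≠ c) (hbc : b ≠ c) :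
    Function.Injective ![a, b, c] := by
  intro i j
  fin_cases i <;> fin_cases j <;> simp [hab, hac, hbc, hab.symm, hac.symm, hbc.symm]

lemma AtMostTwoBranch.false_of_adj (h : AtMostTwoBranch H) {t : Fin 3 → W}
    (ht : Function.Injective t)
    (hn : ∀ i, ∃ a b c, a ≠ b ∧ a ≠ c ∧ b ≠ c ∧ H.Adj (t i) a ∧ H.Adj (t i) b ∧ H.Adj (t i) c) :
    False := by
  refine h t ht fun i => ?_
  obtain ⟨a, b, c, hab, hac, hbc, ha, hb, hc⟩ := hn i
  exact ⟨![a, b, c], injective_vec_three hab hac hbc, fun j => by fin_cases j <;> simp [ha, hb, hc]⟩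

lemma AtMostTwoBranch.eq_of_clique (h : AtMostTwoBranch H) {a b c d : W} (hab : H.Adj a b)
    (hac : H.Adj a c) (had : H.Adj a d) (hbc : H.Adj b c) (hbd : H.Adj b d) :
    ¬ H.Adj c d := by
  intro hcd
  refine h.false_of_adj (injective_vec_three hab.ne hac.ne hbc.ne) fun i => ?_
  fin_cases i
  · exact ⟨b, c, d, hbc.ne, hbd.ne, hcd.ne, hab, hac, had⟩
  · exact ⟨a, c, d, hac.ne, had.ne, hcd.ne, hab.symm, hbc, hbd⟩
  · exact ⟨a, b, d, hab.ne, had.ne, hbd.ne, hac.symm, hbc.symm, hcd⟩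

lemma NoAvoidedCycle.adj_of_triangle (h : NoAvoidedCycle H) {a b c w : W} (hab : H.Adj a b)
    (hac : H.Adj a c) (hbc : H.Adj b c) (ha : w ≠ a) (hb : w ≠ b) (hc : w ≠ c) :
    H.Adj w a ∨ H.Adj w b ∨ H.Adj w c := by
  by_contra! hcon
  obtain ⟨x, hx, hxx⟩ := h {a, b, c} w (by simp [ha, hb, hc]) (by simpa using hcon) ⟨a, by simp⟩
  simp only [Set.mem_insert_iff, Set.mem_singleton_iff] at hx
  rcases hx with rfl | rfl | rfl
  · exact hbc.ne (hxx b (by simp) c (by simp) hab hac)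
  · exact hac.ne (hxx a (by simp) c (by simp) hab.symm hbc)
  · exact hab.ne (hxx a (by simp) b (by simp) hac.symm hbc.symm)

lemma MatchedCliques.embeds_of_triangle {P : Set W} (h : MatchedCliques H P)
    (hD : AtMostTwoBranch H) (hR : NoAvoidedCycle H) {a b c : W} (ha : a ∈ P) (hb : b ∈ P)
    (hc : c ∈ P) (hab : a ≠ b) (hac : a ≠ c) (hbc : b ≠ c) :
    Nonempty (H ↪g diamond) ∨ Nonempty (H ↪g house) := by
  have h1 := h.1
  have h2 := h.2.1
  have h3 := h.2.2.1
  have h4 := h.2.2.2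
  have hP : ∀ p ∈ P, ∀ p' ∈ P, p ≠ p' → ∀ x ∈ P, ∀ y ∈ P, x ≠ p → x ≠ p' → y ≠ p → y ≠ p' →
      x = y := by
    intro p hp p' hp' hne x hx y hy hxp hxp' hyp hyp'
    by_contra hxy
    exact hD.eq_of_clique (h1 _ hp _ hp' hne) (h1 _ hp _ hx hxp.symm) (h1 _ hp _ hy hyp.symm)
      (h1 _ hp' _ hx hxp'.symm) (h1 _ hp' _ hy hyp'.symm) (h1 _ hx _ hy hxy)
  have hnbr : ∀ q ∉ P, ∃ p ∈ P, H.Adj p q := by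
    intro q hq
    rcases hR.adj_of_triangle (h1 _ ha _ hb hab) (h1 _ ha _ hc hac) (h1 _ hb _ hc hbc)
      (w := q) (fun e => hq (e ▸ ha)) (fun e => hq (e ▸ hb)) (fun e => hq (e ▸ hc)) with e | e | e
    · exact ⟨a, ha, e.symm⟩
    · exact ⟨b, hb, e.symm⟩
    · exact ⟨c, hc, e.symm⟩
  by_cases hQ : ∃ q, q ∉ P
  · right
    obtain ⟨q, hq⟩ := hQ
    obtain ⟨p, hp, hpq⟩ := hnbr q hq
    by_cases hQ' : ∃ q', q' ∉ P ∧ q' ≠ q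
    · obtain ⟨q', hq', hne⟩ := hQ'
      obtain ⟨p', hp', hpq'⟩ := hnbr q' hq'
      have hpp' : p ≠ p' := by
        rintro rfl
        exact hne (h3 _ hp _ hq' _ hq hpq' hpq)
      have huniq : ∀ x ∉ P, x ≠ q → x = q' := by
        intro x hx hxq
        by_contra hxq'
        obtain ⟨r, hr, hrx⟩ := hnbr x hx
        have hrp : r ≠ p := by
          rintro rfl
          exact hxq (h3 _ hr _ hx _ hq hrx hpq)
        have hrp' : r ≠ p' := by
          rintro rfl
          exact hxq' (h3 _ hr _ hx _ hq' hrx hpq')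
        have n1 : p' ≠ q := fun e => hq (e ▸ hp')
        have n2 : r ≠ q := fun e => hq (e ▸ hr)
        have n3 : p ≠ q' := fun e => hq' (e ▸ hp)
        have n4 : r ≠ q' := fun e => hq' (e ▸ hr)
        have n5 : p ≠ x := fun e => hx (e ▸ hp)
        have n6 : p' ≠ x := fun e => hx (e ▸ hp')
        refine hD.false_of_adj (injective_vec_three hpp' hrp.symm hrp'.symm) fun i => ?_
        fin_cases i
        · exact ⟨p', r, q, hrp'.symm, n1, n2, h1 _ hp _ hp' hpp', h1 _ hp _ hr hrp.symm, hpq⟩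
        · exact ⟨p, r, q', hrp.symm, n3, n4, h1 _ hp' _ hp hpp'.symm, h1 _ hp' _ hr hrp'.symm,
            hpq'⟩
        · exact ⟨p, p', x, hpp', n5, n6, h1 _ hr _ hp hrp, h1 _ hr _ hp' hrp', hrx⟩
      exact h.embeds_house hp hp' hpp' hq hpq (hP p hp p' hp' hpp')
        (fun x hx y hy hxq hyq => (huniq x hx hxq).trans (huniq y hy hyq).symm)
        fun x hx hxq => huniq x hx hxq ▸ hpq'
    · push Not at hQ'
      obtain ⟨p', hp', hpp'⟩ : ∃ p' ∈ P, p ≠ p' := by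
        by_cases e : p = a
        · exact ⟨b, hb, e ▸ hab⟩
        · exact ⟨a, ha, e⟩
      exact h.embeds_house hp hp' hpp' hq hpq (hP p hp p' hp' hpp')
        (fun x hx y hy hxq => absurd (hQ' x hx) hxq) fun x hx hxq => absurd (hQ' x hx) hxq
  · push Not at hQ
    left
    have hall : ∀ x, x ≠ a → x ≠ b → x = c := fun x hxa hxb =>
      hP a ha b hb hab x (hQ x) c hc hxa hxb hac.symm hbc.symm
    exact embeds_diamond (h1 _ ha _ hb hab) (h1 _ ha _ hc hac) hbc
      (fun x y _ _ e => h1 _ (hQ x) _ (hQ y) e)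
      (fun x hxb hxc e => hxc (hall x e.ne' hxb)) fun x y hxa hxb hxc => absurd (hall x hxa hxb) hxc

lemma MatchedCliques.embeds {P : Set W} (h : MatchedCliques H P)
    (hD : AtMostTwoBranch H) (hR : NoAvoidedCycle H) :
    Nonempty (H ↪g twoP2) ∨ Nonempty (H ↪g diamond) ∨ Nonempty (H ↪g house) := by
  by_cases hP : ∃ a ∈ P, ∃ b ∈ P, ∃ c ∈ P, a ≠ b ∧ a ≠ c ∧ b ≠ c
  · obtain ⟨a, ha, b, hb, c, hc, hab, hac, hbc⟩ := hP
    exact Or.inr (h.embeds_of_triangle hD hR ha hb hc hab hac hbc)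
  by_cases hQ : ∃ a ∉ P, ∃ b ∉ P, ∃ c ∉ P, a ≠ b ∧ a ≠ c ∧ b ≠ c
  · obtain ⟨a, ha, b, hb, c, hc, hab, hac, hbc⟩ := hQ
    exact Or.inr (h.compl.embeds_of_triangle hD hR ha hb hc hab hac hbc)
  have hP' : ∀ p ∈ P, ∀ a ∈ P, ∀ b ∈ P, a ≠ p → b ≠ p → a = b := by
    intro p hp a ha b hb hap hbp
    by_contra hab
    exact hP ⟨a, ha, b, hb, p, hp, hab, hap, hbp⟩
  have hQ' : ∀ p ∉ P, ∀ a ∉ P, ∀ b ∉ P, a ≠ p → b ≠ p → a = b := by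
    intro p hp a ha b hb hap hbp
    by_contra hab
    exact hQ ⟨a, ha, b, hb, p, hp, hab, hap, hbp⟩
  by_cases hedge : ∃ p ∈ P, ∃ q ∉ P, H.Adj p q
  · obtain ⟨p, hp, q, hq, hpq⟩ := hedge
    refine Or.inr (Or.inr ?_)
    by_cases hedge' : ∃ p' ∈ P, ∃ q' ∉ P, p' ≠ p ∧ q' ≠ q ∧ H.Adj p' q'
    · obtain ⟨p', hp', q', hq', hpp', hqq', hpq'⟩ := hedge'
      exact h.embeds_house hp hp' hpp'.symm hq hpq
        (fun x hx y hy hxp _ hyp _ => hP' p hp x hx y hy hxp hyp) (hQ' q hq)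
        fun x hx hxq => hQ' q hq x hx q' hq' hxq hqq' ▸ hpq'
    · exact h.embeds_house_of_path hp hq hpq (hP' p hp) (hQ' q hq)
        fun x hx y hy hxp hyq e => hedge' ⟨x, hx, y, hy, hxp, hyq, e⟩
  · have hno : ∀ a ∈ P, ∀ b ∉ P, ¬ H.Adj a b := fun a ha b hb e => hedge ⟨a, ha, b, hb, e⟩
    left
    rcases isEmpty_or_nonempty W with _ | ⟨⟨w⟩⟩
    · exact nonempty_embedding (f := isEmptyElim) (fun x => isEmptyElim x) fun x => isEmptyElim x
    · have hex : ∀ Q : Set W, (∀ p ∈ Q, ∀ a ∈ Q, ∀ b ∈ Q, a ≠ p → b ≠ p → a = b) →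
          ∃ p, ∀ a ∈ Q, ∀ b ∈ Q, a ≠ p → b ≠ p → a = b := by
        intro Q hQ
        by_cases hne : ∃ p, p ∈ Q
        · exact ⟨_, hQ _ hne.choose_spec⟩
        · exact ⟨w, fun a ha => absurd ⟨a, ha⟩ hne⟩
      obtain ⟨p, hp⟩ := hex P hP'
      obtain ⟨q, hq⟩ := hex Pᶜ hQ'
      exact h.embeds_twoP2 hp hq hno

lemma CliquePlusVertex.embeds {w : W} (h : CliquePlusVertex H w)
    (hD : AtMostTwoBranch H) (hR : NoAvoidedCycle H) :
    Nonempty (H ↪g twoP2) ∨ Nonempty (H ↪g diamond) ∨ Nonempty (H ↪g house) := by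
  obtain ⟨h1, h2⟩ := h
  by_cases hxy : ∃ x y, H.Adj w x ∧ H.Adj w y ∧ x ≠ y
  · obtain ⟨x, y, hx, hy, hne⟩ := hxy
    refine Or.inr (Or.inl (embeds_diamond hx hy hne h1 (fun a hax hay ha => ?_) ?_))
    · rcases h2 x y a hx hy ha with e | e | e
      · exact hne e
      · exact hay e.symm
      · exact hax e.symm
    · intro a b haw hax hay hbw hbx hby
      by_contra hab
      exact hD.eq_of_clique (h1 _ _ hx.ne' hy.ne' hne) (h1 _ _ hx.ne' haw hax.symm)
        (h1 _ _ hx.ne' hbw hbx.symm) (h1 _ _ hy.ne' haw hay.symm) (h1 _ _ hy.ne' hbw hby.symm)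
        (h1 _ _ haw hbw hab)
  · refine MatchedCliques.embeds (P := {w}) ⟨?_, ?_, ?_, ?_⟩ hD hR
    · rintro a rfl b rfl e
      exact absurd rfl e
    · exact fun a ha b hb e => h1 a b ha hb e
    · rintro a rfl b - b' - e e'
      by_contra hne
      exact hxy ⟨b, b', e, e', hne⟩
    · rintro a rfl a' rfl - - - -
      rfl

lemma matchedCliques_or_cliquePlusVertex_of_subdivision {B : Type} {K : SimpleGraph B}
    (hs : Subdivision H K) (h : (∃ P, MatchedCliques K P) ∨ ∃ w, CliquePlusVertex K w) :
    (∃ P, MatchedCliques H P) ∨ ∃ w, CliquePlusVertex H w := by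
  induction hs with
  | refl => exact h
  | step _ huv ih =>
    exact ih (Or.inr (matchedCliques_or_cliquePlusVertex_of_subdivideEdge huv h))

lemma AtMostTwoBranch.of_subdivision {B : Type} {K : SimpleGraph B}
    (hs : Subdivision H K) (h : AtMostTwoBranch K) : AtMostTwoBranch H := by
  induction hs with
  | refl => exact h
  | step _ huv ih => exact ih (h.of_subdivideEdge huv)

lemma NoAvoidedCycle.of_subdivision {B : Type} {K : SimpleGraph B}
    (hs : Subdivision H K) (h : NoAvoidedCycle K) : NoAvoidedCycle H := by
  induction hs with
  | refl => exact h
  | step _ huv ih => exact ih (h.of_subdivideEdge huv)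

lemma embeds_of_not_feral
    (hH : ¬ Feral (fun n (G : SimpleGraph (Fin n)) => ¬ ContainsInducedSubdivision H G)) :
    Nonempty (H ↪g twoP2) ∨ Nonempty (H ↪g diamond) ∨ Nonempty (H ↪g house) := by
  obtain ⟨k, B, K, hs, ⟨f⟩⟩ := exists_thetaGraph_of_not_feral hH
  have hD := ((atMostTwoBranch_thetaGraph k).comap f).of_subdivision hs
  have hR := ((noAvoidedCycle_thetaGraph k).comap f).of_subdivision hs
  obtain ⟨l, B', K', hs', ⟨f'⟩⟩ := exists_prismGraph_of_not_feral hH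
  rcases matchedCliques_or_cliquePlusVertex_of_subdivision hs'
    (matchedCliques_or_cliquePlusVertex_comap f' (Or.inl ⟨_, matchedCliques_prismGraph l⟩)) with
    ⟨P, h⟩ | ⟨w, h⟩
  · exact h.embeds hD hR
  · exact h.embeds hD hR

end classification

theorem dichotomy_induced_subdivision {W : Type} [Fintype W] (H : SimpleGraph W) :
    List.TFAE
      [ Tame (fun n (G : SimpleGraph (Fin n)) => ¬ ContainsInducedSubdivision H G),
        ¬ Feral (fun n (G : SimpleGraph (Fin n)) => ¬ ContainsInducedSubdivision H G),
        Nonempty (H ↪g twoP2) ∨ Nonempty (H ↪g diamond) ∨ Nonempty (H ↪g house),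
        ContainsInducedSubdivision H twoP2 ∨ ContainsInducedSubdivision H house ] := by
  tfae_have 1 → 2 := Tame.not_feral
  tfae_have 2 → 3 := embeds_of_not_feral
  tfae_have 3 → 4 := contained_of_embedding
  tfae_have 4 → 1 := tame_of_contained
  tfae_finish
end

section
/- Let H be a finite simple graph, let W be a thin walk in H, and suppose H is an induced minor of a finite simple graph G. Then there exists an induced minor model {X_v}_{v∈V(H)} of H in G such that |X_w| = 1 for every internal vertex w of W. -/
open SimpleGraph

/-- Growing a connected set `A` along a walk until it first becomes adjacent to a vertex of `B`. -/
theorem exists_connected_superset_adj_of_walk {V : Type} (G : SimpleGraph V) (B : Set V)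
    {s t : V} (q : G.Walk s t) (ht : t ∈ B) (A : Set V) (hA : (G.induce A).Connected)
    (hs : ∃ a ∈ A, G.Adj a s) :
    ∃ (A' : Set V) (c : V), A ⊆ A' ∧ (∀ z ∈ A', z ∉ A → z ∈ q.support ∧ z ∉ B) ∧
      (G.induce A').Connected ∧ c ∈ q.support ∧ c ∈ B ∧ ∃ a ∈ A', G.Adj a c := by
  induction q generalizing A with
  | nil => exact ⟨A, _, subset_rfl, fun z hz hz' => absurd hz hz', hA, by simp, ht, hs⟩
  | @cons s r t h q ih =>
    by_cases hsB : s ∈ B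
    · exact ⟨A, s, subset_rfl, fun z hz hz' => absurd hz hz', hA, by simp, hsB, hs⟩
    obtain ⟨a, ha, has⟩ := hs
    have hconn : (G.induce (A ∪ {s})).Connected := by
      have := induce_union_connected hA.preconnected
        (induce_pair_connected_of_adj has).preconnected ⟨a, ha, by simp⟩
      rwa [Set.union_insert, Set.insert_eq_of_mem (Set.mem_union_left _ ha)] at this
    obtain ⟨A', c, hAA', hA', hc, hcq, hcB, hadj⟩ :=
      ih ht (A ∪ {s}) hconn ⟨s, by simp, h⟩
    refine ⟨A', c, fun z hz => hAA' (Or.inl hz), fun z hz hzA => ?_, hc, by simp [hcq], hcB, hadj⟩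
    by_cases hzs : z = s
    · subst hzs
      exact ⟨by simp, hsB⟩
    · obtain ⟨h₁, h₂⟩ := hA' z hz (by simp [hzA, hzs])
      exact ⟨by simp [h₁], h₂⟩

/-- The branch set of a vertex `v` of degree two can be shrunk to a singleton by enlarging the
branch set of one prescribed neighbor `a` and leaving all the others unchanged. -/
theorem IsInducedMinorModel.exists_singleton {V W : Type} {G : SimpleGraph V} {H : SimpleGraph W}
    {X : W → Set V} (hX : IsInducedMinorModel G H X) {a v : W} (hav : H.Adj a v)
    (hv : (H.neighborSet v).ncard = 2) :
    ∃ X' : W → Set V, IsInducedMinorModel G H X' ∧ (X' v).ncard = 1 ∧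
      ∀ u, u ≠ a → u ≠ v → X' u = X u := by
  classical
  obtain ⟨hne, hconn, hdisj, hadj, hnadj⟩ := hX
  obtain ⟨b, hab, hN⟩ : ∃ b, a ≠ b ∧ H.neighborSet v = {a, b} := by
    obtain ⟨c, d, hcd, hN⟩ := Set.ncard_eq_two.1 hv
    have : a ∈ H.neighborSet v := hav.symm
    rw [hN] at this
    rcases this with rfl | rfl
    · exact ⟨d, hcd, hN⟩
    · exact ⟨c, hcd.symm, by rw [hN, Set.pair_comm]⟩
  have hNv : ∀ u, H.Adj v u ↔ u = a ∨ u = b := fun u => by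
    rw [← mem_neighborSet, hN]; simp
  have hvb : H.Adj v b := (hNv b).2 (Or.inr rfl)
  obtain ⟨a₀, ha₀, s, hs, hs'⟩ := hadj a v hav
  obtain ⟨t, ht, b₀, hb₀, ht'⟩ := hadj v b hvb
  obtain ⟨q⟩ := (hconn v).preconnected ⟨s, hs⟩ ⟨t, ht⟩
  let q' := q.map (Embedding.induce (G := G) (X v)).toHom
  have hq : ∀ z ∈ q'.support, z ∈ X v := by
    intro z hz
    simp only [q', Walk.support_map, List.mem_map] at hz
    obtain ⟨z', -, rfl⟩ := hz
    exact z'.2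
  obtain ⟨A', c, hAA', hA', hA'c, hcq, ⟨b₁, hb₁, hcb⟩, a₁, ha₁, hac⟩ :=
    exists_connected_superset_adj_of_walk G {z | ∃ b' ∈ X b, G.Adj z b'} q'
      ⟨b₀, hb₀, ht'⟩ (X a) (hconn a) ⟨a₀, ha₀, hs'⟩
  have hcv : c ∈ X v := hq c hcq
  have hcA : c ∉ A' := fun h =>
    (hA' c h fun h' => Set.disjoint_left.1 (hdisj hav.ne) h' hcv).2 ⟨b₁, hb₁, hcb⟩
  have hA'sub : ∀ z ∈ A', z ∈ X a ∨ z ∈ X v := fun z hz => by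
    by_cases h : z ∈ X a
    · exact Or.inl h
    · exact Or.inr (hq z (hA' z hz h).1)
  have hA'other : ∀ u, u ≠ a → u ≠ v → ∀ z ∈ A', z ∉ X u := by
    intro u hua huv z hz hzu
    rcases hA'sub z hz with h | h
    · exact Set.disjoint_left.1 (hdisj hua) hzu h
    · exact Set.disjoint_left.1 (hdisj huv) hzu h
  have hA'nadj : ∀ u, u ≠ a → u ≠ v → ¬ H.Adj a u → ∀ z ∈ A', ∀ y ∈ X u, ¬ G.Adj z y := by
    intro u hua huv hau z hz y hy hzy
    by_cases hza : z ∈ X a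
    · exact hnadj a u hua.symm hau z hza y hy hzy
    · obtain ⟨hzq, hzB⟩ := hA' z hz hza
      by_cases hub : u = b
      · subst hub
        exact hzB ⟨y, hy, hzy⟩
      · exact hnadj v u huv.symm (by simp [hNv, hua, hub]) z (hq z hzq) y hy hzy
  have hva : v ≠ a := hav.ne'
  have hbv : b ≠ v := hvb.ne'
  let X' : W → Set V := fun u => if u = a then A' else if u = v then {c} else X u
  have hX'a : X' a = A' := by simp [X']
  have hX'v : X' v = {c} := by simp [X', hva]
  have hX' : ∀ u, u ≠ a → u ≠ v → X' u = X u := fun u h₁ h₂ => by simp [X', h₁, h₂]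
  have hcases : ∀ u, u = a ∨ u = v ∨ (u ≠ a ∧ u ≠ v) := fun u => by tauto
  refine ⟨X', ⟨?_, ?_, ?_, ?_, ?_⟩, by simp [hX'v], hX'⟩
  · intro u
    rcases hcases u with rfl | rfl | ⟨h₁, h₂⟩
    · rw [hX'a]; exact ⟨a₁, ha₁⟩
    · rw [hX'v]; exact ⟨c, rfl⟩
    · rw [hX' u h₁ h₂]; exact hne u
  · intro u
    rcases hcases u with rfl | rfl | ⟨h₁, h₂⟩
    · rw [hX'a]; exact hA'c
    · rw [hX'v]
      exact ⟨Preconnected.of_subsingleton⟩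
    · rw [hX' u h₁ h₂]; exact hconn u
  · intro u w huw
    rw [Set.disjoint_left]
    intro z hzu hzw
    rcases hcases u with rfl | rfl | ⟨h₁, h₂⟩ <;> rcases hcases w with rfl | rfl | ⟨h₃, h₄⟩
    · exact huw rfl
    · rw [hX'a] at hzu
      rw [hX'v] at hzw
      exact hcA (hzw ▸ hzu)
    · rw [hX'a] at hzu
      rw [hX' w h₃ h₄] at hzw
      exact hA'other w h₃ h₄ z hzu hzw
    · rw [hX'a] at hzw
      rw [hX'v] at hzu
      exact hcA (hzu ▸ hzw)
    · exact huw rfl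
    · rw [hX'v] at hzu
      rw [hX' w h₃ h₄] at hzw
      exact Set.disjoint_left.1 (hdisj huw) hcv (hzu ▸ hzw)
    · rw [hX'a] at hzw
      rw [hX' u h₁ h₂] at hzu
      exact hA'other u h₁ h₂ z hzw hzu
    · rw [hX'v] at hzw
      rw [hX' u h₁ h₂] at hzu
      exact Set.disjoint_left.1 (hdisj huw) (hzw ▸ hzu) hcv
    · rw [hX' u h₁ h₂] at hzu
      rw [hX' w h₃ h₄] at hzw
      exact Set.disjoint_left.1 (hdisj huw) hzu hzw
  · have hA'adj : ∀ u, u ≠ a → u ≠ v → H.Adj a u → ∃ z ∈ A', ∃ y ∈ X u, G.Adj z y :=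
      fun u _ _ hau => by
        obtain ⟨z, hz, y, hy, hzy⟩ := hadj a u hau
        exact ⟨z, hAA' hz, y, hy, hzy⟩
    intro u w huw
    rcases hcases u with rfl | rfl | ⟨h₁, h₂⟩ <;> rcases hcases w with rfl | rfl | ⟨h₃, h₄⟩
    · exact absurd rfl huw.ne
    · rw [hX'a, hX'v]; exact ⟨a₁, ha₁, c, rfl, hac⟩
    · rw [hX'a, hX' w h₃ h₄]; exact hA'adj w h₃ h₄ huw
    · rw [hX'a, hX'v]; exact ⟨c, rfl, a₁, ha₁, hac.symm⟩
    · exact absurd rfl huw.ne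
    · obtain rfl : w = b := ((hNv w).1 huw).resolve_left h₃
      rw [hX'v, hX' w h₃ h₄]; exact ⟨c, rfl, b₁, hb₁, hcb⟩
    · obtain ⟨z, hz, y, hy, hzy⟩ := hA'adj u h₁ h₂ huw.symm
      rw [hX'a, hX' u h₁ h₂]; exact ⟨y, hy, z, hz, hzy.symm⟩
    · obtain rfl : u = b := ((hNv u).1 huw.symm).resolve_left h₁
      rw [hX'v, hX' u h₁ h₂]; exact ⟨b₁, hb₁, c, rfl, hcb.symm⟩
    · rw [hX' u h₁ h₂, hX' w h₃ h₄]; exact hadj u w huw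
  · intro u w hne' huw z hz y hy hzy
    rcases hcases u with rfl | rfl | ⟨h₁, h₂⟩ <;> rcases hcases w with rfl | rfl | ⟨h₃, h₄⟩
    · exact hne' rfl
    · exact huw hav
    · rw [hX'a] at hz
      rw [hX' w h₃ h₄] at hy
      exact hA'nadj w h₃ h₄ huw z hz y hy hzy
    · exact huw hav.symm
    · exact hne' rfl
    · rw [hX'v] at hz
      rw [hX' w h₃ h₄] at hy
      exact hnadj u w hne' huw z (hz ▸ hcv) y hy hzy
    · rw [hX'a] at hy
      rw [hX' u h₁ h₂] at hz
      exact hA'nadj u h₁ h₂ (fun h => huw h.symm) y hy z hz hzy.symm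
    · rw [hX'v] at hy
      rw [hX' u h₁ h₂] at hz
      exact hnadj u w hne' huw z hz y (hy ▸ hcv) hzy
    · rw [hX' u h₁ h₂] at hz
      rw [hX' w h₃ h₄] at hy
      exact hnadj u w hne' huw z hz y hy hzy

theorem thin_walk_singleton_model {V W : Type} [Fintype V] [Fintype W]
    (H : SimpleGraph W) (G : SimpleGraph V) {x y : W} (p : H.Walk x y)
    (hp : IsThinWalk H p) (h : InducedMinor H G) :
    ∃ X : W → Set V, IsInducedMinorModel G H X ∧
      ∀ w ∈ p.support.tail.dropLast, (X w).ncard = 1 := by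
  induction p with
  | nil =>
    obtain ⟨X, hX⟩ := h
    exact ⟨X, hX, by simp⟩
  | @cons x v y hxv q ih =>
    obtain ⟨hp₁, hp₂, hp₃⟩ := hp
    cases q with
    | nil =>
      obtain ⟨X, hX⟩ := h
      exact ⟨X, hX, by simp⟩
    | @cons _ r _ hvr q =>
      have hq : q.support ≠ [] := q.support_ne_nil
      simp only [Walk.support_cons, List.tail_cons, List.dropLast_cons_of_ne_nil hq,
        List.dropLast_cons_of_ne_nil (List.cons_ne_nil _ _), List.nodup_cons,
        List.mem_cons, not_or] at hp₁ hp₂ hp₃ ih ⊢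
      obtain ⟨X, hX, hXq⟩ := ih ⟨hp₁.2, by
        simpa only [Walk.support_cons, List.dropLast_cons_of_ne_nil hq, List.nodup_cons]
          using hp₂.2, fun w hw => hp₃ w (Or.inr hw)⟩
      obtain ⟨X', hX', hv, hother⟩ := hX.exists_singleton hxv (hp₃ v (Or.inl rfl))
      refine ⟨X', hX', ?_⟩
      rintro w (rfl | hw)
      · exact hv
      · rw [hother w (fun h => hp₂.1.2 (h ▸ hw)) (fun h => hp₂.2.1 (h ▸ hw))]
        exact hXq w hw
end
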